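/- arXiv:1606.00860 — 2 statements merged into one kernel-verified Lean document; each statement's English description precedes it below -/
import Mathlib

section
/- Let 0 < ξ ≤ 1/2, let ℓ ≥ 2 be an integer, N a sufficiently large integer and L = log N. Then ∫_{−ξ}^{ξ} |ω_ℓ(α)|² dα ≪_ℓ ξ N^{1/ℓ} + L if ℓ = 2 and ≪_ℓ ξ N^{1/ℓ} + 1 if ℓ > 2; moreover ∫_{−ξ}^{ξ} |S̃_ℓ(α)|² dα ≪_ℓ ξ N^{1/ℓ} L + L² if ℓ = 2 and ≪_ℓ ξ N^{1/ℓ} L + 1 if ℓ > 2. -/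
open Complex MeasureTheory

/-- `S̃_ℓ(α) = ∑_{n=1}^∞ Λ(n) e^{−n^ℓ/N} e(n^ℓ α)`, with `e(x) = exp(2πix)`. -/
noncomputable def Stilde (N ℓ : ℕ) (α : ℝ) : ℂ :=
  ∑' n : ℕ, (ArithmeticFunction.vonMangoldt n : ℂ) *
    Complex.exp (-(n : ℂ) ^ ℓ / N) *
    Complex.exp (2 * Real.pi * Complex.I * (n : ℂ) ^ ℓ * α)

/-- `ω_ℓ(α) = ∑_{m=1}^∞ e^{−m^ℓ/N} e(m^ℓ α)`. -/
noncomputable def omegal (N ℓ : ℕ) (α : ℝ) : ℂ :=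
  ∑' m : ℕ+, Complex.exp (-(m : ℂ) ^ ℓ / N) *
    Complex.exp (2 * Real.pi * Complex.I * (m : ℂ) ^ ℓ * α)

open scoped ArithmeticFunction.vonMangoldt

lemma integrable_gaussian_mul_cos {ξ : ℝ} (hξ : 0 < ξ) (k : ℝ) :
    Integrable fun α : ℝ => Real.exp (-(1 / ξ ^ 2) * α ^ 2) * Real.cos (2 * Real.pi * k * α) := by
  refine (integrable_exp_neg_mul_sq (b := 1 / ξ ^ 2) (by positivity)).mono' (by fun_prop) ?_
  filter_upwards with α
  rw [norm_mul, Real.norm_eq_abs, Real.norm_eq_abs, abs_of_pos (Real.exp_pos _)]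
  exact mul_le_of_le_one_right (Real.exp_pos _).le (Real.abs_cos_le_one _)

lemma integral_gaussian_mul_cos_le {ξ : ℝ} (hξ : 0 < ξ) (k : ℝ) :
    ∫ α : ℝ, Real.exp (-(1 / ξ ^ 2) * α ^ 2) * Real.cos (2 * Real.pi * k * α) ≤
      4 * ξ * Real.exp (-(ξ * |k|)) := by
  have hb : 0 < ((1 / ξ ^ 2 : ℝ) : ℂ).re := by rw [ofReal_re]; positivity
  have hF := fourierIntegral_gaussian hb ((2 * Real.pi * k : ℝ) : ℂ)
  have hint : Integrable fun x : ℝ => cexp (I * ((2 * Real.pi * k : ℝ) : ℂ) * x) *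
      cexp (-((1 / ξ ^ 2 : ℝ) : ℂ) * x ^ 2) := by
    have := integrable_cexp_quadratic hb (I * ((2 * Real.pi * k : ℝ) : ℂ)) 0
    refine this.congr (Filter.Eventually.of_forall fun x => ?_)
    simp only
    rw [← Complex.exp_add]; ring_nf
  have hre := reCLM.integral_comp_comm hint
  have hpt : ∀ x : ℝ, reCLM (cexp (I * ((2 * Real.pi * k : ℝ) : ℂ) * x) *
      cexp (-((1 / ξ ^ 2 : ℝ) : ℂ) * x ^ 2)) =
      Real.exp (-(1 / ξ ^ 2) * x ^ 2) * Real.cos (2 * Real.pi * k * x) := by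
    intro x
    have h1 : cexp (-((1 / ξ ^ 2 : ℝ) : ℂ) * x ^ 2) =
        ((Real.exp (-(1 / ξ ^ 2) * x ^ 2) : ℝ) : ℂ) := by push_cast; rfl
    have h2 : I * ((2 * Real.pi * k : ℝ) : ℂ) * x = ((2 * Real.pi * k * x : ℝ) : ℂ) * I := by
      push_cast; ring
    rw [h1, h2, reCLM_apply, re_mul_ofReal, exp_ofReal_mul_I_re, mul_comm]
  simp_rw [hpt] at hre
  rw [hre, hF, reCLM_apply]
  refine (re_le_norm _).trans ?_
  rw [norm_mul, Complex.norm_exp, ← ofReal_div,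
    norm_cpow_eq_rpow_re_of_pos (by positivity)]
  have h1 : (Real.pi / (1 / ξ ^ 2)) ^ ((1 / 2 : ℂ)).re ≤ 2 * ξ := by
    have : ((1 / 2 : ℂ)).re = 1 / 2 := by norm_num
    rw [this, ← Real.sqrt_eq_rpow]
    apply Real.sqrt_le_iff.2 ⟨by positivity, ?_⟩
    have := Real.pi_le_four
    rw [div_div_eq_mul_div, div_one]
    nlinarith [sq_nonneg ξ]
  have h2 : (-((2 * Real.pi * k : ℝ) : ℂ) ^ 2 / (4 * ((1 / ξ ^ 2 : ℝ) : ℂ))).re =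
      -(Real.pi ^ 2 * (ξ * |k|) ^ 2) := by
    rw [← ofReal_pow, ← ofReal_neg, ← ofReal_ofNat 4, ← ofReal_mul, ← ofReal_div, ofReal_re,
      mul_pow ξ, sq_abs]
    field_simp
    ring
  have h3 : Real.exp (-(Real.pi ^ 2 * (ξ * |k|) ^ 2)) ≤ 2 * Real.exp (-(ξ * |k|)) := by
    nth_rw 1 [← Real.exp_log (show (0 : ℝ) < 2 by norm_num)]
    rw [← Real.exp_add]
    apply Real.exp_le_exp.2
    have := Real.log_two_gt_d9
    have hpi : 1 ≤ Real.pi ^ 2 := by nlinarith [Real.pi_gt_three]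
    nlinarith [sq_nonneg (ξ * |k| - 1 / 2), sq_nonneg (ξ * |k|)]
  rw [h2]
  calc _ ≤ (2 * ξ) * (2 * Real.exp (-(ξ * |k|))) := by gcongr
    _ = _ := by ring

lemma norm_sq_sum_mul_exp (s : Finset ℕ) (a ν : ℕ → ℝ) (α : ℝ) :
    ‖∑ n ∈ s, (a n : ℂ) * cexp (2 * Real.pi * I * ν n * α)‖ ^ 2 =
      ∑ n ∈ s, ∑ m ∈ s, a n * a m * Real.cos (2 * Real.pi * (ν n - ν m) * α) := by
  have h : ∀ n, (a n : ℂ) * cexp (2 * Real.pi * I * ν n * α) =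
      (a n : ℂ) * cexp ((2 * Real.pi * ν n * α : ℝ) * I) := by
    intro n; push_cast; ring_nf
  simp_rw [h]
  rw [Complex.sq_norm, normSq_apply, re_sum, im_sum, Finset.sum_mul_sum, Finset.sum_mul_sum,
    ← Finset.sum_add_distrib]
  refine Finset.sum_congr rfl fun n _ => ?_
  rw [← Finset.sum_add_distrib]
  refine Finset.sum_congr rfl fun m _ => ?_
  rw [re_ofReal_mul, re_ofReal_mul, im_ofReal_mul, im_ofReal_mul, exp_ofReal_mul_I_re,
    exp_ofReal_mul_I_re, exp_ofReal_mul_I_im, exp_ofReal_mul_I_im,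
    show 2 * Real.pi * (ν n - ν m) * α = 2 * Real.pi * ν n * α - 2 * Real.pi * ν m * α by ring,
    Real.cos_sub]
  ring

lemma integral_norm_sq_sum_le {ξ : ℝ} (hξ : 0 < ξ) (s : Finset ℕ) (a ν : ℕ → ℝ)
    (ha : ∀ n, 0 ≤ a n) :
    (∫ α in (-ξ)..ξ, ‖∑ n ∈ s, (a n : ℂ) * cexp (2 * Real.pi * I * ν n * α)‖ ^ 2) ≤
      12 * ξ * ∑ n ∈ s, ∑ m ∈ s, a n * a m * Real.exp (-(ξ * |ν n - ν m|)) := by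
  set G : ℝ → ℝ := fun α => Real.exp (-(1 / ξ ^ 2) * α ^ 2)
  set F : ℝ → ℝ := fun α => ‖∑ n ∈ s, (a n : ℂ) * cexp (2 * Real.pi * I * ν n * α)‖ ^ 2 with hF
  have hFG : ∀ α, 3 * (G α * F α) = ∑ n ∈ s, ∑ m ∈ s, 3 * (a n * a m) *
      (G α * Real.cos (2 * Real.pi * (ν n - ν m) * α)) := by
    intro α
    rw [hF]
    simp only
    rw [norm_sq_sum_mul_exp, Finset.mul_sum, Finset.mul_sum]
    refine Finset.sum_congr rfl fun n _ => ?_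
    rw [Finset.mul_sum, Finset.mul_sum]
    refine Finset.sum_congr rfl fun m _ => ?_
    ring
  have hterm : ∀ n m, Integrable fun α => 3 * (a n * a m) *
      (G α * Real.cos (2 * Real.pi * (ν n - ν m) * α)) := fun n m =>
    (integrable_gaussian_mul_cos hξ _).const_mul _
  have hint : Integrable fun α => 3 * (G α * F α) := by
    simp_rw [hFG]
    exact integrable_finsetSum _ fun n _ => integrable_finsetSum _ fun m _ => hterm n m
  have hFc : Continuous F := by fun_prop
  have hle : ∀ α ∈ Set.Ioc (-ξ) ξ, F α ≤ 3 * (G α * F α) := by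
    intro α hα
    have hG : 1 ≤ 3 * G α := by
      have h1 : Real.exp (-1) ≤ G α := by
        apply Real.exp_le_exp.2
        have : α ^ 2 ≤ ξ ^ 2 := sq_le_sq' hα.1.le hα.2
        have : 1 / ξ ^ 2 * α ^ 2 ≤ 1 := by
          rw [one_div_mul_eq_div]; exact div_le_one_of_le₀ this (by positivity)
        linarith
      linarith [Real.exp_neg_one_gt_d9]
    nlinarith [show 0 ≤ F α by positivity]
  calc ∫ α in (-ξ)..ξ, F α = ∫ α in Set.Ioc (-ξ) ξ, F α :=
        intervalIntegral.integral_of_le (by linarith)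
    _ ≤ ∫ α in Set.Ioc (-ξ) ξ, 3 * (G α * F α) :=
        setIntegral_mono_on (hFc.integrableOn_Ioc) hint.integrableOn measurableSet_Ioc hle
    _ ≤ ∫ α, 3 * (G α * F α) :=
        setIntegral_le_integral hint (Filter.Eventually.of_forall fun α => by
          simp only [Pi.zero_apply]; positivity)
    _ = ∑ n ∈ s, ∑ m ∈ s, 3 * (a n * a m) *
          ∫ α, G α * Real.cos (2 * Real.pi * (ν n - ν m) * α) := by
        simp_rw [hFG]
        rw [integral_finsetSum _ fun n _ => integrable_finsetSum _ fun m _ => hterm n m]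
        refine Finset.sum_congr rfl fun n _ => ?_
        rw [integral_finsetSum _ fun m _ => hterm n m]
        exact Finset.sum_congr rfl fun m _ => integral_const_mul _ _
    _ ≤ ∑ n ∈ s, ∑ m ∈ s, 3 * (a n * a m) * (4 * ξ * Real.exp (-(ξ * |ν n - ν m|))) := by
        gcongr with n _ m _
        · exact mul_nonneg (by norm_num) (mul_nonneg (ha n) (ha m))
        · exact integral_gaussian_mul_cos_le hξ _
    _ = _ := by
        simp_rw [Finset.mul_sum]
        refine Finset.sum_congr rfl fun n _ => Finset.sum_congr rfl fun m _ => ?_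
        ring

lemma sum_exp_neg_mul_succ_le {c : ℝ} (hc : 0 < c) (k : ℕ) :
    ∑ j ∈ Finset.range k, Real.exp (-(c * (j + 1))) ≤ 1 / c := by
  have h : ∑ j ∈ Finset.range k, Real.exp (-(c * (j + 1))) ≤
      (1 - Real.exp (-(c * k))) / c := by
    induction k with
    | zero => simp
    | succ k ih =>
      rw [Finset.sum_range_succ]
      have h1 : Real.exp (-(c * k)) = Real.exp c * Real.exp (-(c * (k + 1))) := by
        rw [← Real.exp_add]; ring_nf
      have h2 := Real.add_one_le_exp c
      have h3 := Real.exp_pos (-(c * (k + 1)))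
      rw [le_div_iff₀ hc] at ih ⊢
      push_cast
      nlinarith
  refine h.trans ?_
  gcongr
  linarith [Real.exp_pos (-(c * k))]

lemma sum_exp_neg_mul_abs_sub_le {c : ℝ} (hc : 0 < c) (n M : ℕ) :
    ∑ m ∈ Finset.range M, Real.exp (-(c * |(n : ℝ) - m|)) ≤ 1 + 2 / c := by
  have h1 : ∑ m ∈ Finset.range M, Real.exp (-(c * |(n : ℝ) - m|)) ≤
      ∑ m ∈ Finset.range (n + 1 + M), Real.exp (-(c * |(n : ℝ) - m|)) :=
    Finset.sum_le_sum_of_subset_of_nonneg (Finset.range_mono (by omega))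
      fun _ _ _ => (Real.exp_pos _).le
  rw [Finset.sum_range_add, Finset.sum_range_succ,
    ← Finset.sum_range_reflect (fun m : ℕ => Real.exp (-(c * |(n : ℝ) - m|))) n] at h1
  have h2 : ∑ j ∈ Finset.range n, Real.exp (-(c * |(n : ℝ) - (n - 1 - j : ℕ)|)) =
      ∑ j ∈ Finset.range n, Real.exp (-(c * (j + 1))) := by
    refine Finset.sum_congr rfl fun j hj => ?_
    have hj' := Finset.mem_range.1 hj
    have : (n : ℝ) - (n - 1 - j : ℕ) = j + 1 := by
      rw [Nat.sub_sub, Nat.cast_sub (by omega)]; push_cast; ring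
    rw [this, abs_of_pos (by positivity)]
  have h3 : ∑ j ∈ Finset.range M, Real.exp (-(c * |(n : ℝ) - (n + 1 + j : ℕ)|)) =
      ∑ j ∈ Finset.range M, Real.exp (-(c * (j + 1))) := by
    refine Finset.sum_congr rfl fun j hj => ?_
    have : (n : ℝ) - (n + 1 + j : ℕ) = -(j + 1) := by push_cast; ring
    rw [this, abs_neg, abs_of_pos (by positivity)]
  rw [h2, h3] at h1
  have h4 := sum_exp_neg_mul_succ_le hc n
  have h5 := sum_exp_neg_mul_succ_le hc M
  simp only [sub_self, abs_zero, mul_zero, neg_zero, Real.exp_zero] at h1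
  calc _ ≤ _ := h1
    _ ≤ 1 / c + 1 + 1 / c := by gcongr
    _ = _ := by ring

lemma mul_abs_sub_le_abs_pow_sub_pow {x y : ℝ} (hx : 0 ≤ x) (hy : 0 ≤ y) (k : ℕ) :
    x ^ k * |x - y| ≤ |x ^ (k + 1) - y ^ (k + 1)| := by
  rcases le_total y x with h | h
  · have := pow_le_pow_left₀ hy h k
    rw [abs_of_nonneg (sub_nonneg.2 h)]
    refine le_trans ?_ (le_abs_self _)
    rw [pow_succ, pow_succ]
    nlinarith
  · have := pow_le_pow_left₀ hx h k
    rw [abs_of_nonpos (sub_nonpos.2 h)]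
    refine le_trans ?_ (neg_le_abs _)
    rw [pow_succ, pow_succ]
    nlinarith

set_option maxHeartbeats 1000000 in
lemma integral_norm_sq_power_sum_le {ξ : ℝ} (hξ : 0 < ξ) (k M : ℕ) (a : ℕ → ℝ)
    (ha : ∀ n, 0 ≤ a n) :
    (∫ α in (-ξ)..ξ, ‖∑ n ∈ Finset.range M,
        (a n : ℂ) * cexp (2 * Real.pi * I * (((n : ℝ) + 1) ^ (k + 1) : ℝ) * α)‖ ^ 2) ≤
      24 * ∑ n ∈ Finset.range M, a n ^ 2 * (ξ + 1 / ((n : ℝ) + 1) ^ k) := by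
  refine (integral_norm_sq_sum_le hξ (Finset.range M) a
    (fun n => ((n : ℝ) + 1) ^ (k + 1)) ha).trans ?_
  set E : ℕ → ℕ → ℝ := fun n m =>
    Real.exp (-(ξ * |((n : ℝ) + 1) ^ (k + 1) - ((m : ℝ) + 1) ^ (k + 1)|)) with hE
  have hsymm : ∀ n m, E n m = E m n := fun n m => by simp only [hE]; rw [abs_sub_comm]
  have hAMGM : ∑ n ∈ Finset.range M, ∑ m ∈ Finset.range M, a n * a m * E n m ≤
      ∑ n ∈ Finset.range M, a n ^ 2 * ∑ m ∈ Finset.range M, E n m := by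
    have h1 : ∑ n ∈ Finset.range M, ∑ m ∈ Finset.range M, a n * a m * E n m ≤
        ∑ n ∈ Finset.range M, ∑ m ∈ Finset.range M,
          (a n ^ 2 * E n m / 2 + a m ^ 2 * E n m / 2) := by
      gcongr with n _ m _
      nlinarith [mul_nonneg (sq_nonneg (a n - a m)) (Real.exp_pos _ : 0 < E n m).le]
    have h2 : ∑ n ∈ Finset.range M, ∑ m ∈ Finset.range M, a m ^ 2 * E n m / 2 =
        ∑ n ∈ Finset.range M, ∑ m ∈ Finset.range M, a n ^ 2 * E n m / 2 := by
      rw [Finset.sum_comm]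
      simp_rw [hsymm]
    simp_rw [Finset.sum_add_distrib] at h1
    rw [h2, ← Finset.sum_add_distrib] at h1
    refine h1.trans (le_of_eq (Finset.sum_congr rfl fun n _ => ?_))
    rw [← Finset.sum_add_distrib, Finset.mul_sum]
    exact Finset.sum_congr rfl fun m _ => by ring
  have hinner : ∀ n, ξ * ∑ m ∈ Finset.range M, E n m ≤ 2 * (ξ + 1 / ((n : ℝ) + 1) ^ k) := by
    intro n
    have hq : 0 < ((n : ℝ) + 1) ^ k := by positivity
    have : ∑ m ∈ Finset.range M, E n m ≤ 1 + 2 / (ξ * ((n : ℝ) + 1) ^ k) := by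
      refine le_trans (Finset.sum_le_sum fun m _ => ?_)
        (sum_exp_neg_mul_abs_sub_le (mul_pos hξ hq) n M)
      apply Real.exp_le_exp.2
      have := mul_abs_sub_le_abs_pow_sub_pow (x := (n : ℝ) + 1) (y := (m : ℝ) + 1)
        (by positivity) (by positivity) k
      rw [add_sub_add_right_eq_sub] at this
      nlinarith
    calc _ ≤ ξ * (1 + 2 / (ξ * ((n : ℝ) + 1) ^ k)) := by gcongr
      _ = ξ + 2 * (1 / ((n : ℝ) + 1) ^ k) := by field_simp
      _ ≤ _ := by linarith
  calc _ ≤ 12 * ξ * ∑ n ∈ Finset.range M, a n ^ 2 * ∑ m ∈ Finset.range M, E n m := by gcongr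
    _ = 12 * ∑ n ∈ Finset.range M, a n ^ 2 * (ξ * ∑ m ∈ Finset.range M, E n m) := by
        simp_rw [mul_assoc, Finset.mul_sum]
        refine Finset.sum_congr rfl fun n _ => Finset.sum_congr rfl fun m _ => by ring
    _ ≤ 12 * ∑ n ∈ Finset.range M, a n ^ 2 * (2 * (ξ + 1 / ((n : ℝ) + 1) ^ k)) := by
        refine mul_le_mul_of_nonneg_left (Finset.sum_le_sum fun n _ => ?_) (by norm_num)
        exact mul_le_mul_of_nonneg_left (hinner n) (sq_nonneg _)
    _ = _ := by
        simp_rw [Finset.mul_sum]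
        exact Finset.sum_congr rfl fun n _ => by ring

lemma integral_norm_sq_power_tsum_le {ξ : ℝ} (hξ : 0 < ξ) (k : ℕ) (a : ℕ → ℝ)
    (ha : ∀ n, 0 ≤ a n) (hs : Summable a) {B : ℝ}
    (hB : ∀ M, ∑ n ∈ Finset.range M, a n ^ 2 * (ξ + 1 / ((n : ℝ) + 1) ^ k) ≤ B) :
    (∫ α in (-ξ)..ξ, ‖∑' n : ℕ,
        (a n : ℂ) * cexp (2 * Real.pi * I * (((n : ℝ) + 1) ^ (k + 1) : ℝ) * α)‖ ^ 2) ≤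
      24 * B := by
  have hnorm : ∀ (α : ℝ) (n : ℕ),
      ‖(a n : ℂ) * cexp (2 * Real.pi * I * (((n : ℝ) + 1) ^ (k + 1) : ℝ) * α)‖ = a n := by
    intro α n
    rw [show 2 * Real.pi * I * (((n : ℝ) + 1) ^ (k + 1) : ℝ) * α =
      ((2 * Real.pi * ((n : ℝ) + 1) ^ (k + 1) * α : ℝ) : ℂ) * I by push_cast; ring,
      norm_mul, norm_exp_ofReal_mul_I, mul_one, norm_real, Real.norm_eq_abs, abs_of_nonneg (ha n)]
  have hsum : ∀ α : ℝ, Summable fun n : ℕ =>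
      (a n : ℂ) * cexp (2 * Real.pi * I * (((n : ℝ) + 1) ^ (k + 1) : ℝ) * α) := fun α =>
    Summable.of_norm (by simpa only [hnorm] using hs)
  have hlim : Filter.Tendsto (fun M : ℕ => ∫ α in (-ξ)..ξ, ‖∑ n ∈ Finset.range M,
      (a n : ℂ) * cexp (2 * Real.pi * I * (((n : ℝ) + 1) ^ (k + 1) : ℝ) * α)‖ ^ 2) Filter.atTop
      (nhds (∫ α in (-ξ)..ξ, ‖∑' n : ℕ,
        (a n : ℂ) * cexp (2 * Real.pi * I * (((n : ℝ) + 1) ^ (k + 1) : ℝ) * α)‖ ^ 2)) := by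
    apply intervalIntegral.tendsto_integral_filter_of_dominated_convergence
      (fun _ => (∑' n, a n) ^ 2)
    · filter_upwards with M
      exact Continuous.aestronglyMeasurable (by fun_prop)
    · filter_upwards with M
      filter_upwards with α _
      rw [norm_pow, norm_norm]
      gcongr
      refine (norm_sum_le _ _).trans ?_
      simp_rw [hnorm]
      exact hs.sum_le_tsum _ fun n _ => ha n
    · exact intervalIntegrable_const
    · filter_upwards with α _
      exact ((hsum α).hasSum.tendsto_sum_nat.norm.pow 2)
  refine le_of_tendsto' hlim fun M => ?_
  refine (integral_norm_sq_power_sum_le hξ k M a ha).trans ?_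
  gcongr
  exact hB M

lemma sum_mul_le_of_antitone {b g : ℕ → ℝ} {C : ℝ} (hg0 : ∀ n, 0 ≤ g n) (hg : Antitone g)
    (hb : ∀ M : ℕ, ∑ n ∈ Finset.range M, b n ≤ C * M) (M : ℕ) :
    ∑ n ∈ Finset.range M, b n * g n ≤ C * ∑ n ∈ Finset.range M, g n := by
  have h : (C * M - ∑ n ∈ Finset.range M, b n) * g M ≤
      C * ∑ n ∈ Finset.range M, g n - ∑ n ∈ Finset.range M, b n * g n := by
    induction M with
    | zero => simp
    | succ M ih =>
      have h1 := hb (M + 1)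
      have h2 := mul_le_mul_of_nonneg_left (hg (Nat.le_succ M)) (sub_nonneg.2 h1)
      rw [Finset.sum_range_succ] at h2 ⊢
      rw [Finset.sum_range_succ, Finset.sum_range_succ]
      push_cast at h2 ⊢
      simp only [Nat.succ_eq_add_one] at h2
      linarith
  have := mul_nonneg (sub_nonneg.2 (hb M)) (hg0 M)
  linarith

lemma sum_vonMangoldt_succ_le (M : ℕ) :
    ∑ n ∈ Finset.range M, Λ (n + 1) ≤ (Real.log 4 + 4) * M := by
  have h := Chebyshev.psi_le_const_mul_self (Nat.cast_nonneg M : (0 : ℝ) ≤ M)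
  rw [Chebyshev.psi, Nat.floor_natCast] at h
  refine le_of_eq_of_le ?_ h
  clear h
  induction M with
  | zero => simp
  | succ M ih => rw [Finset.sum_range_succ, Finset.sum_Ioc_succ_top (Nat.zero_le M), ih]

lemma one_le_log_natCast {N : ℕ} (hN : 3 ≤ N) : 1 ≤ Real.log N := by
  rw [Real.le_log_iff_exp_le (by positivity)]
  have : (3 : ℝ) ≤ N := by exact_mod_cast hN
  linarith [Real.exp_one_lt_d9]

lemma sum_exp_neg_sq_div_le {N : ℕ} (hN : 3 ≤ N) (M : ℕ) :
    ∑ j ∈ Finset.range M, Real.exp (-(((j : ℝ) + 1) ^ 2 / N)) / ((j : ℝ) + 1) ≤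
      3 * Real.log N := by
  have hN0 : (0 : ℝ) < N := by positivity
  have h1 : ∑ j ∈ Finset.range M, Real.exp (-(((j : ℝ) + 1) ^ 2 / N)) / ((j : ℝ) + 1) ≤
      ∑ j ∈ Finset.range (N + M), Real.exp (-(((j : ℝ) + 1) ^ 2 / N)) / ((j : ℝ) + 1) :=
    Finset.sum_le_sum_of_subset_of_nonneg (Finset.range_mono (by omega))
      fun _ _ _ => by positivity
  rw [Finset.sum_range_add] at h1
  have h2 : ∑ j ∈ Finset.range N, Real.exp (-(((j : ℝ) + 1) ^ 2 / N)) / ((j : ℝ) + 1) ≤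
      1 + Real.log N := by
    refine le_trans ?_ (harmonic_le_one_add_log N)
    rw [harmonic]
    push_cast
    refine Finset.sum_le_sum fun j _ => ?_
    rw [div_eq_mul_inv]
    refine mul_le_of_le_one_left (by positivity) (Real.exp_le_one_iff.2 ?_)
    exact neg_nonpos.2 (by positivity)
  have h3 : ∑ j ∈ Finset.range M,
      Real.exp (-((((N + j : ℕ) : ℝ) + 1) ^ 2 / N)) / (((N + j : ℕ) : ℝ) + 1) ≤ 1 := by
    refine le_trans (Finset.sum_le_sum fun j _ => ?_)
      ((sum_exp_neg_mul_succ_le one_pos M).trans_eq (by norm_num))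
    have hj : (0 : ℝ) ≤ j := Nat.cast_nonneg j
    refine (div_le_self (Real.exp_pos _).le (by push_cast; linarith)).trans ?_
    apply Real.exp_le_exp.2
    rw [neg_le_neg_iff, le_div_iff₀ hN0]
    push_cast
    nlinarith
  linarith [one_le_log_natCast hN]

lemma exp_neg_pow_le {X x : ℝ} (hX : 0 < X) (hx : 0 ≤ x) {l : ℕ} (hl : l ≠ 0) :
    Real.exp (-(x ^ l / X ^ l)) ≤ 3 * Real.exp (-(1 / X * x)) := by
  have h : x / X - 1 ≤ x ^ l / X ^ l := by
    rw [← div_pow]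
    rcases le_total 1 (x / X) with h | h
    · linarith [le_self_pow₀ h hl]
    · have : 0 ≤ (x / X) ^ l := by positivity
      linarith
  calc _ ≤ Real.exp (1 + -(1 / X * x)) := by
        apply Real.exp_le_exp.2
        rw [one_div_mul_eq_div]; linarith
    _ = Real.exp 1 * Real.exp (-(1 / X * x)) := Real.exp_add _ _
    _ ≤ _ := by gcongr; linarith [Real.exp_one_lt_d9]

lemma add_mul_exp_sq_le {L u : ℝ} (hL : 1 ≤ L) (hu : 0 ≤ u) :
    (L + u) * Real.exp (-u) ^ 2 ≤ 2 * L * Real.exp (-u) := by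
  have h1 : u * Real.exp (-u) ≤ 1 := by
    rw [Real.exp_neg, ← div_eq_mul_inv]
    exact div_le_one_of_le₀ (by linarith [Real.add_one_le_exp u]) (Real.exp_pos _).le
  have h2 : Real.exp (-u) ≤ 1 := Real.exp_le_one_iff.2 (by linarith)
  have h3 : (L + u) * Real.exp (-u) ≤ 2 * L := by nlinarith
  have := mul_le_mul_of_nonneg_right h3 (Real.exp_pos (-u)).le
  linarith

lemma vonMangoldt_sq_mul_exp_sq_le {n : ℕ} (hn : n ≠ 0) {L X u : ℝ} (hX : 0 < X) (hL : 1 ≤ L)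
    (hXL : Real.log X ≤ L) (hu : 1 / X * n ≤ u) :
    Λ n ^ 2 * Real.exp (-u) ^ 2 ≤ 2 * L * (Λ n * Real.exp (-u)) := by
  have hn0 : (0 : ℝ) < n := by positivity
  have hu0 : 0 ≤ u := le_trans (by positivity) hu
  have h1 : Real.log n ≤ L + u := by
    have := Real.log_le_sub_one_of_pos (show 0 < (n : ℝ) / X by positivity)
    rw [Real.log_div hn0.ne' hX.ne'] at this
    rw [one_div_mul_eq_div] at hu
    linarith
  have h2 := (ArithmeticFunction.vonMangoldt_le_log (n := n)).trans h1
  have h0 : 0 ≤ Λ n := ArithmeticFunction.vonMangoldt_nonneg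
  calc Λ n ^ 2 * Real.exp (-u) ^ 2 = Λ n * (Λ n * Real.exp (-u) ^ 2) := by ring
    _ ≤ Λ n * ((L + u) * Real.exp (-u) ^ 2) := by gcongr
    _ ≤ Λ n * (2 * L * Real.exp (-u)) :=
        mul_le_mul_of_nonneg_left (add_mul_exp_sq_le hL hu0) h0
    _ = _ := by ring

lemma summable_log_sq_div_sq :
    Summable fun n : ℕ => Real.log ((n : ℝ) + 1) ^ 2 / ((n : ℝ) + 1) ^ 2 := by
  have h : Summable fun n : ℕ => 16 * ((n + 1 : ℕ) : ℝ) ^ (-(3 / 2) : ℝ) :=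
    ((summable_nat_add_iff 1).2 (Real.summable_nat_rpow.2 (by norm_num))).mul_left 16
  refine h.of_nonneg_of_le (fun n => by positivity) fun n => ?_
  have hn : (0 : ℝ) < (n : ℝ) + 1 := by positivity
  have h1 := Real.log_le_rpow_div hn.le (show (0 : ℝ) < 1 / 4 by norm_num)
  have h0 : 0 ≤ Real.log ((n : ℝ) + 1) :=
    Real.log_nonneg (by linarith [(Nat.cast_nonneg n : (0 : ℝ) ≤ n)])
  have h2 : Real.log ((n : ℝ) + 1) ^ 2 ≤ 16 * ((n : ℝ) + 1) ^ (1 / 2 : ℝ) := by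
    calc _ ≤ (((n : ℝ) + 1) ^ (1 / 4 : ℝ) / (1 / 4)) ^ 2 := by gcongr
      _ = 16 * (((n : ℝ) + 1) ^ (1 / 4 : ℝ)) ^ 2 := by ring
      _ = _ := by rw [← Real.rpow_mul_natCast hn.le]; norm_num
  calc _ ≤ 16 * ((n : ℝ) + 1) ^ (1 / 2 : ℝ) / ((n : ℝ) + 1) ^ 2 := by gcongr
    _ = 16 * (((n : ℝ) + 1) ^ (1 / 2 : ℝ) / ((n : ℝ) + 1) ^ (2 : ℝ)) := by
        rw [mul_div_assoc]; norm_num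
    _ = _ := by rw [← Real.rpow_sub hn]; push_cast; norm_num

lemma summable_one_div_succ_sq : Summable fun n : ℕ => 1 / ((n : ℝ) + 1) ^ 2 := by
  have := (summable_nat_add_iff 1).2 (Real.summable_one_div_nat_pow.2 one_lt_two)
  simpa using this

lemma summable_succ_mul_exp {N : ℕ} (hN : 0 < N) (k : ℕ) :
    Summable fun n : ℕ => ((n : ℝ) + 1) * Real.exp (-(((n : ℝ) + 1) ^ (k + 1) / N)) := by
  have h := (summable_nat_add_iff 1).2
    (Real.summable_pow_mul_exp_neg_nat_mul 1 (show (0 : ℝ) < 1 / N by positivity))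
  refine h.of_nonneg_of_le (fun n => by positivity) fun n => ?_
  have hn : (1 : ℝ) ≤ (n : ℝ) + 1 := by linarith [(Nat.cast_nonneg n : (0:ℝ) ≤ n)]
  push_cast
  rw [pow_one]
  gcongr
  rw [neg_mul, neg_le_neg_iff, one_div_mul_eq_div]
  gcongr
  exact le_self_pow₀ hn (by omega)

lemma sum_exp_neg_pow_le {N : ℕ} (hN : 0 < N) (k M : ℕ) :
    ∑ n ∈ Finset.range M, Real.exp (-(((n : ℝ) + 1) ^ (k + 1) / N)) ≤
      3 * (N : ℝ) ^ (1 / ((k + 1 : ℕ) : ℝ)) := by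
  have hN0 : (0 : ℝ) < N := by positivity
  set X : ℝ := (N : ℝ) ^ (1 / ((k + 1 : ℕ) : ℝ)) with hXdef
  have hX : 0 < X := Real.rpow_pos_of_pos hN0 _
  have hXN : X ^ (k + 1) = N := by
    rw [hXdef, one_div, Real.rpow_inv_natCast_pow hN0.le (by omega)]
  have h := sum_exp_neg_mul_succ_le (one_div_pos.2 hX) M
  rw [one_div_one_div] at h
  calc _ ≤ ∑ n ∈ Finset.range M, 3 * Real.exp (-(1 / X * ((n : ℝ) + 1))) := by
        rw [← hXN]
        exact Finset.sum_le_sum fun n _ => exp_neg_pow_le hX (by positivity) (by omega)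
    _ ≤ 3 * X := by rw [← Finset.mul_sum]; gcongr

lemma antitone_exp_neg_pow (N k : ℕ) :
    Antitone fun n : ℕ => Real.exp (-(((n : ℝ) + 1) ^ (k + 1) / N)) := by
  intro m n hmn
  have : (m : ℝ) ≤ n := by exact_mod_cast hmn
  simp only
  gcongr

lemma sum_vonMangoldt_mul_exp_le {N : ℕ} (hN : 0 < N) (k M : ℕ) :
    ∑ n ∈ Finset.range M, Λ (n + 1) * Real.exp (-(((n : ℝ) + 1) ^ (k + 1) / N)) ≤
      (Real.log 4 + 4) * (3 * (N : ℝ) ^ (1 / ((k + 1 : ℕ) : ℝ))) :=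
  (sum_mul_le_of_antitone (fun n => (Real.exp_pos _).le) (antitone_exp_neg_pow N k)
    sum_vonMangoldt_succ_le M).trans (by gcongr; exact sum_exp_neg_pow_le hN k M)

lemma sum_vonMangoldt_mul_exp_sq_div_le {N : ℕ} (hN : 3 ≤ N) (M : ℕ) :
    ∑ n ∈ Finset.range M, Λ (n + 1) *
        (Real.exp (-(((n : ℝ) + 1) ^ 2 / N)) / ((n : ℝ) + 1)) ≤
      (Real.log 4 + 4) * (3 * Real.log N) := by
  refine (sum_mul_le_of_antitone (fun n => by positivity) ?_
    sum_vonMangoldt_succ_le M).trans (by gcongr; exact sum_exp_neg_sq_div_le hN M)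
  intro m n hmn
  have := antitone_exp_neg_pow N 1 hmn
  have h : (m : ℝ) ≤ n := by exact_mod_cast hmn
  simp only at this ⊢
  gcongr

lemma sum_exp_sq_mul_le : ∃ C > (0 : ℝ), ∀ k : ℕ, 1 ≤ k → ∀ N : ℕ, 3 ≤ N → ∀ ξ : ℝ, 0 < ξ →
    ∀ M : ℕ, ∑ n ∈ Finset.range M, Real.exp (-(((n : ℝ) + 1) ^ (k + 1) / N)) ^ 2 *
        (ξ + 1 / ((n : ℝ) + 1) ^ k) ≤
      C * (ξ * (N : ℝ) ^ (1 / ((k + 1 : ℕ) : ℝ)) + if k + 1 = 2 then Real.log N else 1) := by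
  set D : ℝ := ∑' n : ℕ, 1 / ((n : ℝ) + 1) ^ 2
  have hD : 0 ≤ D := tsum_nonneg fun n => by positivity
  refine ⟨3 + D, by positivity, fun k hk N hN ξ hξ M => ?_⟩
  have hexp : ∀ n : ℕ, Real.exp (-(((n : ℝ) + 1) ^ (k + 1) / N)) ≤ 1 := fun n =>
    Real.exp_le_one_iff.2 (neg_nonpos.2 (by positivity))
  have h1 := sum_exp_neg_pow_le (show 0 < N by omega) k M
  have h2 : ∑ n ∈ Finset.range M, Real.exp (-(((n : ℝ) + 1) ^ (k + 1) / N)) *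
      (1 / ((n : ℝ) + 1) ^ k) ≤ (3 + D) * if k + 1 = 2 then Real.log N else 1 := by
    split_ifs with hk2
    · obtain rfl : k = 1 := by omega
      have := sum_exp_neg_sq_div_le hN M
      have hL := one_le_log_natCast hN
      calc _ = ∑ j ∈ Finset.range M, Real.exp (-(((j : ℝ) + 1) ^ 2 / N)) / ((j : ℝ) + 1) := by
            simp only [pow_one, mul_one_div, Nat.reduceAdd]
        _ ≤ _ := this
        _ ≤ _ := by gcongr; linarith
    · calc _ ≤ ∑ n ∈ Finset.range M, 1 / ((n : ℝ) + 1) ^ 2 := by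
            refine Finset.sum_le_sum fun n _ => ?_
            refine (mul_le_of_le_one_left (by positivity) (hexp n)).trans ?_
            gcongr
            · linarith [(Nat.cast_nonneg n : (0 : ℝ) ≤ n)]
            · omega
        _ ≤ D := summable_one_div_succ_sq.sum_le_tsum _ fun n _ => by positivity
        _ ≤ _ := by linarith
  have hX : (0 : ℝ) ≤ (N : ℝ) ^ (1 / ((k + 1 : ℕ) : ℝ)) := by positivity
  calc _ ≤ ∑ n ∈ Finset.range M, Real.exp (-(((n : ℝ) + 1) ^ (k + 1) / N)) *
        (ξ + 1 / ((n : ℝ) + 1) ^ k) := by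
        refine Finset.sum_le_sum fun n _ => ?_
        gcongr
        rw [sq]
        exact mul_le_of_le_one_left (Real.exp_pos _).le (hexp n)
    _ = ξ * ∑ n ∈ Finset.range M, Real.exp (-(((n : ℝ) + 1) ^ (k + 1) / N)) +
        ∑ n ∈ Finset.range M, Real.exp (-(((n : ℝ) + 1) ^ (k + 1) / N)) *
          (1 / ((n : ℝ) + 1) ^ k) := by
        simp_rw [mul_add, Finset.sum_add_distrib, Finset.mul_sum, mul_comm ξ]
    _ ≤ ξ * (3 * (N : ℝ) ^ (1 / ((k + 1 : ℕ) : ℝ))) +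
        (3 + D) * if k + 1 = 2 then Real.log N else 1 := by gcongr
    _ ≤ _ := by nlinarith [mul_nonneg hD (mul_nonneg hξ.le hX)]

lemma sum_vonMangoldt_exp_sq_mul_le : ∃ C > (0 : ℝ), ∀ k : ℕ, 1 ≤ k → ∀ N : ℕ, 3 ≤ N →
    ∀ ξ : ℝ, 0 < ξ → ∀ M : ℕ,
    ∑ n ∈ Finset.range M, (Λ (n + 1) * Real.exp (-(((n : ℝ) + 1) ^ (k + 1) / N))) ^ 2 *
        (ξ + 1 / ((n : ℝ) + 1) ^ k) ≤
      C * (ξ * (N : ℝ) ^ (1 / ((k + 1 : ℕ) : ℝ)) * Real.log N +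
        if k + 1 = 2 then Real.log N ^ 2 else 1) := by
  set D : ℝ := ∑' n : ℕ, Real.log ((n : ℝ) + 1) ^ 2 / ((n : ℝ) + 1) ^ 2
  have hD : 0 ≤ D := tsum_nonneg fun n => by positivity
  set K : ℝ := Real.log 4 + 4
  have hK : 0 ≤ K := by positivity
  refine ⟨6 * K + D + 1, by positivity, fun k hk N hN ξ hξ M => ?_⟩
  have hN0 : (0 : ℝ) < N := by positivity
  have hL := one_le_log_natCast hN
  have hexp : ∀ n : ℕ, Real.exp (-(((n : ℝ) + 1) ^ (k + 1) / N)) ≤ 1 := fun n =>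
    Real.exp_le_one_iff.2 (neg_nonpos.2 (by positivity))
  have hpt : ∀ n : ℕ, (Λ (n + 1) * Real.exp (-(((n : ℝ) + 1) ^ (k + 1) / N))) ^ 2 ≤
      2 * Real.log N * (Λ (n + 1) * Real.exp (-(((n : ℝ) + 1) ^ (k + 1) / N))) := by
    intro n
    rw [mul_pow]
    refine vonMangoldt_sq_mul_exp_sq_le n.succ_ne_zero hN0 hL le_rfl ?_
    have hn : (1 : ℝ) ≤ (n : ℝ) + 1 := by linarith [(Nat.cast_nonneg n : (0:ℝ) ≤ n)]
    rw [one_div_mul_eq_div]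
    push_cast
    gcongr
    exact le_self_pow₀ hn (by omega)
  have h1 : ∑ n ∈ Finset.range M, (Λ (n + 1) *
      Real.exp (-(((n : ℝ) + 1) ^ (k + 1) / N))) ^ 2 ≤
      6 * K * ((N : ℝ) ^ (1 / ((k + 1 : ℕ) : ℝ)) * Real.log N) := by
    calc _ ≤ 2 * Real.log N * ∑ n ∈ Finset.range M,
          Λ (n + 1) * Real.exp (-(((n : ℝ) + 1) ^ (k + 1) / N)) := by
          rw [Finset.mul_sum]; exact Finset.sum_le_sum fun n _ => hpt n
      _ ≤ 2 * Real.log N * (K * (3 * (N : ℝ) ^ (1 / ((k + 1 : ℕ) : ℝ)))) := by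
          gcongr; exact sum_vonMangoldt_mul_exp_le (by omega) k M
      _ = _ := by ring
  have h2 : ∑ n ∈ Finset.range M, (Λ (n + 1) *
      Real.exp (-(((n : ℝ) + 1) ^ (k + 1) / N))) ^ 2 * (1 / ((n : ℝ) + 1) ^ k) ≤
      (6 * K + D + 1) * if k + 1 = 2 then Real.log N ^ 2 else 1 := by
    split_ifs with hk2
    · obtain rfl : k = 1 := by omega
      calc _ ≤ ∑ n ∈ Finset.range M, 2 * Real.log N * (Λ (n + 1) *
              (Real.exp (-(((n : ℝ) + 1) ^ 2 / N)) / ((n : ℝ) + 1))) := by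
            refine Finset.sum_le_sum fun n _ => ?_
            refine (mul_le_mul_of_nonneg_right (hpt n) (by positivity)).trans_eq ?_
            simp only [pow_one, Nat.reduceAdd]
            ring
        _ ≤ 2 * Real.log N * (K * (3 * Real.log N)) := by
            rw [← Finset.mul_sum]
            gcongr
            exact sum_vonMangoldt_mul_exp_sq_div_le hN M
        _ = 6 * K * Real.log N ^ 2 := by ring
        _ ≤ _ := by gcongr; linarith
    · calc _ ≤ ∑ n ∈ Finset.range M, Real.log ((n : ℝ) + 1) ^ 2 / ((n : ℝ) + 1) ^ 2 := by
            refine Finset.sum_le_sum fun n _ => ?_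
            rw [mul_one_div]
            have h0 : 0 ≤ Λ (n + 1) := ArithmeticFunction.vonMangoldt_nonneg
            have hlog : Λ (n + 1) ≤ Real.log ((n : ℝ) + 1) := by
              have := ArithmeticFunction.vonMangoldt_le_log (n := n + 1)
              push_cast at this
              exact this
            gcongr
            · exact (mul_le_of_le_one_right h0 (hexp n)).trans hlog
            · linarith [(Nat.cast_nonneg n : (0 : ℝ) ≤ n)]
            · omega
        _ ≤ D := summable_log_sq_div_sq.sum_le_tsum _ fun n _ => by positivity
        _ ≤ _ := by linarith
  have hX : (0 : ℝ) ≤ (N : ℝ) ^ (1 / ((k + 1 : ℕ) : ℝ)) := by positivity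
  calc _ = ξ * ∑ n ∈ Finset.range M, (Λ (n + 1) *
          Real.exp (-(((n : ℝ) + 1) ^ (k + 1) / N))) ^ 2 +
        ∑ n ∈ Finset.range M, (Λ (n + 1) * Real.exp (-(((n : ℝ) + 1) ^ (k + 1) / N))) ^ 2 *
          (1 / ((n : ℝ) + 1) ^ k) := by
        simp_rw [mul_add, Finset.sum_add_distrib, Finset.mul_sum, mul_comm ξ]
    _ ≤ ξ * (6 * K * ((N : ℝ) ^ (1 / ((k + 1 : ℕ) : ℝ)) * Real.log N)) +
        (6 * K + D + 1) * if k + 1 = 2 then Real.log N ^ 2 else 1 := by gcongr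
    _ ≤ _ := by
        have : 0 ≤ (D + 1) * (ξ * ((N : ℝ) ^ (1 / ((k + 1 : ℕ) : ℝ)) * Real.log N)) := by
          positivity
        linarith

lemma summable_exp_neg_pow {N : ℕ} (hN : 0 < N) (k : ℕ) :
    Summable fun n : ℕ => Real.exp (-(((n : ℝ) + 1) ^ (k + 1) / N)) :=
  (summable_succ_mul_exp hN k).of_nonneg_of_le (fun _ => (Real.exp_pos _).le) fun n =>
    le_mul_of_one_le_left (Real.exp_pos _).le (by linarith [(Nat.cast_nonneg n : (0 : ℝ) ≤ n)])

lemma summable_vonMangoldt_mul_exp_neg_pow {N : ℕ} (hN : 0 < N) (k : ℕ) :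
    Summable fun n : ℕ => Λ (n + 1) * Real.exp (-(((n : ℝ) + 1) ^ (k + 1) / N)) := by
  refine (summable_succ_mul_exp hN k).of_nonneg_of_le
    (fun _ => mul_nonneg ArithmeticFunction.vonMangoldt_nonneg (Real.exp_pos _).le) fun n => ?_
  gcongr
  refine ArithmeticFunction.vonMangoldt_le_log.trans ?_
  push_cast
  exact Real.log_le_self (by positivity)

lemma omegal_succ_eq_tsum (N k : ℕ) (α : ℝ) :
    omegal N (k + 1) α = ∑' n : ℕ, ((Real.exp (-(((n : ℝ) + 1) ^ (k + 1) / N)) : ℝ) : ℂ) *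
      cexp (2 * Real.pi * I * (((n : ℝ) + 1) ^ (k + 1) : ℝ) * α) := by
  rw [omegal, tsum_pnat_eq_tsum_succ (f := fun m : ℕ => cexp (-(m : ℂ) ^ (k + 1) / N) *
    cexp (2 * Real.pi * I * (m : ℂ) ^ (k + 1) * α))]
  refine tsum_congr fun n => ?_
  push_cast
  rw [neg_div]

lemma Stilde_succ_eq_tsum {N : ℕ} (hN : 0 < N) (k : ℕ) (α : ℝ) :
    Stilde N (k + 1) α = ∑' n : ℕ,
      ((Λ (n + 1) * Real.exp (-(((n : ℝ) + 1) ^ (k + 1) / N)) : ℝ) : ℂ) *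
      cexp (2 * Real.pi * I * (((n : ℝ) + 1) ^ (k + 1) : ℝ) * α) := by
  have heq : ∀ n : ℕ, (Λ (n + 1) : ℂ) * cexp (-((n + 1 : ℕ) : ℂ) ^ (k + 1) / N) *
      cexp (2 * Real.pi * I * ((n + 1 : ℕ) : ℂ) ^ (k + 1) * α) =
      ((Λ (n + 1) * Real.exp (-(((n : ℝ) + 1) ^ (k + 1) / N)) : ℝ) : ℂ) *
      cexp (2 * Real.pi * I * (((n : ℝ) + 1) ^ (k + 1) : ℝ) * α) := by
    intro n
    push_cast
    rw [neg_div]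
  have hs : Summable fun n : ℕ =>
      ((Λ (n + 1) * Real.exp (-(((n : ℝ) + 1) ^ (k + 1) / N)) : ℝ) : ℂ) *
      cexp (2 * Real.pi * I * (((n : ℝ) + 1) ^ (k + 1) : ℝ) * α) := by
    refine Summable.of_norm ((summable_vonMangoldt_mul_exp_neg_pow hN k).congr fun n => ?_)
    rw [show 2 * Real.pi * I * (((n : ℝ) + 1) ^ (k + 1) : ℝ) * α =
      ((2 * Real.pi * ((n : ℝ) + 1) ^ (k + 1) * α : ℝ) : ℂ) * I by push_cast; ring,
      norm_mul, norm_exp_ofReal_mul_I, mul_one, norm_real, Real.norm_eq_abs, abs_of_nonneg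
      (mul_nonneg ArithmeticFunction.vonMangoldt_nonneg (Real.exp_pos _).le)]
  rw [Stilde, Summable.tsum_eq_zero_add]
  · simp only [ArithmeticFunction.map_zero, ofReal_zero, zero_mul, zero_add, heq]
  · rw [← summable_nat_add_iff 1]
    simpa only [heq] using hs

/-- For an integer `ℓ ≥ 2` and all sufficiently large `N` (with `L = log N`), uniformly
for `0 < ξ ≤ 1/2`:
`∫_{−ξ}^{ξ} |ω_ℓ(α)|² dα ≪_ℓ ξ N^{1/ℓ} + L` if `ℓ = 2` (resp. `+ 1` if `ℓ > 2`), and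
`∫_{−ξ}^{ξ} |S̃_ℓ(α)|² dα ≪_ℓ ξ N^{1/ℓ} L + L²` if `ℓ = 2` (resp. `+ 1` if `ℓ > 2`). -/
theorem omega_Stilde_truncated_L2 (ℓ : ℕ) (hℓ : 2 ≤ ℓ) :
    ∃ C > (0 : ℝ), ∃ N₀ : ℕ, ∀ N : ℕ, N₀ ≤ N → ∀ ξ : ℝ, 0 < ξ → ξ ≤ 1 / 2 →
      (∫ α in (-ξ)..ξ, ‖omegal N ℓ α‖ ^ 2) ≤
          C * (ξ * (N : ℝ) ^ (1 / (ℓ : ℝ)) + if ℓ = 2 then Real.log N else 1) ∧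
      (∫ α in (-ξ)..ξ, ‖Stilde N ℓ α‖ ^ 2) ≤
          C * (ξ * (N : ℝ) ^ (1 / (ℓ : ℝ)) * Real.log N +
            if ℓ = 2 then Real.log N ^ 2 else 1) := by
  obtain ⟨k, rfl⟩ : ∃ k, ℓ = k + 1 := ⟨ℓ - 1, by omega⟩
  have hk : 1 ≤ k := by omega
  obtain ⟨C₁, hC₁, h₁⟩ := sum_exp_sq_mul_le
  obtain ⟨C₂, hC₂, h₂⟩ := sum_vonMangoldt_exp_sq_mul_le
  refine ⟨24 * (C₁ + C₂), by positivity, 3, fun N hN ξ hξ _ => ?_⟩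
  have hN0 : 0 < N := by omega
  have hL := one_le_log_natCast hN
  constructor
  · simp_rw [omegal_succ_eq_tsum]
    refine (integral_norm_sq_power_tsum_le hξ k _ (fun n => (Real.exp_pos _).le)
      (summable_exp_neg_pow hN0 k) (h₁ k hk N hN ξ hξ)).trans ?_
    rw [← mul_assoc]
    refine mul_le_mul_of_nonneg_right (by linarith) ?_
    split_ifs <;> positivity
  · simp_rw [Stilde_succ_eq_tsum hN0]
    refine (integral_norm_sq_power_tsum_le hξ k _
      (fun n => mul_nonneg ArithmeticFunction.vonMangoldt_nonneg (Real.exp_pos _).le)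
      (summable_vonMangoldt_mul_exp_neg_pow hN0 k) (h₂ k hk N hN ξ hξ)).trans ?_
    rw [← mul_assoc]
    refine mul_le_mul_of_nonneg_right (by linarith) ?_
    split_ifs <;> positivity
end

section
/- Let N be a sufficiently large integer and L = log N. Then ∫_{−1/2}^{1/2} | S̃₂(α) |⁴ dα ≪ N L². -/
open Complex MeasureTheory

/-- `S̃₂(α) = ∑_{n=1}^∞ Λ(n) e^{−n²/N} e(n² α)`, with `e(x) = exp(2πix)`. -/
noncomputable def Stilde2 (N : ℕ) (α : ℝ) : ℂ :=
  ∑' n : ℕ, (ArithmeticFunction.vonMangoldt n : ℂ) *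
    Complex.exp (-(n : ℂ) ^ 2 / N) *
    Complex.exp (2 * Real.pi * Complex.I * (n : ℂ) ^ 2 * α)

theorem sum_Icc_neg_one_pow_card {ι : Type*} [DecidableEq ι] (j k : Finset ι) (hjk : j ⊆ k) :
    ∑ s ∈ Finset.Icc j k, (-1 : ℝ) ^ s.card = if j = k then (-1) ^ j.card else 0 := by
  rw [Finset.Icc_eq_image_powerset hjk, Finset.sum_image]
  · have h1 : ∀ s ∈ (k \ j).powerset, (-1 : ℝ) ^ (j ∪ s).card = (-1) ^ j.card * (-1) ^ s.card := by
      intro s hs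
      rw [Finset.card_union_of_disjoint, pow_add]
      rw [Finset.mem_powerset] at hs
      exact Finset.disjoint_of_subset_right hs Finset.disjoint_sdiff
    rw [Finset.sum_congr rfl h1, ← Finset.mul_sum]
    have h2 : ∑ s ∈ (k \ j).powerset, (-1 : ℝ) ^ s.card = if k \ j = ∅ then 1 else 0 := by
      have := Finset.sum_powerset_neg_one_pow_card (x := k \ j)
      exact_mod_cast this
    rw [h2]
    have h3 : k \ j = ∅ ↔ j = k := by
      rw [Finset.sdiff_eq_empty_iff_subset]
      exact ⟨fun h => hjk.antisymm h, fun h => h ▸ subset_rfl⟩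
    simp [h3]
  · intro s hs t ht hst
    rw [Finset.mem_coe] at hs ht
    have hs' : Disjoint j s := Finset.disjoint_of_subset_right (Finset.mem_powerset.1 hs) Finset.disjoint_sdiff
    have ht' : Disjoint j t := Finset.disjoint_of_subset_right (Finset.mem_powerset.1 ht) Finset.disjoint_sdiff
    have : (j ∪ s) \ j = (j ∪ t) \ j := by rw [show j ∪ s = j ∪ t from hst]
    rwa [Finset.union_sdiff_cancel_left hs', Finset.union_sdiff_cancel_left ht'] at this

/-- Selberg's upper bound sieve over a downward closed family `𝒟` of sets of sifting primes. -/
theorem selberg_upper_bound {α ι : Type*} [DecidableEq ι] (A : Finset α) (B : α → Finset ι)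
    (𝒟 : Finset (Finset ι)) (hd : ∀ s ∈ 𝒟, ∀ t ⊆ s, t ∈ 𝒟) (h0 : ∅ ∈ 𝒟) (g : ι → ℝ)
    (hg : ∀ s ∈ 𝒟, ∀ i ∈ s, 0 < g i ∧ g i < 1) (X M r : ℝ)
    (hr : ∀ s ∈ 𝒟, ∀ t ∈ 𝒟,
      |((A.filter fun d => s ∪ t ⊆ B d).card : ℝ) - X * ∏ i ∈ s ∪ t, g i| ≤ r)
    (hM : ∀ s ∈ 𝒟, (∏ i ∈ s, g i)⁻¹ ≤ M) :
    ((A.filter fun d => B d = ∅).card : ℝ) ≤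
      X / (∑ s ∈ 𝒟, ∏ i ∈ s, g i / (1 - g i)) + (𝒟.card : ℝ) ^ 2 * M ^ 2 * r := by
  set h : Finset ι → ℝ := fun s => ∏ i ∈ s, g i / (1 - g i) with hh
  set G : Finset ι → ℝ := fun s => ∏ i ∈ s, g i with hG
  set J : ℝ := ∑ s ∈ 𝒟, h s with hJ
  have hpos : ∀ s ∈ 𝒟, 0 < h s := fun s hs => Finset.prod_pos fun i hi =>
    div_pos (hg s hs i hi).1 (by linarith [(hg s hs i hi).2])
  have Gpos : ∀ s ∈ 𝒟, 0 < G s := fun s hs => Finset.prod_pos fun i hi => (hg s hs i hi).1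
  have Jpos : 0 < J := Finset.sum_pos hpos ⟨∅, h0⟩
  set w : Finset ι → ℝ := fun s => (-1) ^ s.card * (G s)⁻¹ * ((∑ j ∈ 𝒟 with s ⊆ j, h j) / J) with hw
  have w_empty : w ∅ = 1 := by
    simp only [hw, hG]
    simp [Jpos.ne', ← hJ]
  have w_le : ∀ s ∈ 𝒟, |w s| ≤ M := by
    intro s hs
    have h1 : |(∑ j ∈ 𝒟 with s ⊆ j, h j) / J| ≤ 1 := by
      rw [abs_of_nonneg (div_nonneg (Finset.sum_nonneg fun j hj => (hpos j (Finset.mem_filter.1 hj).1).le) Jpos.le),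
        div_le_one Jpos]
      exact Finset.sum_le_sum_of_subset_of_nonneg (Finset.filter_subset _ _) fun j hj _ => (hpos j hj).le
    have h2 : |w s| = (G s)⁻¹ * |(∑ j ∈ 𝒟 with s ⊆ j, h j) / J| := by
      simp only [hw, abs_mul, abs_pow, abs_neg, abs_one, one_pow, one_mul]
      rw [abs_of_pos (inv_pos.2 (Gpos s hs))]
    rw [h2]
    calc _ ≤ (G s)⁻¹ * 1 := mul_le_mul_of_nonneg_left h1 (inv_pos.2 (Gpos s hs)).le
      _ ≤ M := by rw [mul_one]; exact hM s hs
  have y_eq : ∀ j ∈ 𝒟, ∑ s ∈ 𝒟 with j ⊆ s, G s * w s = (-1) ^ j.card * h j / J := by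
    intro j hj
    have e1 : ∀ s ∈ 𝒟.filter (fun s => j ⊆ s), G s * w s = ∑ k ∈ 𝒟, if s ⊆ k then (-1) ^ s.card * h k / J else 0 := by
      intro s hs
      have hs' := (Finset.mem_filter.1 hs).1
      rw [← Finset.sum_filter, ← Finset.sum_div, ← Finset.mul_sum]
      simp only [hw]
      have := (Gpos s hs').ne'
      field_simp
    rw [Finset.sum_congr rfl e1, Finset.sum_comm]
    have e2 : ∀ k ∈ 𝒟, (∑ s ∈ 𝒟 with j ⊆ s, if s ⊆ k then (-1) ^ s.card * h k / J else 0)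
        = if j = k then (-1) ^ j.card * h j / J else 0 := by
      intro k hk
      rw [← Finset.sum_filter, Finset.filter_filter]
      have e3 : (𝒟.filter fun s => j ⊆ s ∧ s ⊆ k) = Finset.Icc j k := by
        ext s
        simp only [Finset.mem_filter, Finset.mem_Icc]
        exact ⟨fun h => h.2, fun h => ⟨hd k hk s h.2, h⟩⟩
      rw [e3]
      by_cases hjk : j ⊆ k
      · have := sum_Icc_neg_one_pow_card j k hjk
        simp_rw [mul_div_assoc]
        rw [← Finset.sum_mul, this]
        split_ifs with hjk'
        · rw [hjk']
        · simp
      · have : Finset.Icc j k = ∅ := Finset.Icc_eq_empty (by simpa using hjk)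
        rw [this, if_neg (fun h : j = k => hjk h.subset)]
        simp
    rw [Finset.sum_congr rfl e2]
    simp [hj]
  have G_union : ∀ s ∈ 𝒟, ∀ t ∈ 𝒟, G (s ∪ t) =
      ∑ j ∈ 𝒟, if j ⊆ s ∧ j ⊆ t then (h j)⁻¹ * (G s * G t) else 0 := by
    intro s hs t ht
    have hst : s ∩ t ∈ 𝒟 := hd s hs _ Finset.inter_subset_left
    have e1 : G (s ∪ t) * G (s ∩ t) = G s * G t := Finset.prod_union_inter
    have e2 : (G (s ∩ t))⁻¹ = ∑ j ∈ (s ∩ t).powerset, (h j)⁻¹ := by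
      have : ∀ i ∈ s ∩ t, (g i)⁻¹ = (g i / (1 - g i))⁻¹ + 1 := by
        intro i hi
        have := hg _ hst i hi
        have h1 : 1 - g i ≠ 0 := by linarith [this.2]
        have h2 := this.1.ne'
        field_simp
        ring
      simp only [hG, hh, ← Finset.prod_inv_distrib]
      rw [Finset.prod_congr rfl this, Finset.prod_add_one]
    have e3 : (𝒟.filter fun j => j ⊆ s ∧ j ⊆ t) = (s ∩ t).powerset := by
      ext j
      simp only [Finset.mem_filter, Finset.mem_powerset, Finset.subset_inter_iff]
      exact ⟨fun h => h.2, fun h => ⟨hd s hs j h.1, h⟩⟩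
    rw [← Finset.sum_filter, e3, ← Finset.sum_mul, ← e2, ← e1]
    have := (Gpos _ hst).ne'
    field_simp
  have main : ∑ s ∈ 𝒟, ∑ t ∈ 𝒟, w s * w t * G (s ∪ t) = 1 / J := by
    calc ∑ s ∈ 𝒟, ∑ t ∈ 𝒟, w s * w t * G (s ∪ t)
        = ∑ s ∈ 𝒟, ∑ t ∈ 𝒟, ∑ j ∈ 𝒟, (h j)⁻¹ * ((if j ⊆ s then G s * w s else 0) *
            (if j ⊆ t then G t * w t else 0)) := by
          refine Finset.sum_congr rfl fun s hs => Finset.sum_congr rfl fun t ht => ?_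
          rw [G_union s hs t ht, Finset.mul_sum]
          refine Finset.sum_congr rfl fun j _ => ?_
          by_cases h1 : j ⊆ s <;> by_cases h2 : j ⊆ t <;> simp [h1, h2]
          ring
      _ = ∑ j ∈ 𝒟, (h j)⁻¹ * ((∑ s ∈ 𝒟 with j ⊆ s, G s * w s) * ∑ t ∈ 𝒟 with j ⊆ t, G t * w t) := by
          simp_rw [Finset.sum_filter, Finset.sum_mul_sum, Finset.mul_sum]
          rw [Finset.sum_comm_cycle]
      _ = ∑ j ∈ 𝒟, h j / J ^ 2 := by
          refine Finset.sum_congr rfl fun j hj => ?_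
          rw [y_eq j hj]
          have := (hpos j hj).ne'
          have e : ((-1 : ℝ) ^ j.card) * (-1) ^ j.card = 1 := by rw [← mul_pow]; simp
          field_simp
          linear_combination e
      _ = 1 / J := by
          rw [← Finset.sum_div, ← hJ]
          field_simp
  have count : ((A.filter fun d => B d = ∅).card : ℝ) ≤
      ∑ s ∈ 𝒟, ∑ t ∈ 𝒟, w s * w t * ((A.filter fun d => s ∪ t ⊆ B d).card : ℝ) := by
    calc ((A.filter fun d => B d = ∅).card : ℝ) = ∑ d ∈ A, if B d = ∅ then (1 : ℝ) else 0 := by simp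
      _ ≤ ∑ d ∈ A, (∑ s ∈ 𝒟 with s ⊆ B d, w s) ^ 2 := by
          refine Finset.sum_le_sum fun d _ => ?_
          split_ifs with hB
          · have : 𝒟.filter (fun s => s ⊆ B d) = {∅} := by
              ext s
              simp only [hB, Finset.mem_filter, Finset.subset_empty, Finset.mem_singleton]
              exact ⟨fun h => h.2, fun h => ⟨h ▸ h0, h⟩⟩
            rw [this]
            simp [w_empty]
          · positivity
      _ = ∑ d ∈ A, ∑ s ∈ 𝒟, ∑ t ∈ 𝒟, w s * w t * (if s ∪ t ⊆ B d then 1 else 0) := by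
          refine Finset.sum_congr rfl fun d _ => ?_
          rw [sq, Finset.sum_filter, Finset.sum_mul_sum]
          refine Finset.sum_congr rfl fun s _ => Finset.sum_congr rfl fun t _ => ?_
          by_cases h1 : s ⊆ B d <;> by_cases h2 : t ⊆ B d <;> simp [h1, h2, Finset.union_subset_iff]
      _ = _ := by
          rw [Finset.sum_comm]
          refine Finset.sum_congr rfl fun s _ => ?_
          rw [Finset.sum_comm]
          refine Finset.sum_congr rfl fun t _ => ?_
          rw [← Finset.mul_sum]
          simp
  have M0 : 0 ≤ M := (abs_nonneg _).trans (w_le ∅ h0)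
  calc _ ≤ _ := count
    _ ≤ ∑ s ∈ 𝒟, ∑ t ∈ 𝒟, (X * (w s * w t * G (s ∪ t)) + M ^ 2 * r) := by
        refine Finset.sum_le_sum fun s hs => Finset.sum_le_sum fun t ht => ?_
        have h1 : w s * w t * ((A.filter fun d => s ∪ t ⊆ B d).card : ℝ) - X * (w s * w t * G (s ∪ t))
            ≤ |w s| * |w t| * |((A.filter fun d => s ∪ t ⊆ B d).card : ℝ) - X * G (s ∪ t)| := by
          rw [← abs_mul, ← abs_mul]
          exact (le_of_eq (by ring)).trans (le_abs_self _)
        have h2 : |w s| * |w t| * |((A.filter fun d => s ∪ t ⊆ B d).card : ℝ) - X * G (s ∪ t)| ≤ M * M * r :=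
          mul_le_mul (mul_le_mul (w_le s hs) (w_le t ht) (abs_nonneg _) M0) (hr s hs t ht) (abs_nonneg _)
            (mul_nonneg M0 M0)
        linarith
    _ = X * (1 / J) + (𝒟.card : ℝ) ^ 2 * M ^ 2 * r := by
        simp_rw [Finset.sum_add_distrib, ← Finset.mul_sum, main]
        simp
        ring
    _ = _ := by ring

/-- The sum of `∏ p ∈ s, h p` over the subsets `s` of `P` whose product is at most `y`. -/
noncomputable def sieveSum (h : ℕ → ℝ) (P : Finset ℕ) (y : ℕ) : ℝ :=
  ∑ s ∈ P.powerset with ∏ p ∈ s, p ≤ y, ∏ p ∈ s, h p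

theorem sieveSum_nonneg {h : ℕ → ℝ} {P : Finset ℕ} (hh : ∀ p ∈ P, 0 ≤ h p) (y : ℕ) :
    0 ≤ sieveSum h P y := by
  refine Finset.sum_nonneg fun s hs => Finset.prod_nonneg fun p hp => hh p ?_
  simp only [Finset.mem_filter, Finset.mem_powerset] at hs
  exact hs.1 hp

theorem sieveSum_mono {h : ℕ → ℝ} {P : Finset ℕ} (hh : ∀ p ∈ P, 0 ≤ h p) {y z : ℕ} (hyz : y ≤ z) :
    sieveSum h P y ≤ sieveSum h P z := by
  refine Finset.sum_le_sum_of_subset_of_nonneg ?_ ?_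
  · exact Finset.monotone_filter_right _ fun s _ hs => le_trans hs hyz
  · intro s hs _
    simp only [Finset.mem_filter, Finset.mem_powerset] at hs
    exact Finset.prod_nonneg fun p hp => hh p (hs.1 hp)

theorem sieveSum_empty (h : ℕ → ℝ) (y : ℕ) : sieveSum h ∅ y = if 1 ≤ y then 1 else 0 := by
  unfold sieveSum
  rw [Finset.sum_filter]
  simp only [Finset.powerset_empty, Finset.sum_singleton, Finset.prod_empty]
  by_cases hy : 1 ≤ y <;> simp [hy]

theorem sieveSum_insert (h : ℕ → ℝ) {P : Finset ℕ} {q : ℕ} (hq : q ∉ P) (hq0 : 0 < q) (y : ℕ) :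
    sieveSum h (insert q P) y = sieveSum h P y + h q * sieveSum h P (y / q) := by
  unfold sieveSum
  rw [Finset.sum_filter, Finset.sum_powerset_insert hq, ← Finset.sum_filter]
  congr 1
  rw [Finset.mul_sum, Finset.sum_filter]
  refine Finset.sum_congr rfl fun s hs => ?_
  have hqs : q ∉ s := fun h => hq (Finset.mem_powerset.1 hs h)
  rw [Finset.prod_insert hqs, Finset.prod_insert hqs]
  simp only [Nat.le_div_iff_mul_le hq0, mul_comm q]

theorem sieveSum_mul_le {h₁ h₂ h₃ : ℕ → ℝ} {P : Finset ℕ} (hP : ∀ p ∈ P, 0 < p)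
    (hh₁ : ∀ p ∈ P, 0 ≤ h₁ p) (hh₂ : ∀ p ∈ P, 0 ≤ h₂ p)
    (hh : ∀ p ∈ P, (1 + h₁ p) * (1 + h₂ p) ≤ 1 + h₃ p) (y z : ℕ) :
    sieveSum h₁ P y * sieveSum h₂ P z ≤ sieveSum h₃ P (y * z) := by
  induction P using Finset.induction_on generalizing y z with
  | empty =>
    simp only [sieveSum_empty, Nat.one_le_iff_ne_zero, ne_eq, mul_eq_zero]
    split_ifs <;> simp_all
  | insert q P hq ih =>
    simp only [Finset.forall_mem_insert] at hP hh₁ hh₂ hh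
    have hh₃ : ∀ p ∈ P, 0 ≤ h₃ p := fun p hp => by
      nlinarith [hh.2 p hp, hh₁.2 p hp, hh₂.2 p hp, mul_nonneg (hh₁.2 p hp) (hh₂.2 p hp)]
    rw [sieveSum_insert _ hq hP.1, sieveSum_insert _ hq hP.1, sieveSum_insert _ hq hP.1]
    have ih' := ih hP.2 hh₁.2 hh₂.2 hh.2
    have m : ∀ u v, u * v ≤ y * z / q → sieveSum h₁ P u * sieveSum h₂ P v ≤ sieveSum h₃ P (y * z / q) :=
      fun u v huv => (ih' u v).trans (sieveSum_mono hh₃ huv)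
    have dm : y / q * z ≤ y * z / q := by
      rw [mul_comm, mul_comm y]
      exact Nat.mul_div_le_mul_div_assoc _ _ _
    have a0 := ih' y z
    have a1 := m (y / q) z dm
    have a2 := m y (z / q) (Nat.mul_div_le_mul_div_assoc _ _ _)
    have a3 := m (y / q) (z / q)
      ((Nat.mul_le_mul_left _ (Nat.div_le_self z q)).trans dm)
    have b := sieveSum_nonneg hh₃ (y * z / q)
    have c1 := mul_le_mul_of_nonneg_left a1 hh₁.1
    have c2 := mul_le_mul_of_nonneg_left a2 hh₂.1
    have c3 := mul_le_mul_of_nonneg_left a3 (mul_nonneg hh₁.1 hh₂.1)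
    have c4 := mul_le_mul_of_nonneg_right hh.1 b
    linarith

theorem sieveSum_le_prod_mul {h : ℕ → ℝ} (P : Finset ℕ) {R : Finset ℕ} (hPR : Disjoint P R)
    (hP : ∀ p ∈ P, 0 ≤ h p) (hR : ∀ p ∈ R, 0 < p ∧ 0 ≤ h p) (y : ℕ) :
    sieveSum h (R ∪ P) y ≤ (∏ q ∈ R, (1 + h q)) * sieveSum h P y := by
  induction R using Finset.induction_on with
  | empty => simp
  | insert q R hq ih =>
    simp only [Finset.forall_mem_insert] at hR
    rw [Finset.disjoint_insert_right] at hPR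
    have hq' : q ∉ R ∪ P := by simp [hq, hPR.1]
    have hpos : ∀ p ∈ R ∪ P, 0 ≤ h p := by
      intro p hp
      rcases Finset.mem_union.1 hp with hp | hp
      exacts [(hR.2 p hp).2, hP p hp]
    rw [Finset.insert_union, sieveSum_insert _ hq' hR.1.1, Finset.prod_insert hq, mul_assoc]
    have i := ih hPR.2 hR.2
    have m := sieveSum_mono hpos (Nat.div_le_self y q)
    calc _ ≤ sieveSum h (R ∪ P) y + h q * sieveSum h (R ∪ P) y := by
          have := hR.1.2
          gcongr
      _ = (1 + h q) * sieveSum h (R ∪ P) y := by ring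
      _ ≤ _ := mul_le_mul_of_nonneg_left i (by linarith [hR.1.2])

theorem sum_inv_le_sieveSum {P : Finset ℕ} (hP : ∀ p ∈ P, p.Prime) (y : ℕ) :
    ∑ n ∈ Finset.Icc 1 y with n.primeFactors ⊆ P, (1 : ℝ) / n ≤
      sieveSum (fun p => 1 / ((p : ℝ) - 1)) P y := by
  induction P using Finset.induction_on generalizing y with
  | empty =>
    rw [sieveSum_empty]
    split_ifs with hy
    · have : (Finset.Icc 1 y).filter (fun n => n.primeFactors ⊆ ∅) = {1} := by
        ext n
        simp only [Finset.mem_filter, Finset.mem_Icc, Finset.subset_empty, Nat.primeFactors_eq_empty,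
          Finset.mem_singleton]
        omega
      rw [this]
      simp
    · have : y = 0 := by omega
      simp [this]
  | insert q P hq ih =>
    simp only [Finset.forall_mem_insert] at hP
    have q2 : (2 : ℝ) ≤ q := by exact_mod_cast hP.1.two_le
    have hpos : ∀ p ∈ P, (0 : ℝ) ≤ 1 / ((p : ℝ) - 1) := fun p hp => by
      have : (2 : ℝ) ≤ p := by exact_mod_cast (hP.2 p hp).two_le
      exact div_nonneg zero_le_one (by linarith)
    induction y using Nat.strong_induction_on with
    | _ y ihy =>
      rcases Nat.eq_zero_or_pos y with rfl | hy
      · simp only [Finset.Icc_eq_empty (by norm_num : ¬ 1 ≤ 0), Finset.filter_empty, Finset.sum_empty]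
        refine sieveSum_nonneg ?_ _
        simp only [Finset.forall_mem_insert]
        exact ⟨div_nonneg zero_le_one (by linarith), hpos⟩
      have hlt : y / q < y := Nat.div_lt_self hy hP.1.one_lt
      have i1 := ihy (y / q) hlt
      have i2 := ih hP.2 y
      rw [sieveSum_insert _ hq hP.1.pos] at i1 ⊢
      rw [← Finset.sum_filter_add_sum_filter_not _ (fun n => ¬ q ∣ n)]
      have e1 : ∑ n ∈ ((Finset.Icc 1 y).filter fun n => n.primeFactors ⊆ insert q P).filter
          (fun n => ¬ q ∣ n), (1 : ℝ) / n ≤ ∑ n ∈ Finset.Icc 1 y with n.primeFactors ⊆ P, (1 : ℝ) / n := by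
        refine Finset.sum_le_sum_of_subset_of_nonneg ?_ fun _ _ _ => by positivity
        intro n hn
        simp only [Finset.mem_filter] at hn ⊢
        refine ⟨hn.1.1, fun p hp => ?_⟩
        rcases Finset.mem_insert.1 (hn.1.2 hp) with rfl | h
        · exact absurd (Nat.dvd_of_mem_primeFactors hp) hn.2
        · exact h
      have e2 : ∑ n ∈ ((Finset.Icc 1 y).filter fun n => n.primeFactors ⊆ insert q P).filter
          (fun n => ¬ ¬ q ∣ n), (1 : ℝ) / n ≤ ∑ m ∈ ((Finset.Icc 1 (y / q)).filter
            fun n => n.primeFactors ⊆ insert q P), (1 : ℝ) / q * (1 / m) := by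
        have : ∀ m ∈ ((Finset.Icc 1 (y / q)).filter fun n => n.primeFactors ⊆ insert q P),
            (1 : ℝ) / q * (1 / m) = 1 / ((q * m : ℕ) : ℝ) := by
          intro m _
          push_cast
          rw [one_div_mul_one_div]
        rw [Finset.sum_congr rfl this, ← Finset.sum_image (f := fun n : ℕ => (1 : ℝ) / n)
          (g := fun m => q * m)]
        · refine Finset.sum_le_sum_of_subset_of_nonneg ?_ fun _ _ _ => by positivity
          intro n hn
          simp only [Finset.mem_filter, not_not, Finset.mem_Icc] at hn
          obtain ⟨m, rfl⟩ := hn.2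
          have hm : m ≠ 0 := by
            rintro rfl
            simp at hn
          refine Finset.mem_image_of_mem _ ?_
          simp only [Finset.mem_filter, Finset.mem_Icc]
          refine ⟨⟨Nat.one_le_iff_ne_zero.2 hm, (Nat.le_div_iff_mul_le hP.1.pos).2 ?_⟩, ?_⟩
          · rw [mul_comm]
            exact hn.1.1.2
          · exact (Nat.primeFactors_mono (Dvd.intro_left q rfl) (mul_ne_zero hP.1.ne_zero hm)).trans hn.1.2
        · intro a _ b _ hab
          exact Nat.eq_of_mul_eq_mul_left hP.1.pos hab
      rw [← Finset.mul_sum] at e2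
      refine add_le_add (e1.trans i2) (e2.trans ?_)
      have m := sieveSum_mono hpos (Nat.div_le_self (y / q) q)
      have h1 : (1 : ℝ) / q * (1 + 1 / (q - 1)) = 1 / (q - 1) := by
        have : (q : ℝ) - 1 ≠ 0 := by linarith
        have : (q : ℝ) ≠ 0 := by linarith
        field_simp
        ring
      have h2 : 0 ≤ 1 / ((q : ℝ) - 1) := div_nonneg zero_le_one (by linarith)
      have h3 : 0 ≤ 1 / (q : ℝ) := by positivity
      calc _ ≤ 1 / (q : ℝ) * ((1 + 1 / (q - 1)) * sieveSum (fun p => 1 / ((p : ℝ) - 1)) P (y / q)) := by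
            refine mul_le_mul_of_nonneg_left (i1.trans ?_) h3
            nlinarith [mul_le_mul_of_nonneg_left m h2]
        _ = _ := by rw [← mul_assoc, h1]

theorem log_pow_four_le_sieveSum {P R : Finset ℕ} (hPR : Disjoint P R) (hP : ∀ p ∈ P, p.Prime ∧ 5 ≤ p)
    (hR : ∀ p ∈ R, p.Prime) {y : ℕ} (hy : ∀ p ≤ y, p.Prime → p ∈ R ∪ P) :
    Real.log (y + 1) ^ 4 ≤ (∏ q ∈ R, (1 + 1 / ((q : ℝ) - 1))) ^ 4 *
      sieveSum (fun p => (4 / p : ℝ) / (1 - 4 / p)) P (y ^ 4) := by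
  have hP5 : ∀ p ∈ P, (5 : ℝ) ≤ p := fun p hp => by exact_mod_cast (hP p hp).2
  have hR2 : ∀ p ∈ R, (2 : ℝ) ≤ p := fun p hp => by exact_mod_cast (hR p hp).two_le
  set J := sieveSum (fun p => 1 / ((p : ℝ) - 1)) P y with hJ
  have J0 : 0 ≤ J := sieveSum_nonneg (fun p hp => div_nonneg zero_le_one (by linarith [hP5 p hp])) y
  have h1 : Real.log (y + 1) ≤ (∏ q ∈ R, (1 + 1 / ((q : ℝ) - 1))) * J := by
    have e1 := sum_inv_le_sieveSum (P := R ∪ P) (by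
      intro p hp
      rcases Finset.mem_union.1 hp with hp | hp
      exacts [hR p hp, (hP p hp).1]) y
    have e2 := sieveSum_le_prod_mul (h := fun p => 1 / ((p : ℝ) - 1)) P hPR
      (fun p hp => div_nonneg zero_le_one (by linarith [hP5 p hp]))
      (fun p hp => ⟨(hR p hp).pos, div_nonneg zero_le_one (by linarith [hR2 p hp])⟩) y
    have e3 : (Finset.Icc 1 y).filter (fun n => n.primeFactors ⊆ R ∪ P) = Finset.Icc 1 y := by
      refine Finset.filter_true_of_mem fun n hn p hp => ?_
      rw [Finset.mem_Icc] at hn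
      exact hy p ((Nat.le_of_mem_primeFactors hp).trans hn.2) (Nat.prime_of_mem_primeFactors hp)
    rw [e3] at e1
    have e4 := log_add_one_le_harmonic y
    rw [harmonic_eq_sum_Icc] at e4
    push_cast at e4
    simp only [one_div] at e1 e2 hJ ⊢
    rw [hJ]
    linarith
  have h2 : J ^ 4 ≤ sieveSum (fun p => (4 / p : ℝ) / (1 - 4 / p)) P (y ^ 4) := by
    have e1 : J * J ≤ sieveSum (fun p => 2 / ((p : ℝ) - 2)) P (y * y) := by
      refine sieveSum_mul_le (fun p hp => (hP p hp).1.pos)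
        (fun p hp => div_nonneg zero_le_one (by linarith [hP5 p hp]))
        (fun p hp => div_nonneg zero_le_one (by linarith [hP5 p hp])) (fun p hp => ?_) y y
      have := hP5 p hp
      have a1 : (p : ℝ) - 1 ≠ 0 := by linarith
      have a2 : 0 < (p : ℝ) - 1 := by linarith
      have a3 : 0 < (p : ℝ) - 2 := by linarith
      rw [show (1 : ℝ) + 1 / (p - 1) = p / (p - 1) by field_simp; ring,
        show (1 : ℝ) + 2 / (p - 2) = p / (p - 2) by field_simp; ring, div_mul_div_comm,
        div_le_div_iff₀ (by positivity) a3]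
      nlinarith
    have e2 : sieveSum (fun p => 2 / ((p : ℝ) - 2)) P (y * y) * sieveSum (fun p => 2 / ((p : ℝ) - 2)) P (y * y)
        ≤ sieveSum (fun p => (4 / p : ℝ) / (1 - 4 / p)) P (y * y * (y * y)) := by
      refine sieveSum_mul_le (fun p hp => (hP p hp).1.pos)
        (fun p hp => div_nonneg zero_le_two (by linarith [hP5 p hp]))
        (fun p hp => div_nonneg zero_le_two (by linarith [hP5 p hp])) (fun p hp => ?_) _ _
      have := hP5 p hp
      have a0 : 0 < (p : ℝ) := by linarith
      have a2 : 0 < (p : ℝ) - 4 := by linarith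
      have a3 : 0 < (p : ℝ) - 2 := by linarith
      have a4 : (1 : ℝ) - 4 / p = (p - 4) / p := by field_simp
      rw [show (1 : ℝ) + 2 / (p - 2) = p / (p - 2) by field_simp; ring, a4,
        show (1 : ℝ) + 4 / p / ((p - 4) / p) = p / (p - 4) by field_simp; ring, div_mul_div_comm,
        div_le_div_iff₀ (by positivity) a2]
      nlinarith
    calc J ^ 4 = (J * J) * (J * J) := by ring
      _ ≤ _ := mul_le_mul e1 e1 (mul_nonneg J0 J0) ((mul_nonneg J0 J0).trans e1)
      _ ≤ _ := e2
      _ = _ := by congr 1; ring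
  have h3 : 0 ≤ Real.log (y + 1) := Real.log_nonneg (by linarith [(Nat.cast_nonneg y : (0 : ℝ) ≤ y)])
  calc Real.log (y + 1) ^ 4 ≤ ((∏ q ∈ R, (1 + 1 / ((q : ℝ) - 1))) * J) ^ 4 := pow_le_pow_left₀ h3 h1 4
    _ = (∏ q ∈ R, (1 + 1 / ((q : ℝ) - 1))) ^ 4 * J ^ 4 := mul_pow _ _ _
    _ ≤ _ := mul_le_mul_of_nonneg_left h2 (by positivity)

theorem prod_one_add_inv_le_exp {S : Finset ℕ} {w : ℕ} (hw : 0 < w) (hS : ∀ p ∈ S, w < p) :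
    ∏ p ∈ S, (1 + 1 / ((p : ℝ) - 1)) ≤ Real.exp (S.card / w) := by
  have hw' : (0 : ℝ) < w := by exact_mod_cast hw
  have h : ∀ p ∈ S, (1 + 1 / ((p : ℝ) - 1)) ≤ Real.exp (1 / w) := by
    intro p hp
    have : (w : ℝ) + 1 ≤ p := by exact_mod_cast hS p hp
    have h1 : 1 / ((p : ℝ) - 1) ≤ 1 / w := one_div_le_one_div_of_le hw' (by linarith)
    linarith [Real.add_one_le_exp (1 / (w : ℝ))]
  calc _ ≤ ∏ p ∈ S, Real.exp (1 / w) := Finset.prod_le_prod (fun p hp => by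
        have : (w : ℝ) + 1 ≤ p := by exact_mod_cast hS p hp
        have : 0 ≤ 1 / ((p : ℝ) - 1) := div_nonneg zero_le_one (by linarith)
        linarith) h
    _ = _ := by
        rw [Finset.prod_const, ← Real.exp_nat_mul]
        congr 1
        ring

theorem card_primes_dyadic_le (k : ℕ) :
    k * ((Nat.primesLE (2 ^ (k + 1))).filter fun p => 2 ^ k < p).card ≤ 4 * 2 ^ k := by
  set S := (Nat.primesLE (2 ^ (k + 1))).filter fun p => 2 ^ k < p with hS
  have h1 : (2 ^ k) ^ S.card ≤ ∏ p ∈ S, p :=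
    Finset.pow_card_le_prod _ _ _ fun p hp => (Finset.mem_filter.1 hp).2.le
  have h2 : ∏ p ∈ S, p ≤ ∏ p ∈ Nat.primesLE (2 ^ (k + 1)), p :=
    Finset.prod_le_prod_of_subset_of_one_le' (Finset.filter_subset _ _)
      fun p hp _ => (Nat.prime_of_mem_primesLE hp).one_le
  have h3 := primorial_le_four_pow (2 ^ (k + 1))
  rw [primorial_eq_prod_primesLE] at h3
  have h4 : 2 ^ (k * S.card) ≤ 2 ^ (2 * 2 ^ (k + 1)) := by
    calc 2 ^ (k * S.card) = (2 ^ k) ^ S.card := by rw [pow_mul]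
      _ ≤ 4 ^ 2 ^ (k + 1) := h1.trans (h2.trans h3)
      _ = _ := by rw [pow_mul]; norm_num
  have := (Nat.pow_le_pow_iff_right (by norm_num : 1 < 2)).1 h4
  rw [pow_succ] at this
  linarith

theorem exists_prod_primesLE_two_pow_le :
    ∃ C > (0 : ℝ), ∀ K : ℕ, (∏ p ∈ Nat.primesLE (2 ^ K), (1 + 1 / ((p : ℝ) - 1))) ^ 4 ≤ C * 2 ^ K := by
  set F : ℕ → ℝ := fun K => (∏ p ∈ Nat.primesLE (2 ^ K), (1 + 1 / ((p : ℝ) - 1))) ^ 4 with hF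
  have fpos : ∀ n, ∀ p ∈ Nat.primesLE n, (1 : ℝ) ≤ 1 + 1 / ((p : ℝ) - 1) := fun n p hp => by
    have : (2 : ℝ) ≤ p := by exact_mod_cast (Nat.prime_of_mem_primesLE hp).two_le
    have : 0 ≤ 1 / ((p : ℝ) - 1) := div_nonneg zero_le_one (by linarith)
    linarith
  have F0 : ∀ K, 0 ≤ F K := fun K => pow_nonneg (Finset.prod_nonneg fun p hp => by
    linarith [fpos _ p hp]) 4
  have Fstep : ∀ K, 24 ≤ K → F (K + 1) ≤ 2 * F K := by
    intro K hK
    have e1 := prod_one_add_inv_le_exp (S := (Nat.primesLE (2 ^ (K + 1))).filter fun p => 2 ^ K < p)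
      (w := 2 ^ K) (by positivity) (fun p hp => (Finset.mem_filter.1 hp).2)
    have e2 := card_primes_dyadic_le K
    set S := (Nat.primesLE (2 ^ (K + 1))).filter fun p => 2 ^ K < p with hS
    have e3 : ((Nat.primesLE (2 ^ (K + 1))).filter fun p => ¬ 2 ^ K < p) = Nat.primesLE (2 ^ K) := by
      ext p
      simp only [Finset.mem_filter, Nat.mem_primesLE, not_lt]
      refine ⟨fun h => ⟨h.2, h.1.2⟩, fun h => ⟨⟨h.1.trans ?_, h.2⟩, h.1⟩⟩
      exact Nat.pow_le_pow_right (by norm_num) (Nat.le_succ K)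
    have e4 : ((S.card : ℝ) / (2 ^ K : ℕ)) ≤ 1 / 6 := by
      have : (24 : ℝ) * S.card ≤ 4 * 2 ^ K := by
        exact_mod_cast (Nat.mul_le_mul_right _ hK).trans e2
      push_cast
      rw [div_le_iff₀ (by positivity)]
      linarith
    have e5 : (∏ p ∈ S, (1 + 1 / ((p : ℝ) - 1))) ^ 4 ≤ 2 := by
      have h0 : 0 ≤ ∏ p ∈ S, (1 + 1 / ((p : ℝ) - 1)) := Finset.prod_nonneg fun p hp => by
        linarith [fpos _ p (Finset.mem_filter.1 hp).1]
      calc _ ≤ (Real.exp (1 / 6)) ^ 4 :=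
            pow_le_pow_left₀ h0 (e1.trans (Real.exp_le_exp.2 e4)) 4
        _ = Real.exp (2 / 3) := by rw [← Real.exp_nat_mul]; norm_num
        _ ≤ Real.exp (Real.log 2) := Real.exp_le_exp.2 (by linarith [Real.log_two_gt_d9])
        _ = 2 := Real.exp_log (by norm_num)
    simp only [hF]
    rw [← Finset.prod_filter_mul_prod_filter_not (Nat.primesLE (2 ^ (K + 1))) (fun p => 2 ^ K < p), e3,
      mul_pow]
    exact mul_le_mul_of_nonneg_right e5 (F0 K)
  have hle : ∀ K, 24 ≤ K → F K ≤ F 24 * 2 ^ K := by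
    intro K hK
    induction K, hK using Nat.le_induction with
    | base => exact le_mul_of_one_le_right (F0 _) (one_le_pow₀ (by norm_num))
    | succ K hK ih =>
      calc _ ≤ 2 * F K := Fstep K hK
        _ ≤ 2 * (F 24 * 2 ^ K) := by linarith
        _ = _ := by ring
  refine ⟨F 24 + 1, by linarith [F0 24], fun K => ?_⟩
  have h2 : (1 : ℝ) ≤ 2 ^ K := one_le_pow₀ (by norm_num)
  rcases le_total 24 K with hK | hK
  · exact (hle K hK).trans (by nlinarith)
  · have : F K ≤ F 24 := by
      refine pow_le_pow_left₀ (Finset.prod_nonneg fun p hp => by linarith [fpos _ p hp]) ?_ 4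
      refine Finset.prod_le_prod_of_subset_of_one_le (Nat.primesLE_mono
        (Nat.pow_le_pow_right (by norm_num) hK)) (fun p hp => by linarith [fpos _ p hp])
        fun p hp _ => fpos _ p hp
    exact this.trans (by nlinarith [F0 24])

/-- `(n / φ(n)) ^ 4 ≪ log n`. -/
theorem exists_prod_primeFactors_le :
    ∃ C > (0 : ℝ), ∀ E : ℕ, 2 ≤ E →
      (∏ p ∈ E.primeFactors, (1 + 1 / ((p : ℝ) - 1))) ^ 4 ≤ C * Real.log E := by
  obtain ⟨C, C0, hC⟩ := exists_prod_primesLE_two_pow_le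
  refine ⟨Real.exp 1 ^ 4 * C * 4, by positivity, fun E hE => ?_⟩
  set l := Nat.log 2 E with hl
  set K := Nat.log 2 l + 1 with hK
  have hl0 : l ≠ 0 := (Nat.log_pos (by norm_num) hE).ne'
  have hlK : l < 2 ^ K := Nat.lt_pow_succ_log_self (by norm_num) l
  have hKl : 2 ^ K ≤ 2 * l := by
    rw [hK, pow_succ, mul_comm]
    exact Nat.mul_le_mul_left 2 (Nat.pow_log_le_self 2 hl0)
  have hlE : (l : ℝ) ≤ 2 * Real.log E := by
    have h1 : (2 : ℝ) ^ l ≤ E := by exact_mod_cast Nat.pow_log_le_self 2 (by omega : E ≠ 0)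
    have h2 := Real.log_le_log (by positivity) h1
    rw [Real.log_pow] at h2
    nlinarith [Real.log_two_gt_d9, (Nat.cast_nonneg l : (0 : ℝ) ≤ l)]
  have fpos : ∀ p : ℕ, p.Prime → (1 : ℝ) ≤ 1 + 1 / ((p : ℝ) - 1) := fun p hp => by
    have : (2 : ℝ) ≤ p := by exact_mod_cast hp.two_le
    have : 0 ≤ 1 / ((p : ℝ) - 1) := div_nonneg zero_le_one (by linarith)
    linarith
  have e1 := prod_one_add_inv_le_exp (S := E.primeFactors.filter fun p => 2 ^ K < p) (w := 2 ^ K)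
    (by positivity) (fun p hp => (Finset.mem_filter.1 hp).2)
  set S := E.primeFactors.filter fun p => 2 ^ K < p with hS
  have hcard : S.card ≤ l := by
    have h1 : 2 ^ S.card ≤ ∏ p ∈ S, p := Finset.pow_card_le_prod _ _ _ fun p hp =>
      (Nat.prime_of_mem_primeFactors (Finset.mem_filter.1 hp).1).two_le
    have h2 : ∏ p ∈ S, p ≤ ∏ p ∈ E.primeFactors, p :=
      Finset.prod_le_prod_of_subset_of_one_le' (Finset.filter_subset _ _)
        fun p hp _ => (Nat.prime_of_mem_primeFactors hp).one_le
    have h3 := Nat.le_of_dvd (by omega) (Nat.prod_primeFactors_dvd E)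
    exact Nat.le_log_of_pow_le (by norm_num) (h1.trans (h2.trans h3))
  have e2 : ((S.card : ℝ) / (2 ^ K : ℕ)) ≤ 1 := by
    rw [div_le_one (by positivity)]
    exact_mod_cast hcard.trans hlK.le
  have e3 : ∏ p ∈ S, (1 + 1 / ((p : ℝ) - 1)) ≤ Real.exp 1 := e1.trans (Real.exp_le_exp.2 e2)
  have e4 : ∏ p ∈ E.primeFactors with ¬ 2 ^ K < p, (1 + 1 / ((p : ℝ) - 1)) ≤
      ∏ p ∈ Nat.primesLE (2 ^ K), (1 + 1 / ((p : ℝ) - 1)) := by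
    refine Finset.prod_le_prod_of_subset_of_one_le (fun p hp => ?_)
      (fun p hp => ?_) fun p hp _ => fpos p (Nat.prime_of_mem_primesLE hp)
    · simp only [Finset.mem_filter, not_lt] at hp
      exact Nat.mem_primesLE.2 ⟨hp.2, Nat.prime_of_mem_primeFactors hp.1⟩
    · linarith [fpos p (Nat.prime_of_mem_primeFactors (Finset.mem_filter.1 hp).1)]
  have n1 : 0 ≤ ∏ p ∈ S, (1 + 1 / ((p : ℝ) - 1)) := Finset.prod_nonneg fun p hp => by
    linarith [fpos p (Nat.prime_of_mem_primeFactors (Finset.mem_filter.1 hp).1)]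
  have n2 : 0 ≤ ∏ p ∈ E.primeFactors with ¬ 2 ^ K < p, (1 + 1 / ((p : ℝ) - 1)) :=
    Finset.prod_nonneg fun p hp => by
      linarith [fpos p (Nat.prime_of_mem_primeFactors (Finset.mem_filter.1 hp).1)]
  rw [← Finset.prod_filter_mul_prod_filter_not E.primeFactors (fun p => 2 ^ K < p), mul_pow]
  have hK' : (2 : ℝ) ^ K ≤ 4 * Real.log E := by
    have : (2 : ℝ) ^ K ≤ 2 * l := by exact_mod_cast hKl
    linarith
  calc _ ≤ Real.exp 1 ^ 4 * (C * 2 ^ K) := by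
        refine mul_le_mul (pow_le_pow_left₀ n1 e3 4) ((pow_le_pow_left₀ n2 e4 4).trans (hC K))
          (pow_nonneg n2 4) (by positivity)
    _ ≤ Real.exp 1 ^ 4 * (C * (4 * Real.log E)) := by gcongr
    _ = _ := by ring
theorem card_residues_block {s : Finset ℕ} (hs : ∀ p ∈ s, p.Prime) (Ω : ℕ → Finset ℕ)
    (hΩ : ∀ p ∈ s, Ω p ⊆ Finset.range p) :
    ((Finset.range (∏ p ∈ s, p)).filter fun d => ∀ p ∈ s, d % p ∈ Ω p).card = ∏ p ∈ s, (Ω p).card := by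
  have hco : Set.Pairwise (s : Set ℕ) (Function.onFun Nat.Coprime fun p => p) := fun p hp q hq hpq =>
    (Nat.coprime_primes (hs p hp) (hs q hq)).2 hpq
  rw [← Finset.card_pi]
  refine Finset.card_bij (fun d _ => fun p _ => d % p) ?_ ?_ ?_
  · intro d hd
    rw [Finset.mem_pi]
    exact (Finset.mem_filter.1 hd).2
  · intro d hd e he hde
    simp only [Finset.mem_filter, Finset.mem_range] at hd he
    have h1 : d ≡ e [MOD ∏ p ∈ s, p] := by
      rw [Nat.modEq_iff_dvd]
      push_cast
      refine Finset.prod_dvd_of_coprime (fun p hp q hq hpq => ?_) fun p hp => ?_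
      · exact Nat.isCoprime_iff_coprime.2 (hco hp hq hpq)
      · rw [← Nat.modEq_iff_dvd]
        exact congrFun (congrFun hde p) hp
    exact Nat.ModEq.eq_of_lt_of_lt h1 hd.1 he.1
  · intro f hf
    rw [Finset.mem_pi] at hf
    have hs0 : ∀ p ∈ s, p ≠ 0 := fun p hp => (hs p hp).ne_zero
    set a : ℕ → ℕ := fun p => if hp : p ∈ s then f p hp else 0 with ha
    obtain ⟨k, hk, hlt⟩ : ∃ k, (∀ p ∈ s, k ≡ a p [MOD p]) ∧ k < ∏ p ∈ s, p :=
      ⟨_, (Nat.chineseRemainderOfFinset a (fun p => p) s hs0 hco).2,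
        Nat.chineseRemainderOfFinset_lt_prod a (fun p => p) hs0 hco⟩
    have hk' : ∀ p (hp : p ∈ s), k % p = f p hp := by
      intro p hp
      have h1 : k % p = a p % p := hk p hp
      have h2 : f p hp < p := Finset.mem_range.1 (hΩ p hp (hf p hp))
      simp only [ha, hp, dif_pos, Nat.mod_eq_of_lt h2] at h1
      exact h1
    refine ⟨k, ?_, ?_⟩
    · rw [Finset.mem_filter, Finset.mem_range]
      exact ⟨hlt, fun p hp => by rw [hk' p hp]; exact hf p hp⟩
    · funext p hp
      exact hk' p hp

theorem card_residues_approx {s : Finset ℕ} (hs : ∀ p ∈ s, p.Prime) (Ω : ℕ → Finset ℕ)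
    (hΩ : ∀ p ∈ s, Ω p ⊆ Finset.range p) (X : ℕ) :
    |(((Finset.range X).filter fun d => ∀ p ∈ s, d % p ∈ Ω p).card : ℝ) -
      X * ∏ p ∈ s, ((Ω p).card / p : ℝ)| ≤ ∏ p ∈ s, (p : ℝ) := by
  have hblock := card_residues_block hs Ω hΩ
  rw [← Nat.count_eq_card_filter_range] at hblock ⊢
  have hl0 : 0 < ∏ p ∈ s, p := Finset.prod_pos fun p hp => (hs p hp).pos
  rw [Finset.prod_div_distrib]
  have c1 : (∏ p ∈ s, ((Ω p).card : ℝ)) = ((∏ p ∈ s, (Ω p).card : ℕ) : ℝ) := by push_cast; rfl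
  have c2 : (∏ p ∈ s, (p : ℝ)) = ((∏ p ∈ s, p : ℕ) : ℝ) := by push_cast; rfl
  rw [c1, c2, ← hblock]
  set Q : ℕ → Prop := fun d => ∀ p ∈ s, d % p ∈ Ω p with hQ
  set l := ∏ p ∈ s, p with hl
  have hper : ∀ a d, Q (l * a + d) ↔ Q d := by
    intro a d
    refine forall₂_congr fun p hp => ?_
    obtain ⟨c, hc⟩ : p ∣ l := Finset.dvd_prod_of_mem _ hp
    rw [hc, mul_assoc, Nat.mul_add_mod]
  have hmul : ∀ k r, Nat.count Q (l * k + r) = k * Nat.count Q l + Nat.count Q r := by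
    intro k r
    induction k generalizing r with
    | zero => simp
    | succ k ih =>
      rw [mul_add, mul_one, add_assoc, ih, Nat.count_add]
      have := hper 1
      simp only [mul_one] at this
      simp only [this]
      ring
  have hX := hmul (X / l) (X % l)
  rw [Nat.div_add_mod] at hX
  have hr : Nat.count Q (X % l) ≤ l := (Nat.count_le Q).trans (Nat.mod_lt _ hl0).le
  have hρ : Nat.count Q l ≤ l := Nat.count_le Q
  have hXr : (X : ℝ) = l * (X / l : ℕ) + (X % l : ℕ) := by
    exact_mod_cast (Nat.div_add_mod X l).symm
  have hl0' : (0 : ℝ) < l := by exact_mod_cast hl0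
  have hr' : (Nat.count Q (X % l) : ℝ) ≤ l := by exact_mod_cast hr
  have hρ' : (Nat.count Q l : ℝ) ≤ l := by exact_mod_cast hρ
  have hm : ((X % l : ℕ) : ℝ) ≤ l := by exact_mod_cast (Nat.mod_lt _ hl0).le
  rw [hX, hXr]
  push_cast
  have e : ((X / l : ℕ) * (Nat.count Q l : ℝ) + Nat.count Q (X % l) -
      (l * (X / l : ℕ) + (X % l : ℕ)) * (Nat.count Q l / l)) =
      Nat.count Q (X % l) - (X % l : ℕ) * (Nat.count Q l / l) := by
    field_simp
    ring
  rw [e]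
  have h1 : (Nat.count Q l : ℝ) / l ≤ 1 := (div_le_one hl0').2 hρ'
  have h2 : 0 ≤ (Nat.count Q l : ℝ) / l := by positivity
  have h3 : ((X % l : ℕ) : ℝ) * (Nat.count Q l / l) ≤ l * 1 := mul_le_mul hm h1 h2 hl0'.le
  have h4 : 0 ≤ ((X % l : ℕ) : ℝ) * (Nat.count Q l / l) := by positivity
  have h5 : (0 : ℝ) ≤ Nat.count Q (X % l) := Nat.cast_nonneg _
  rw [abs_le]
  constructor <;> linarith

theorem sieve_four_classes {P : Finset ℕ} (hP : ∀ p ∈ P, p.Prime ∧ 5 ≤ p) (Ω : ℕ → Finset ℕ)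
    (hΩ : ∀ p ∈ P, Ω p ⊆ Finset.range p) (hΩ4 : ∀ p ∈ P, (Ω p).card = 4) (X : ℕ) {R : ℕ} (hR : 1 ≤ R) :
    (((Finset.range X).filter fun d => ∀ p ∈ P, d % p ∉ Ω p).card : ℝ) ≤
      X / sieveSum (fun p => (4 / p : ℝ) / (1 - 4 / p)) P R + (R : ℝ) ^ 6 := by
  have h5 : ∀ p ∈ P, (5 : ℝ) ≤ p := fun p hp => by exact_mod_cast (hP p hp).2
  set 𝒟 := P.powerset.filter fun s => ∏ p ∈ s, p ≤ R with h𝒟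
  have m𝒟 : ∀ s, s ∈ 𝒟 ↔ s ⊆ P ∧ ∏ p ∈ s, p ≤ R := fun s => by simp [h𝒟]
  have hone : ∀ s ∈ 𝒟, ∀ p ∈ s, 1 ≤ p := fun s hs p hp => (hP p (((m𝒟 s).1 hs).1 hp)).1.one_le
  have key := selberg_upper_bound (Finset.range X) (fun d => P.filter fun p => d % p ∈ Ω p) 𝒟
    (fun s hs t hts => by
      rw [m𝒟] at hs ⊢
      refine ⟨hts.trans hs.1, le_trans ?_ hs.2⟩
      exact Finset.prod_le_prod_of_subset_of_one_le' hts fun p hp _ => (hP p (hs.1 hp)).1.one_le)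
    (by rw [m𝒟]; simpa using hR) (fun p => (4 / p : ℝ))
    (fun s hs i hi => by
      have := h5 i (((m𝒟 s).1 hs).1 hi)
      exact ⟨by positivity, (div_lt_one (by linarith)).2 (by linarith)⟩)
    X R ((R : ℝ) ^ 2)
    (fun s hs t ht => by
      have hs' := (m𝒟 s).1 hs
      have ht' := (m𝒟 t).1 ht
      have hsub : s ∪ t ⊆ P := Finset.union_subset hs'.1 ht'.1
      have h1 := card_residues_approx (s := s ∪ t) (fun p hp => (hP p (hsub hp)).1) Ω
        (fun p hp => hΩ p (hsub hp)) X
      have h2 : ∏ p ∈ s ∪ t, ((Ω p).card / p : ℝ) = ∏ p ∈ s ∪ t, (4 / p : ℝ) :=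
        Finset.prod_congr rfl fun p hp => by rw [hΩ4 p (hsub hp)]; norm_num
      rw [h2] at h1
      have h3 : (Finset.range X).filter (fun d => s ∪ t ⊆ P.filter fun p => d % p ∈ Ω p) =
          (Finset.range X).filter fun d => ∀ p ∈ s ∪ t, d % p ∈ Ω p := by
        refine Finset.filter_congr fun d _ => ?_
        refine ⟨fun h p hp => (Finset.mem_filter.1 (h hp)).2, fun h p hp => ?_⟩
        exact Finset.mem_filter.2 ⟨hsub hp, h p hp⟩
      rw [h3]
      refine h1.trans ?_
      have h4 : ∏ p ∈ s ∪ t, p ≤ R * R := by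
        calc ∏ p ∈ s ∪ t, p ≤ (∏ p ∈ s ∪ t, p) * ∏ p ∈ s ∩ t, p :=
              Nat.le_mul_of_pos_right _ (Finset.prod_pos fun p hp =>
                hone s hs p (Finset.mem_of_mem_inter_left hp))
          _ = (∏ p ∈ s, p) * ∏ p ∈ t, p := Finset.prod_union_inter
          _ ≤ R * R := Nat.mul_le_mul hs'.2 ht'.2
      calc (∏ p ∈ s ∪ t, (p : ℝ)) = ((∏ p ∈ s ∪ t, p : ℕ) : ℝ) := by push_cast; rfl
        _ ≤ ((R * R : ℕ) : ℝ) := by exact_mod_cast h4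
        _ = _ := by push_cast; ring)
    (fun s hs => by
      have hs' := (m𝒟 s).1 hs
      rw [← Finset.prod_inv_distrib]
      calc ∏ p ∈ s, (4 / p : ℝ)⁻¹ ≤ ∏ p ∈ s, (p : ℝ) := by
            refine Finset.prod_le_prod (fun p _ => by positivity) fun p _ => ?_
            rw [inv_div]
            linarith [(Nat.cast_nonneg p : (0 : ℝ) ≤ p)]
        _ = ((∏ p ∈ s, p : ℕ) : ℝ) := by push_cast; rfl
        _ ≤ R := by exact_mod_cast hs'.2)
  have hcard : 𝒟.card ≤ R := by
    have : 𝒟.card ≤ (Finset.Icc 1 R).card := by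
      refine Finset.card_le_card_of_injOn (fun s => ∏ p ∈ s, p) (fun s hs => ?_) fun s hs t ht hst => ?_
      · have hs' := (m𝒟 s).1 hs
        rw [Finset.mem_coe, Finset.mem_Icc]
        exact ⟨Nat.one_le_iff_ne_zero.2 (Finset.prod_pos fun p hp => hone s hs p hp).ne', hs'.2⟩
      · have hs' := (m𝒟 s).1 hs
        have ht' := (m𝒟 t).1 ht
        rw [← Nat.primeFactors_prod fun p hp => (hP p (hs'.1 hp)).1,
          ← Nat.primeFactors_prod fun p hp => (hP p (ht'.1 hp)).1]
        exact congrArg _ hst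
    simpa using this
  have hfil : (Finset.range X).filter (fun d => (P.filter fun p => d % p ∈ Ω p) = ∅) =
      (Finset.range X).filter fun d => ∀ p ∈ P, d % p ∉ Ω p :=
    Finset.filter_congr fun d _ => Finset.filter_eq_empty_iff
  rw [hfil] at key
  refine key.trans (add_le_add le_rfl ?_)
  have h1 : (𝒟.card : ℝ) ≤ R := by exact_mod_cast hcard
  calc (𝒟.card : ℝ) ^ 2 * (R : ℝ) ^ 2 * (R : ℝ) ^ 2 ≤ (R : ℝ) ^ 2 * (R : ℝ) ^ 2 * (R : ℝ) ^ 2 := by gcongr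
    _ = _ := by ring
theorem exists_four_roots {K : Type*} [Field K] [DecidableEq K] {A B D : K} (h2 : (2 : K) ≠ 0)
    (hA : A ≠ 0) (hB : B ≠ 0) (hD : D ≠ 0) (hBD : B ^ 4 - D ^ 4 ≠ 0) :
    ∃ T : Finset K, T.card = 4 ∧ ∀ t : K, t ∈ T ↔
      (D * t + A * B) * (D * t - A * B) * ((B * t + A * D) * (B * t - A * D)) = 0 := by
  obtain ⟨x, hx⟩ : ∃ x, A * B = D * x := ⟨A * B / D, by field_simp⟩
  obtain ⟨z, hz⟩ : ∃ z, A * D = B * z := ⟨A * D / B, by field_simp⟩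
  have hx0 : x ≠ 0 := fun h => mul_ne_zero hA hB (by rw [hx, h, mul_zero])
  have hz0 : z ≠ 0 := fun h => mul_ne_zero hA hD (by rw [hz, h, mul_zero])
  have hself : ∀ w : K, w ≠ 0 → w ≠ -w := fun w hw h =>
    mul_ne_zero h2 hw (by linear_combination h)
  have hBD2 : B ^ 2 - D ^ 2 ≠ 0 := fun h => hBD (by linear_combination (B ^ 2 + D ^ 2) * h)
  have hBD2' : B ^ 2 + D ^ 2 ≠ 0 := fun h => hBD (by linear_combination (B ^ 2 - D ^ 2) * h)
  have hxz : x ≠ z := fun h => mul_ne_zero hA hBD2 (by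
    linear_combination B * hx - D * hz + B * D * h)
  have hxz' : x ≠ -z := fun h => mul_ne_zero hA hBD2' (by
    linear_combination B * hx + D * hz + B * D * h)
  have hzx : -x ≠ z := fun h => hxz' (by rw [← h, neg_neg])
  refine ⟨{x, -x, z, -z}, ?_, fun t => ?_⟩
  · rw [Finset.card_insert_of_notMem, Finset.card_insert_of_notMem, Finset.card_insert_of_notMem,
      Finset.card_singleton]
    · rw [Finset.mem_singleton]
      exact hself z hz0
    · rw [Finset.mem_insert, Finset.mem_singleton, not_or]
      exact ⟨hzx, fun h => hxz (neg_injective h)⟩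
    · rw [Finset.mem_insert, Finset.mem_insert, Finset.mem_singleton, not_or, not_or]
      exact ⟨hself x hx0, hxz, hxz'⟩
  · have e : (D * t + A * B) * (D * t - A * B) * ((B * t + A * D) * (B * t - A * D)) =
        (D * D * (B * B)) * ((t - x) * ((t + x) * ((t - z) * (t + z)))) := by
      rw [hx, hz]
      ring
    have hBD0 : D * D * (B * B) ≠ 0 := mul_ne_zero (mul_ne_zero hD hD) (mul_ne_zero hB hB)
    rw [e, mul_eq_zero_iff_left hBD0, mul_eq_zero, mul_eq_zero, mul_eq_zero, sub_eq_zero, sub_eq_zero,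
      ← eq_neg_iff_add_eq_zero, ← eq_neg_iff_add_eq_zero, Finset.mem_insert, Finset.mem_insert,
      Finset.mem_insert, Finset.mem_singleton]

theorem card_roots_four {p : ℕ} (hp : p.Prime) (hp2 : p ≠ 2) {a b c : ℕ} (ha : ¬ p ∣ a) (hb : ¬ p ∣ b)
    (hc : ¬ p ∣ c) (hbc : ¬ (p : ℤ) ∣ (b : ℤ) ^ 4 - (c : ℤ) ^ 4) :
    ((Finset.range p).filter fun d : ℕ => (p : ℤ) ∣
      (c * d + a * b) * (c * d - a * b) * ((b * d + a * c) * (b * d - a * c))).card = 4 := by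
  have : Fact p.Prime := ⟨hp⟩
  have ha' : (a : ZMod p) ≠ 0 := by rwa [Ne, ZMod.natCast_eq_zero_iff]
  have hb' : (b : ZMod p) ≠ 0 := by rwa [Ne, ZMod.natCast_eq_zero_iff]
  have hc' : (c : ZMod p) ≠ 0 := by rwa [Ne, ZMod.natCast_eq_zero_iff]
  have hbc' : (b : ZMod p) ^ 4 - (c : ZMod p) ^ 4 ≠ 0 := by
    rw [← ZMod.intCast_zmod_eq_zero_iff_dvd] at hbc
    push_cast at hbc
    exact hbc
  have h2 : (2 : ZMod p) ≠ 0 := by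
    have : ((2 : ℕ) : ZMod p) ≠ 0 := by
      rw [Ne, ZMod.natCast_eq_zero_iff]
      exact fun h => hp2 ((Nat.prime_dvd_prime_iff_eq hp Nat.prime_two).1 h)
    exact_mod_cast this
  obtain ⟨T, hcard, hiff⟩ := exists_four_roots h2 ha' hb' hc' hbc'
  rw [← hcard, ← Finset.card_image_of_injective T (ZMod.val_injective p)]
  congr 1
  ext d
  have hd : (p : ℤ) ∣ (c * d + a * b) * (c * d - a * b) * ((b * d + a * c) * (b * d - a * c)) ↔
      (d : ZMod p) ∈ T := by
    rw [hiff, ← ZMod.intCast_zmod_eq_zero_iff_dvd]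
    simp only [Int.cast_mul, Int.cast_add, Int.cast_sub, Int.cast_natCast]
  rw [Finset.mem_filter, Finset.mem_image, Finset.mem_range, hd]
  constructor
  · rintro ⟨h1, h2⟩
    exact ⟨d, h2, ZMod.val_cast_of_lt h1⟩
  · rintro ⟨t, h1, rfl⟩
    refine ⟨ZMod.val_lt t, ?_⟩
    rwa [ZMod.natCast_zmod_val]

theorem card_abs_linear_eq_two_mul_pow_le {c : ℕ} (hc : 1 ≤ c) (t : ℤ) (X y K : ℕ) :
    ((Finset.range X).filter fun d : ℕ => ∃ p ≤ y, ∃ k ≤ K, (c * d + t : ℤ).natAbs = 2 * p ^ k).card ≤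
      2 * ((y + 1) * (K + 1)) := by
  have hsub : ((Finset.range X).filter fun d : ℕ => ∃ p ≤ y, ∃ k ≤ K,
      (c * d + t : ℤ).natAbs = 2 * p ^ k) ⊆
      (({1, -1} : Finset ℤ) ×ˢ (Finset.range (y + 1) ×ˢ Finset.range (K + 1))).image
        fun x => ((x.1 * (2 * (x.2.1 : ℤ) ^ x.2.2) - t) / c).toNat := by
    intro d hd
    obtain ⟨-, p, hp, k, hk, h⟩ := Finset.mem_filter.1 hd
    rw [Finset.mem_image]
    have hc0 : (c : ℤ) ≠ 0 := by exact_mod_cast (by omega : c ≠ 0)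
    have h' := (c * d + t : ℤ).natAbs_eq
    rw [h] at h'
    push_cast at h'
    have hmem : (p, k) ∈ Finset.range (y + 1) ×ˢ Finset.range (K + 1) := by
      simp only [Finset.mem_product, Finset.mem_range]; omega
    rcases h' with h' | h'
    · refine ⟨(1, p, k), Finset.mem_product.2 ⟨by simp, hmem⟩, ?_⟩
      have : (1 * (2 * (p : ℤ) ^ k) - t) = c * d := by linarith
      simp only [this, Int.mul_ediv_cancel_left _ hc0, Int.toNat_natCast]
    · refine ⟨(-1, p, k), Finset.mem_product.2 ⟨by simp, hmem⟩, ?_⟩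
      have : (-1 * (2 * (p : ℤ) ^ k) - t) = c * d := by linarith
      simp only [this, Int.mul_ediv_cancel_left _ hc0, Int.toNat_natCast]
  refine (Finset.card_le_card hsub).trans (Finset.card_image_le.trans ?_)
  rw [Finset.card_product, Finset.card_product, Finset.card_range, Finset.card_range]
  simp

/-- Twice a prime power not exceeding `2 * Y`, up to sign. -/
def IsTwicePrimePow (Y : ℕ) (z : ℤ) : Prop := ∃ q ≤ Y, IsPrimePow q ∧ z.natAbs = 2 * q

theorem IsTwicePrimePow.eq_pow_of_dvd {Y : ℕ} {z : ℤ} (h : IsTwicePrimePow Y z) {p : ℕ} (hp : p.Prime)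
    (hp2 : p ≠ 2) (hpz : (p : ℤ) ∣ z) : ∃ k ≤ Nat.log 2 Y, z.natAbs = 2 * p ^ k := by
  obtain ⟨q, hqY, hq, hz⟩ := h
  obtain ⟨r, k, hr, hk, rfl⟩ := (isPrimePow_nat_iff q).1 hq
  have h1 : p ∣ 2 * r ^ k := by rw [← hz]; exact Int.natCast_dvd.1 hpz
  rcases hp.dvd_mul.1 h1 with h | h
  · exact absurd ((Nat.prime_dvd_prime_iff_eq hp Nat.prime_two).1 h) hp2
  · have := (Nat.prime_dvd_prime_iff_eq hp hr).1 (hp.dvd_of_dvd_pow h)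
    subst this
    refine ⟨k, ?_, hz⟩
    refine Nat.le_log_of_pow_le one_lt_two (le_trans ?_ hqY)
    exact Nat.pow_le_pow_left hp.two_le k

theorem card_four_forms_le {a b c : ℕ} (ha : 1 ≤ a) (hb : 1 ≤ b) (hc : 1 ≤ c) (hbc : b ≠ c)
    (Y X : ℕ) {y : ℕ} (hy : 1 ≤ y) {E : ℕ} (hE : E = 6 * a * b * c * ((b : ℤ) ^ 4 - (c : ℤ) ^ 4).natAbs)
    (S : Finset ℕ) (hS : ∀ d ∈ S, d < X ∧ IsTwicePrimePow Y (c * d + a * b) ∧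
      IsTwicePrimePow Y (c * d - a * b) ∧ IsTwicePrimePow Y (b * d + a * c) ∧
      IsTwicePrimePow Y (b * d - a * c)) :
    (S.card : ℝ) ≤ X * (∏ p ∈ E.primeFactors, (1 + 1 / ((p : ℝ) - 1))) ^ 4 / Real.log (y + 1) ^ 4 +
      (y : ℝ) ^ 24 + 8 * ((y + 1) * (Nat.log 2 Y + 1)) := by
  have hE0 : E ≠ 0 := by
    rw [hE]
    have h1 : ((b : ℤ) ^ 4 - (c : ℤ) ^ 4).natAbs ≠ 0 := by
      rw [Int.natAbs_ne_zero, sub_ne_zero]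
      intro h
      exact hbc (Nat.pow_left_injective (n := 4) (by norm_num) (by exact_mod_cast h))
    have : a ≠ 0 := by omega
    have : b ≠ 0 := by omega
    have : c ≠ 0 := by omega
    positivity
  set P := (Nat.primesLE y).filter fun p => ¬ p ∣ E with hPdef
  set R := (Nat.primesLE y).filter fun p => p ∣ E with hRdef
  have hPm : ∀ p ∈ P, p.Prime ∧ p ≤ y ∧ ¬ p ∣ E := fun p hp => by
    have := Finset.mem_filter.1 hp
    rw [Nat.mem_primesLE] at this
    exact ⟨this.1.2, this.1.1, this.2⟩
  have hRm : ∀ p ∈ R, p.Prime ∧ p ∣ E := fun p hp => by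
    have := Finset.mem_filter.1 hp
    rw [Nat.mem_primesLE] at this
    exact ⟨this.1.2, this.2⟩
  have hP5 : ∀ p ∈ P, p.Prime ∧ 5 ≤ p := by
    intro p hp
    obtain ⟨h1, -, h2⟩ := hPm p hp
    refine ⟨h1, ?_⟩
    by_contra! h
    have h2p := h1.two_le
    interval_cases p
    · exact h2 (hE ▸ ((((by norm_num : 2 ∣ 6).mul_right _).mul_right _).mul_right _).mul_right _)
    · exact h2 (hE ▸ ((((by norm_num : 3 ∣ 6).mul_right _).mul_right _).mul_right _).mul_right _)
    · exact absurd h1 (by norm_num)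
  have hlow := log_pow_four_le_sieveSum (P := P) (R := R)
    (Finset.disjoint_filter.2 fun p _ h1 h2 => h1 h2)
    hP5 (fun p hp => (hRm p hp).1) (y := y) (fun p hpy hp => by
      by_cases h : p ∣ E
      · exact Finset.mem_union_left _ (Finset.mem_filter.2 ⟨Nat.mem_primesLE.2 ⟨hpy, hp⟩, h⟩)
      · exact Finset.mem_union_right _ (Finset.mem_filter.2 ⟨Nat.mem_primesLE.2 ⟨hpy, hp⟩, h⟩))
  set V := sieveSum (fun p => (4 / p : ℝ) / (1 - 4 / p)) P (y ^ 4) with hV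
  have hlog : 0 < Real.log (y + 1) := Real.log_pos (by
    have : (1 : ℝ) ≤ y := by exact_mod_cast hy
    linarith)
  have hRE : ∏ q ∈ R, (1 + 1 / ((q : ℝ) - 1)) ≤ ∏ p ∈ E.primeFactors, (1 + 1 / ((p : ℝ) - 1)) := by
    have hq : ∀ q ∈ E.primeFactors, (0 : ℝ) ≤ 1 / ((q : ℝ) - 1) := fun q hq => by
      have : (1 : ℝ) ≤ q := by exact_mod_cast (Nat.prime_of_mem_primeFactors hq).one_le
      exact div_nonneg zero_le_one (by linarith)
    have hsub : R ⊆ E.primeFactors := fun p hp =>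
      Nat.mem_primeFactors.2 ⟨(hRm p hp).1, (hRm p hp).2, hE0⟩
    exact Finset.prod_le_prod_of_subset_of_one_le hsub
      (fun q h => by linarith [hq q (hsub h)]) fun q h _ => by linarith [hq q h]
  have hR0 : 0 ≤ ∏ q ∈ R, (1 + 1 / ((q : ℝ) - 1)) := Finset.prod_nonneg fun q hq => by
    have : (1 : ℝ) ≤ q := by exact_mod_cast (hRm q hq).1.one_le
    have := div_nonneg zero_le_one (by linarith : (0 : ℝ) ≤ (q : ℝ) - 1)
    linarith
  set G := ∏ p ∈ E.primeFactors, (1 + 1 / ((p : ℝ) - 1)) with hG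
  have hV0 : 0 ≤ V := sieveSum_nonneg (fun p hp => by
    have : (5 : ℝ) ≤ p := by exact_mod_cast (hP5 p hp).2
    have h4 : (4 / p : ℝ) < 1 := (div_lt_one (by linarith)).2 (by linarith)
    exact div_nonneg (by positivity) (by linarith)) _
  have hlow' : Real.log (y + 1) ^ 4 ≤ G ^ 4 * V := hlow.trans (by gcongr)
  have hVpos : 0 < V := by
    rcases hV0.lt_or_eq with h | h
    · exact h
    · rw [← h, mul_zero] at hlow'
      exact absurd hlow' (not_le.2 (by positivity))
  set F : ℕ → ℤ := fun d => (c * d + a * b) * (c * d - a * b) * ((b * d + a * c) * (b * d - a * c))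
    with hF
  set Ω : ℕ → Finset ℕ := fun p => (Finset.range p).filter fun d : ℕ => (p : ℤ) ∣ F d with hΩ
  have hsieve := sieve_four_classes hP5 Ω (fun p _ => Finset.filter_subset _ _)
    (fun p hp => by
      obtain ⟨h1, -, h2⟩ := hPm p hp
      refine card_roots_four h1 (by have := (hP5 p hp).2; omega) ?_ ?_ ?_ ?_
      · exact fun h => h2 (hE ▸ (((h.mul_left _).mul_right _).mul_right _).mul_right _)
      · exact fun h => h2 (hE ▸ ((h.mul_left _).mul_right _).mul_right _)
      · exact fun h => h2 (hE ▸ (h.mul_left _).mul_right _)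
      · exact fun h => h2 (hE ▸ (Int.natCast_dvd.1 h).mul_left _))
    X (R := y ^ 4) (Nat.one_le_pow _ _ hy)
  have hΩm : ∀ p ∈ P, ∀ d : ℕ, (p : ℤ) ∣ F d → d % p ∈ Ω p := by
    intro p hp d hd
    rw [hΩ]
    refine Finset.mem_filter.2 ⟨Finset.mem_range.2 (Nat.mod_lt _ (hPm p hp).1.pos), ?_⟩
    have hmod : ((d % p : ℕ) : ℤ) ≡ d [ZMOD p] := by
      push_cast
      exact Int.mod_modEq _ _
    have hFm : F (d % p) ≡ F d [ZMOD p] := by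
      simp only [hF]
      gcongr
    exact (Int.ModEq.dvd_iff hFm).2 hd
  set Ex : ℕ → ℤ → Finset ℕ := fun c t => (Finset.range X).filter fun d : ℕ =>
    ∃ p ≤ y, ∃ k ≤ Nat.log 2 Y, (c * d + t : ℤ).natAbs = 2 * p ^ k with hEx
  have hcover : S ⊆ ((Finset.range X).filter fun d => ∀ p ∈ P, d % p ∉ Ω p) ∪
      ((Ex c (a * b) ∪ Ex c (-(a * b))) ∪ (Ex b (a * c) ∪ Ex b (-(a * c)))) := by
    intro d hd
    obtain ⟨hdX, f1, f2, f3, f4⟩ := hS d hd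
    by_cases hall : ∀ p ∈ P, d % p ∉ Ω p
    · exact Finset.mem_union_left _ (Finset.mem_filter.2 ⟨Finset.mem_range.2 hdX, hall⟩)
    push Not at hall
    obtain ⟨p, hp, hpd⟩ := hall
    refine Finset.mem_union_right _ ?_
    obtain ⟨hpp, hpy, -⟩ := hPm p hp
    have hp2 : p ≠ 2 := by have := (hP5 p hp).2; omega
    have hdvd : (p : ℤ) ∣ F d := by
      have h1 := (Finset.mem_filter.1 hpd).2
      have hmod : ((d % p : ℕ) : ℤ) ≡ d [ZMOD p] := by
        push_cast
        exact Int.mod_modEq _ _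
      have hFm : F (d % p) ≡ F d [ZMOD p] := by
        simp only [hF]
        gcongr
      exact (Int.ModEq.dvd_iff hFm).1 h1
    have hpi := Nat.prime_iff_prime_int.1 hpp
    simp only [Finset.mem_union]
    rcases hpi.dvd_mul.1 hdvd with h | h <;> rcases hpi.dvd_mul.1 h with h | h
    · obtain ⟨k, hk, e⟩ := f1.eq_pow_of_dvd hpp hp2 h
      exact Or.inl (Or.inl (Finset.mem_filter.2 ⟨Finset.mem_range.2 hdX, p, hpy, k, hk, e⟩))
    · obtain ⟨k, hk, e⟩ := f2.eq_pow_of_dvd hpp hp2 h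
      exact Or.inl (Or.inr (Finset.mem_filter.2 ⟨Finset.mem_range.2 hdX, p, hpy, k, hk, e⟩))
    · obtain ⟨k, hk, e⟩ := f3.eq_pow_of_dvd hpp hp2 h
      exact Or.inr (Or.inl (Finset.mem_filter.2 ⟨Finset.mem_range.2 hdX, p, hpy, k, hk, e⟩))
    · obtain ⟨k, hk, e⟩ := f4.eq_pow_of_dvd hpp hp2 h
      exact Or.inr (Or.inr (Finset.mem_filter.2 ⟨Finset.mem_range.2 hdX, p, hpy, k, hk, e⟩))
  have hExc : ∀ c' t, 1 ≤ c' → (Ex c' t).card ≤ 2 * ((y + 1) * (Nat.log 2 Y + 1)) := fun c' t h =>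
    card_abs_linear_eq_two_mul_pow_le h t X y _
  have hcard : S.card ≤ ((Finset.range X).filter fun d => ∀ p ∈ P, d % p ∉ Ω p).card +
      8 * ((y + 1) * (Nat.log 2 Y + 1)) := by
    refine (Finset.card_le_card hcover).trans ((Finset.card_union_le _ _).trans ?_)
    have h0 := Finset.card_union_le (Ex c (a * b) ∪ Ex c (-(a * b))) (Ex b (a * c) ∪ Ex b (-(a * c)))
    have h1 := Finset.card_union_le (Ex c (a * b)) (Ex c (-(a * b)))
    have h2 := Finset.card_union_le (Ex b (a * c)) (Ex b (-(a * c)))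
    have := hExc c (a * b) hc
    have := hExc c (-(a * b)) hc
    have := hExc b (a * c) hb
    have := hExc b (-(a * c)) hb
    omega
  have hcard' : (S.card : ℝ) ≤ (((Finset.range X).filter fun d => ∀ p ∈ P, d % p ∉ Ω p).card : ℝ) +
      8 * ((y + 1) * (Nat.log 2 Y + 1)) := by exact_mod_cast hcard
  have hX : (X : ℝ) / V ≤ X * G ^ 4 / Real.log (y + 1) ^ 4 := by
    rw [div_le_div_iff₀ hVpos (by positivity), mul_assoc]
    gcongr
  have hy24 : ((y ^ 4 : ℕ) : ℝ) ^ 6 = (y : ℝ) ^ 24 := by push_cast; ring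
  rw [hy24] at hsieve
  linarith
theorem exists_pow_le_and_lt (n Y : ℕ) (hn : n ≠ 0) (hY : 1 ≤ Y) : ∃ y, 1 ≤ y ∧ y ^ n ≤ Y ∧ Y < (y + 1) ^ n := by
  have h1 : (1 : ℕ) ^ n ≤ Y := by simpa using hY
  refine ⟨Nat.findGreatest (fun y => y ^ n ≤ Y) Y, Nat.le_findGreatest hY h1,
    Nat.findGreatest_spec (P := fun y => y ^ n ≤ Y) hY h1, ?_⟩
  by_contra! h
  have h2 := Nat.le_findGreatest (P := fun y => y ^ n ≤ Y) ((Nat.le_self_pow hn _).trans h) h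
  omega

theorem pow_mul_log_pow_le {y Y X : ℕ} (hY : 1 ≤ Y) (hy : y ^ 100 ≤ Y) (hX : Y ≤ X ^ 2) :
    (y : ℝ) ^ 24 * Real.log Y ^ 4 ≤ 20 ^ 4 * X := by
  have hY0 : (0 : ℝ) ≤ Y := Nat.cast_nonneg _
  have hY1 : (1 : ℝ) ≤ Y := by exact_mod_cast hY
  have hy' : (y : ℝ) ≤ (Y : ℝ) ^ (1 / 100 : ℝ) := by
    rw [one_div, Real.le_rpow_inv_iff_of_pos (Nat.cast_nonneg _) hY0 (by norm_num)]
    exact_mod_cast hy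
  have hX' : (Y : ℝ) ^ (1 / 2 : ℝ) ≤ X := by
    rw [← Real.sqrt_eq_rpow]
    exact Real.sqrt_le_iff.2 ⟨Nat.cast_nonneg _, by exact_mod_cast hX⟩
  have hl := Real.log_le_rpow_div hY0 (by norm_num : (0 : ℝ) < 1 / 20)
  have hl0 : 0 ≤ Real.log Y := Real.log_nonneg hY1
  calc (y : ℝ) ^ 24 * Real.log Y ^ 4 ≤
      ((Y : ℝ) ^ (1 / 100 : ℝ)) ^ 24 * ((Y : ℝ) ^ (1 / 20 : ℝ) / (1 / 20)) ^ 4 := by gcongr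
    _ = 20 ^ 4 * (Y : ℝ) ^ (11 / 25 : ℝ) := by
      rw [div_pow, ← Real.rpow_mul_natCast hY0, ← Real.rpow_mul_natCast hY0, mul_div_assoc',
        ← Real.rpow_add (by linarith)]
      norm_num
      ring
    _ ≤ 20 ^ 4 * (Y : ℝ) ^ (1 / 2 : ℝ) := by
      have := Real.rpow_le_rpow_of_exponent_le hY1 (by norm_num : (11 / 25 : ℝ) ≤ 1 / 2)
      gcongr
    _ ≤ 20 ^ 4 * X := by gcongr

theorem main_term_le {X C G l m : ℝ} (hX : 0 ≤ X) (hC : 0 ≤ C) (hl : 0 < l) (hG : G ≤ C * (10 * l))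
    (hm : l ≤ 100 * m) : X * G / m ^ 4 ≤ 10 ^ 9 * C * X / l ^ 3 := by
  have hm0 : 0 < m := by linarith
  rw [div_le_div_iff₀ (by positivity) (by positivity)]
  calc X * G * l ^ 3 ≤ X * (C * (10 * l)) * l ^ 3 := by gcongr
    _ = 10 * C * X * l ^ 4 := by ring
    _ ≤ 10 * C * X * (100 * m) ^ 4 := by gcongr
    _ = 10 ^ 9 * C * X * m ^ 4 := by ring

theorem exists_card_four_forms_le : ∃ C > (0 : ℝ), ∀ Y : ℕ, 2 ≤ Y → ∀ a b c : ℕ, 1 ≤ a → 1 ≤ b → 1 ≤ c →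
    b ≠ c → a ≤ Y → b ≤ Y → c ≤ Y → ∀ X : ℕ, Y ≤ X ^ 2 → ∀ S : Finset ℕ,
    (∀ d ∈ S, d < X ∧ IsTwicePrimePow Y (c * d + a * b) ∧
      IsTwicePrimePow Y (c * d - a * b) ∧ IsTwicePrimePow Y (b * d + a * c) ∧
      IsTwicePrimePow Y (b * d - a * c)) → (S.card : ℝ) ≤ C * X / Real.log Y ^ 3 := by
  obtain ⟨C, hC, hprod⟩ := exists_prod_primeFactors_le
  refine ⟨10 ^ 9 * C + 66 * 20 ^ 4, by positivity, ?_⟩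
  intro Y hY a b c ha hb hc hbc haY hbY hcY X hX S hS
  obtain ⟨y, hy1, hyY, hYy⟩ := exists_pow_le_and_lt 100 Y (by norm_num) (by omega)
  obtain ⟨E, hE⟩ : ∃ E, E = 6 * a * b * c * ((b : ℤ) ^ 4 - (c : ℤ) ^ 4).natAbs := ⟨_, rfl⟩
  have hly : Real.log Y ≤ 100 * Real.log (y + 1) := by
    have h1 : (Y : ℝ) ≤ ((y : ℝ) + 1) ^ 100 := by exact_mod_cast hYy.le
    have h2 := Real.log_le_log (by positivity) h1
    rwa [Real.log_pow] at h2
  clear hYy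
  have key := card_four_forms_le ha hb hc hbc Y X hy1 hE S hS
  have hY2 : (2 : ℝ) ≤ Y := by exact_mod_cast hY
  have hl : 1 / 2 ≤ Real.log Y := by
    have h1 := Real.log_le_log (by norm_num) hY2
    have h2 := Real.log_two_gt_d9
    linarith
  have hdiff1 : 1 ≤ ((b : ℤ) ^ 4 - (c : ℤ) ^ 4).natAbs := by
    rw [Nat.one_le_iff_ne_zero, Int.natAbs_ne_zero, sub_ne_zero]
    intro h
    exact hbc (Nat.pow_left_injective (n := 4) (by norm_num) (by exact_mod_cast h))
  have hdiff2 : ((b : ℤ) ^ 4 - (c : ℤ) ^ 4).natAbs ≤ Y ^ 4 := by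
    have h1 : ((b : ℤ) ^ 4) ≤ Y ^ 4 := by exact_mod_cast Nat.pow_le_pow_left hbY 4
    have h2 : ((c : ℤ) ^ 4) ≤ Y ^ 4 := by exact_mod_cast Nat.pow_le_pow_left hcY 4
    have h3 : (0 : ℤ) ≤ (b : ℤ) ^ 4 := by positivity
    have h4 : (0 : ℤ) ≤ (c : ℤ) ^ 4 := by positivity
    have h5 : ((Y ^ 4 : ℕ) : ℤ) = (Y : ℤ) ^ 4 := by push_cast; rfl
    omega
  have hE2 : 2 ≤ E := by
    calc 2 ≤ 6 * 1 * 1 * 1 * 1 := by norm_num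
      _ ≤ E := by rw [hE]; gcongr
  have hEY : E ≤ Y ^ 10 := by
    calc E ≤ 2 ^ 3 * Y * Y * Y * Y ^ 4 := by rw [hE]; gcongr; norm_num
      _ ≤ Y ^ 3 * Y * Y * Y * Y ^ 4 := by gcongr
      _ = Y ^ 10 := by ring
  have hlE : Real.log E ≤ 10 * Real.log Y := by
    have h1 : (E : ℝ) ≤ (Y : ℝ) ^ 10 := by exact_mod_cast hEY
    have h2 := Real.log_le_log (by exact_mod_cast (by omega : 0 < E)) h1
    rwa [Real.log_pow] at h2
  have hG : (∏ p ∈ E.primeFactors, (1 + 1 / ((p : ℝ) - 1))) ^ 4 ≤ C * (10 * Real.log Y) :=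
    (hprod E hE2).trans (by gcongr)
  have hX0 : (0 : ℝ) ≤ X := Nat.cast_nonneg _
  have hlpos : 0 < Real.log Y := by linarith
  have t1 : X * (∏ p ∈ E.primeFactors, (1 + 1 / ((p : ℝ) - 1))) ^ 4 / Real.log (y + 1) ^ 4 ≤
      10 ^ 9 * C * X / Real.log Y ^ 3 := by
    exact main_term_le hX0 hC.le hlpos hG hly
  have hlog2 : (Nat.log 2 Y : ℝ) ≤ 2 * Real.log Y := by
    have h1 : ((2 : ℝ)) ^ Nat.log 2 Y ≤ Y := by exact_mod_cast Nat.pow_log_le_self 2 (by omega)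
    have h2 := Real.log_le_log (by positivity) h1
    rw [Real.log_pow] at h2
    have h3 := Real.log_two_gt_d9
    have h4 : (Nat.log 2 Y : ℝ) * (1 / 2) ≤ Nat.log 2 Y * Real.log 2 := by gcongr; linarith
    linarith
  have hy1' : (1 : ℝ) ≤ y := by exact_mod_cast hy1
  have t2 : (y : ℝ) ^ 24 + 8 * ((y + 1) * (Nat.log 2 Y + 1)) ≤ 66 * 20 ^ 4 * X / Real.log Y ^ 3 := by
    rw [le_div_iff₀ (by positivity)]
    have hyp : (y : ℝ) ≤ (y : ℝ) ^ 24 := le_self_pow₀ hy1' (by norm_num)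
    have s1 : (y : ℝ) ^ 24 + 8 * ((y + 1) * (Nat.log 2 Y + 1)) ≤ 66 * ((y : ℝ) ^ 24 * Real.log Y) := by
      have : ((y : ℝ) + 1) * (Nat.log 2 Y + 1) ≤ (2 * (y : ℝ) ^ 24) * (4 * Real.log Y) := by
        gcongr <;> linarith
      have : (y : ℝ) ^ 24 * (1 / 2) ≤ (y : ℝ) ^ 24 * Real.log Y := by gcongr
      linarith
    have s2 := pow_mul_log_pow_le (by omega) hyY hX
    calc _ ≤ 66 * ((y : ℝ) ^ 24 * Real.log Y) * Real.log Y ^ 3 := by gcongr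
      _ = 66 * ((y : ℝ) ^ 24 * Real.log Y ^ 4) := by ring
      _ ≤ 66 * (20 ^ 4 * X) := by gcongr
      _ = _ := by ring
  calc (S.card : ℝ) ≤ _ := key
    _ ≤ 10 ^ 9 * C * X / Real.log Y ^ 3 + 66 * 20 ^ 4 * X / Real.log Y ^ 3 := by linarith
    _ = _ := by ring
/-- The products of `(a, b, c, d)` parametrising a nontrivial solution of
`n₁ ^ 2 + n₂ ^ 2 = n₃ ^ 2 + n₄ ^ 2` in prime powers up to `Y`. -/
def FormsGood (Y a b c d : ℕ) : Prop :=
  (1 ≤ a ∧ 1 ≤ b ∧ 1 ≤ c ∧ 1 ≤ d) ∧ (a ≠ d ∧ b ≠ c) ∧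
    IsTwicePrimePow Y (c * d + a * b) ∧ IsTwicePrimePow Y (c * d - a * b) ∧
    IsTwicePrimePow Y (b * d + a * c) ∧ IsTwicePrimePow Y (b * d - a * c)

theorem IsTwicePrimePow.congr {Y : ℕ} {z w : ℤ} (h : IsTwicePrimePow Y z) (hzw : w = z ∨ w = -z) :
    IsTwicePrimePow Y w := by
  obtain ⟨q, hq, hqp, hz⟩ := h
  refine ⟨q, hq, hqp, ?_⟩
  rcases hzw with rfl | rfl
  · exact hz
  · rwa [Int.natAbs_neg]

theorem FormsGood.swap_middle {Y a b c d : ℕ} (h : FormsGood Y a b c d) : FormsGood Y a c b d := by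
  obtain ⟨⟨ha, hb, hc, hd⟩, ⟨had, hbc⟩, h1, h2, h3, h4⟩ := h
  exact ⟨⟨ha, hc, hb, hd⟩, ⟨had, hbc.symm⟩, h3, h4, h1, h2⟩

theorem FormsGood.swap_outer {Y a b c d : ℕ} (h : FormsGood Y a b c d) : FormsGood Y d b c a := by
  obtain ⟨⟨ha, hb, hc, hd⟩, ⟨had, hbc⟩, h1, h2, h3, h4⟩ := h
  exact ⟨⟨hd, hb, hc, ha⟩, ⟨had.symm, hbc⟩, h3.congr (Or.inl (by ring)), h4.congr (Or.inr (by ring)),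
    h1.congr (Or.inl (by ring)), h2.congr (Or.inr (by ring))⟩

theorem FormsGood.swap_pairs {Y a b c d : ℕ} (h : FormsGood Y a b c d) : FormsGood Y c d a b := by
  obtain ⟨⟨ha, hb, hc, hd⟩, ⟨had, hbc⟩, h1, h2, h3, h4⟩ := h
  exact ⟨⟨hc, hd, ha, hb⟩, ⟨hbc.symm, had.symm⟩, h1.congr (Or.inl (by ring)),
    h2.congr (Or.inr (by ring)), h3.congr (Or.inl (by ring)), h4.congr (Or.inl (by ring))⟩

theorem FormsGood.bounds {Y a b c d : ℕ} (h : FormsGood Y a b c d) : (a + d) * (b + c) ≤ 4 * Y := by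
  obtain ⟨-, -, ⟨q, hq, -, e⟩, -, ⟨r, hr, -, f⟩, -⟩ := h
  have h1 : c * d + a * b = 2 * q := by rw [← e]; exact_mod_cast rfl
  have h2 : b * d + a * c = 2 * r := by rw [← f]; exact_mod_cast rfl
  nlinarith

theorem sum_inv_sq_shift_le {b : ℕ} (hb : 1 ≤ b) (n : ℕ) :
    ∑ c ∈ Finset.Icc 1 n, (1 : ℝ) / ((b : ℝ) + c) ^ 2 ≤ 1 / b - 1 / (b + n) := by
  have hb' : (1 : ℝ) ≤ b := by exact_mod_cast hb
  induction n with
  | zero => simp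
  | succ n ih =>
    rw [Finset.sum_Icc_succ_top (by omega)]
    have hn : (0 : ℝ) ≤ n := Nat.cast_nonneg n
    have key : (1 : ℝ) / ((b : ℝ) + (n + 1 : ℕ)) ^ 2 ≤ 1 / (b + n) - 1 / (b + (n + 1 : ℕ)) := by
      push_cast
      rw [div_sub_div _ _ (by positivity) (by positivity), div_le_div_iff₀ (by positivity) (by positivity)]
      nlinarith
    linarith

theorem sum_sum_inv_sq_le {Y : ℕ} (hY : 2 ≤ Y) :
    ∑ x ∈ Finset.Icc 1 Y ×ˢ Finset.Icc 1 Y, (1 : ℝ) / ((x.1 : ℝ) + x.2) ^ 2 ≤ 3 * Real.log Y := by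
  have hY2 : (2 : ℝ) ≤ Y := by exact_mod_cast hY
  have hl : 1 / 2 ≤ Real.log Y := by
    have h1 := Real.log_le_log (by norm_num) hY2
    have h2 := Real.log_two_gt_d9
    linarith
  rw [Finset.sum_product]
  calc ∑ b ∈ Finset.Icc 1 Y, ∑ c ∈ Finset.Icc 1 Y, (1 : ℝ) / ((b : ℝ) + c) ^ 2
      ≤ ∑ b ∈ Finset.Icc 1 Y, ((b : ℕ) : ℝ)⁻¹ := by
        refine Finset.sum_le_sum fun b hb => ?_
        have h1 := sum_inv_sq_shift_le (Finset.mem_Icc.1 hb).1 Y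
        have h2 : (0 : ℝ) ≤ 1 / ((b : ℝ) + Y) := by positivity
        rw [← one_div]
        linarith
    _ = (harmonic Y : ℝ) := by rw [harmonic_eq_sum_Icc]; push_cast; rfl
    _ ≤ 1 + Real.log Y := harmonic_le_one_add_log Y
    _ ≤ 3 * Real.log Y := by linarith

theorem exists_card_formsGood_max_le : ∃ C > (0 : ℝ), ∀ Y : ℕ, 2 ≤ Y → ∀ T : Finset (ℕ × ℕ × ℕ × ℕ),
    (∀ q ∈ T, FormsGood Y q.1 q.2.1 q.2.2.1 q.2.2.2 ∧ q.1 ≤ q.2.2.2 ∧ q.2.1 ≤ q.2.2.2 ∧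
      q.2.2.1 ≤ q.2.2.2) → (T.card : ℝ) ≤ C * Y ^ 2 / Real.log Y ^ 2 := by
  obtain ⟨C, hC, hfour⟩ := exists_card_four_forms_le
  refine ⟨192 * C, by positivity, fun Y hY T hT => ?_⟩
  have hY2 : (2 : ℝ) ≤ Y := by exact_mod_cast hY
  have hl : 0 < Real.log Y := Real.log_pos (by linarith)
  have hb : ∀ a b c d : ℕ, (a, b, c, d) ∈ T → (1 ≤ a ∧ 1 ≤ b ∧ 1 ≤ c ∧ 1 ≤ d) ∧ b ≠ c ∧ a ≤ Y ∧ b ≤ Y ∧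
      c ≤ Y ∧ a < 4 * Y / (b + c) + 1 ∧ d < 4 * Y / (b + c) + 1 ∧ Y ≤ (4 * Y / (b + c) + 1) ^ 2 := by
    intro a b c d h
    obtain ⟨hg, had, hbd, hcd⟩ := hT _ h
    simp only at hg had hbd hcd
    have hbound := hg.bounds
    obtain ⟨⟨ha, hb, hc, hd⟩, ⟨-, hbc⟩, -⟩ := hg
    have hbc3 : 3 ≤ b + c := by omega
    have hdX : d ≤ 4 * Y / (b + c) := by
      rw [Nat.le_div_iff_mul_le (by omega)]
      exact (Nat.mul_le_mul_right _ (by omega)).trans hbound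
    have hsq : (b + c) * (b + c) ≤ 8 * Y := by
      have : (b + c) * (b + c) ≤ (2 * (a + d)) * (b + c) := Nat.mul_le_mul_right _ (by omega)
      linarith
    have hXb : 4 * Y < (b + c) * (4 * Y / (b + c) + 1) := Nat.lt_mul_div_succ _ (by omega)
    refine ⟨⟨ha, hb, hc, hd⟩, hbc, ?_, ?_, ?_, by omega, by omega, ?_⟩
    · nlinarith
    · nlinarith
    · nlinarith
    · set X := 4 * Y / (b + c) + 1
      by_contra! hlt
      have h1 : (4 * Y) * (4 * Y) ≤ ((b + c) * X) * ((b + c) * X) := Nat.mul_le_mul hXb.le hXb.le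
      have h2 : ((b + c) * X) * ((b + c) * X) ≤ 8 * Y * Y := by
        calc ((b + c) * X) * ((b + c) * X) = ((b + c) * (b + c)) * X ^ 2 := by ring
          _ ≤ 8 * Y * Y := Nat.mul_le_mul hsq hlt.le
      nlinarith
  set I : Finset (Σ _ : ℕ × ℕ, ℕ) := (Finset.Icc 1 Y ×ˢ Finset.Icc 1 Y).sigma fun x =>
    Finset.range (4 * Y / (x.1 + x.2) + 1) with hI
  have hmaps : ∀ q ∈ T, (⟨(q.2.1, q.2.2.1), q.1⟩ : Σ _ : ℕ × ℕ, ℕ) ∈ I := by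
    rintro ⟨a, b, c, d⟩ hq
    obtain ⟨⟨h1, h2, h3, h4⟩, -, h5, h6, h7, h8, -⟩ := hb a b c d hq
    rw [hI, Finset.mem_sigma, Finset.mem_product, Finset.mem_Icc, Finset.mem_Icc, Finset.mem_range]
    exact ⟨⟨⟨h2, h6⟩, h3, h7⟩, h8⟩
  have hfib : ∀ b c a : ℕ, ((T.filter fun q =>
      (⟨(q.2.1, q.2.2.1), q.1⟩ : Σ _ : ℕ × ℕ, ℕ) = ⟨(b, c), a⟩).card : ℝ) ≤
      C * (4 * Y / (b + c) + 1 : ℕ) / Real.log Y ^ 3 := by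
    intro b c a
    set S := T.filter fun q => (⟨(q.2.1, q.2.2.1), q.1⟩ : Σ _ : ℕ × ℕ, ℕ) = ⟨(b, c), a⟩ with hS
    have hSm : ∀ q ∈ S, q ∈ T ∧ q.1 = a ∧ q.2.1 = b ∧ q.2.2.1 = c := by
      intro q hq
      obtain ⟨h1, h2⟩ := Finset.mem_filter.1 hq
      rw [Sigma.mk.injEq, Prod.mk.injEq, heq_eq_eq] at h2
      exact ⟨h1, h2.2, h2.1.1, h2.1.2⟩
    have hcardS : S.card = (S.image fun q => q.2.2.2).card := by
      refine (Finset.card_image_of_injOn ?_).symm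
      rintro ⟨a1, b1, c1, d1⟩ h1 ⟨a2, b2, c2, d2⟩ h2 h
      have g1 := hSm _ h1
      have g2 := hSm _ h2
      simp only at g1 g2 h
      obtain ⟨-, rfl, rfl, rfl⟩ := g1
      obtain ⟨-, rfl, rfl, rfl⟩ := g2
      rw [h]
    rcases S.eq_empty_or_nonempty with h0 | ⟨⟨a', b', c', d'⟩, h0⟩
    · rw [h0, Finset.card_empty, Nat.cast_zero]
      positivity
    · obtain ⟨h1, rfl, rfl, rfl⟩ := hSm _ h0
      obtain ⟨⟨g1, g2, g3, g4⟩, g5, g6, g7, g8, -, -, g11⟩ := hb _ _ _ _ h1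
      rw [hcardS]
      refine hfour Y hY _ _ _ g1 g2 g3 g5 g6 g7 g8 _ g11 _ fun d hd => ?_
      obtain ⟨⟨a2, b2, c2, d2⟩, hq, rfl⟩ := Finset.mem_image.1 hd
      obtain ⟨h2, e1, e2, e3⟩ := hSm _ hq
      simp only at e1 e2 e3 ⊢
      subst e1 e2 e3
      exact ⟨(hb _ _ _ _ h2).2.2.2.2.2.2.1, (hT _ h2).1.2.2⟩
  have hX : ∀ x ∈ Finset.Icc 1 Y ×ˢ Finset.Icc 1 Y,
      ((4 * Y / (x.1 + x.2) + 1 : ℕ) : ℝ) ≤ 8 * Y / ((x.1 : ℝ) + x.2) := by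
    rintro ⟨b, c⟩ hx
    simp only [Finset.mem_product, Finset.mem_Icc] at hx
    have hb1 : (1 : ℝ) ≤ b := by exact_mod_cast hx.1.1
    have hc1 : (1 : ℝ) ≤ c := by exact_mod_cast hx.2.1
    have hbY : (b : ℝ) ≤ Y := by exact_mod_cast hx.1.2
    have hcY : (c : ℝ) ≤ Y := by exact_mod_cast hx.2.2
    have h1 : ((4 * Y / (b + c) : ℕ) : ℝ) ≤ ((4 * Y : ℕ) : ℝ) / ((b + c : ℕ) : ℝ) := Nat.cast_div_le
    have h2 : (1 : ℝ) ≤ 4 * Y / ((b : ℝ) + c) := by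
      rw [le_div_iff₀ (by positivity)]
      linarith
    push_cast at h1 ⊢
    have h3 : 8 * (Y : ℝ) / ((b : ℝ) + c) = 4 * Y / ((b : ℝ) + c) + 4 * Y / ((b : ℝ) + c) := by ring
    rw [h3]
    linarith
  calc (T.card : ℝ) = ∑ x ∈ I, ((T.filter fun q =>
        (⟨(q.2.1, q.2.2.1), q.1⟩ : Σ _ : ℕ × ℕ, ℕ) = x).card : ℝ) := by
        rw [Finset.card_eq_sum_card_fiberwise hmaps, Nat.cast_sum]
    _ ≤ ∑ x ∈ I, C * (4 * Y / (x.1.1 + x.1.2) + 1 : ℕ) / Real.log Y ^ 3 :=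
        Finset.sum_le_sum fun x _ => hfib x.1.1 x.1.2 x.2
    _ = ∑ x ∈ Finset.Icc 1 Y ×ˢ Finset.Icc 1 Y, C * ((4 * Y / (x.1 + x.2) + 1 : ℕ) : ℝ) ^ 2 /
        Real.log Y ^ 3 := by
        rw [hI, Finset.sum_sigma]
        refine Finset.sum_congr rfl fun x _ => ?_
        simp only [Finset.sum_const, Finset.card_range, nsmul_eq_mul]
        ring
    _ ≤ ∑ x ∈ Finset.Icc 1 Y ×ˢ Finset.Icc 1 Y, (64 * C * Y ^ 2 / Real.log Y ^ 3) *
        (1 / ((x.1 : ℝ) + x.2) ^ 2) := by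
        refine Finset.sum_le_sum fun x hx => ?_
        calc C * ((4 * Y / (x.1 + x.2) + 1 : ℕ) : ℝ) ^ 2 / Real.log Y ^ 3 ≤
            C * (8 * Y / ((x.1 : ℝ) + x.2)) ^ 2 / Real.log Y ^ 3 := by
              gcongr
              exact hX x hx
          _ = _ := by rw [div_pow]; ring
    _ = (64 * C * Y ^ 2 / Real.log Y ^ 3) *
        ∑ x ∈ Finset.Icc 1 Y ×ˢ Finset.Icc 1 Y, (1 / ((x.1 : ℝ) + x.2) ^ 2) := by rw [Finset.mul_sum]
    _ ≤ (64 * C * Y ^ 2 / Real.log Y ^ 3) * (3 * Real.log Y) := by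
        gcongr
        exact sum_sum_inv_sq_le hY
    _ = 192 * C * Y ^ 2 / Real.log Y ^ 2 := by
        field_simp
        norm_num

theorem exists_card_formsGood_le : ∃ C > (0 : ℝ), ∀ Y : ℕ, 2 ≤ Y → ∀ T : Finset (ℕ × ℕ × ℕ × ℕ),
    (∀ q ∈ T, FormsGood Y q.1 q.2.1 q.2.2.1 q.2.2.2) → (T.card : ℝ) ≤ C * Y ^ 2 / Real.log Y ^ 2 := by
  obtain ⟨C, hC, hmax⟩ := exists_card_formsGood_max_le
  refine ⟨4 * C, by positivity, fun Y hY T hT => ?_⟩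
  set T₁ := T.filter fun q => q.1 ≤ q.2.2.2 ∧ q.2.1 ≤ q.2.2.2 ∧ q.2.2.1 ≤ q.2.2.2 with hT₁
  set T₂ := T.filter fun q => q.2.1 ≤ q.1 ∧ q.2.2.1 ≤ q.1 ∧ q.2.2.2 ≤ q.1 with hT₂
  set T₃ := T.filter fun q => q.1 ≤ q.2.1 ∧ q.2.2.1 ≤ q.2.1 ∧ q.2.2.2 ≤ q.2.1 with hT₃
  set T₄ := T.filter fun q => q.1 ≤ q.2.2.1 ∧ q.2.1 ≤ q.2.2.1 ∧ q.2.2.2 ≤ q.2.2.1 with hT₄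
  have hcover : T ⊆ (T₁ ∪ T₂) ∪ (T₃ ∪ T₄) := by
    rintro ⟨a, b, c, d⟩ hq
    simp only [Finset.mem_union, hT₁, hT₂, hT₃, hT₄, Finset.mem_filter, hq, true_and]
    omega
  have hcard : T.card ≤ (T₁.card + T₂.card) + (T₃.card + T₄.card) :=
    (Finset.card_le_card hcover).trans ((Finset.card_union_le _ _).trans
      (add_le_add (Finset.card_union_le _ _) (Finset.card_union_le _ _)))
  have h1 := hmax Y hY T₁ fun q hq => by
    obtain ⟨g, h⟩ := Finset.mem_filter.1 hq
    exact ⟨hT q g, h⟩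
  have h2 : (T₂.card : ℝ) ≤ C * Y ^ 2 / Real.log Y ^ 2 := by
    have hinj : Function.Injective fun q : ℕ × ℕ × ℕ × ℕ => (q.2.2.2, q.2.1, q.2.2.1, q.1) := by
      rintro ⟨a, b, c, d⟩ ⟨a', b', c', d'⟩ h
      simp only [Prod.mk.injEq] at h ⊢
      tauto
    rw [← Finset.card_image_of_injective T₂ hinj]
    refine hmax Y hY _ fun q hq => ?_
    obtain ⟨⟨a, b, c, d⟩, hp, rfl⟩ := Finset.mem_image.1 hq
    obtain ⟨g, h⟩ := Finset.mem_filter.1 hp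
    exact ⟨(hT _ g).swap_outer, h.2.2, h.1, h.2.1⟩
  have h3 : (T₃.card : ℝ) ≤ C * Y ^ 2 / Real.log Y ^ 2 := by
    have hinj : Function.Injective fun q : ℕ × ℕ × ℕ × ℕ => (q.2.2.1, q.2.2.2, q.1, q.2.1) := by
      rintro ⟨a, b, c, d⟩ ⟨a', b', c', d'⟩ h
      simp only [Prod.mk.injEq] at h ⊢
      tauto
    rw [← Finset.card_image_of_injective T₃ hinj]
    refine hmax Y hY _ fun q hq => ?_
    obtain ⟨⟨a, b, c, d⟩, hp, rfl⟩ := Finset.mem_image.1 hq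
    obtain ⟨g, h⟩ := Finset.mem_filter.1 hp
    exact ⟨(hT _ g).swap_pairs, h.2.1, h.2.2, h.1⟩
  have h4 : (T₄.card : ℝ) ≤ C * Y ^ 2 / Real.log Y ^ 2 := by
    have hinj : Function.Injective fun q : ℕ × ℕ × ℕ × ℕ => (q.2.1, q.2.2.2, q.1, q.2.2.1) := by
      rintro ⟨a, b, c, d⟩ ⟨a', b', c', d'⟩ h
      simp only [Prod.mk.injEq] at h ⊢
      tauto
    rw [← Finset.card_image_of_injective T₄ hinj]
    refine hmax Y hY _ fun q hq => ?_
    obtain ⟨⟨a, b, c, d⟩, hp, rfl⟩ := Finset.mem_image.1 hq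
    obtain ⟨g, h⟩ := Finset.mem_filter.1 hp
    exact ⟨(hT _ g).swap_middle.swap_pairs, h.2.1, h.2.2, h.1⟩
  have hcard' : (T.card : ℝ) ≤ (T₁.card + T₂.card) + (T₃.card + T₄.card) := by exact_mod_cast hcard
  calc (T.card : ℝ) ≤ 4 * (C * Y ^ 2 / Real.log Y ^ 2) := by linarith
    _ = _ := by ring
theorem exists_card_ordered_solutions_le : ∃ C > (0 : ℝ), ∀ Y : ℕ, 2 ≤ Y →
    ∀ T : Finset (ℕ × ℕ × ℕ × ℕ),
    (∀ q ∈ T, (IsPrimePow q.1 ∧ IsPrimePow q.2.1 ∧ IsPrimePow q.2.2.1 ∧ IsPrimePow q.2.2.2) ∧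
      (q.1 ≤ Y ∧ q.2.1 ≤ Y ∧ q.2.2.1 ≤ Y ∧ q.2.2.2 ≤ Y) ∧
      q.1 ^ 2 + q.2.1 ^ 2 = q.2.2.1 ^ 2 + q.2.2.2 ^ 2 ∧ q.2.2.1 < q.1 ∧ q.1 ≠ q.2.2.2) →
    (T.card : ℝ) ≤ C * Y ^ 2 / Real.log Y ^ 2 := by
  obtain ⟨C, hC, hgood⟩ := exists_card_formsGood_le
  refine ⟨C, hC, fun Y hY T hT => ?_⟩
  classical
  set g : ℕ × ℕ × ℕ × ℕ → ℕ × ℕ × ℕ × ℕ := fun q =>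
    ((q.1 * q.2.1 + q.2.2.1 * q.2.2.2) / 2, (q.2.1 * q.2.2.2 - q.1 * q.2.2.1) / 2,
      (q.2.2.1 * q.2.2.2 - q.1 * q.2.1) / 2, (q.1 * q.2.2.1 + q.2.1 * q.2.2.2) / 2) with hg
  have hex : ∀ q ∈ T, ∃ r : ℕ × ℕ × ℕ × ℕ, FormsGood Y r.1 r.2.1 r.2.2.1 r.2.2.2 ∧ g r = q := by
    rintro ⟨n₁, n₂, n₃, n₄⟩ hq
    obtain ⟨⟨p₁, p₂, p₃, p₄⟩, ⟨y₁, y₂, y₃, y₄⟩, he, h31, h14⟩ := hT _ hq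
    simp only at p₁ p₂ p₃ p₄ y₁ y₂ y₃ y₄ he h31 h14
    have h24 : n₂ < n₄ := by
      by_contra! h
      have : n₃ ^ 2 < n₁ ^ 2 := Nat.pow_lt_pow_left h31 two_ne_zero
      have : n₄ ^ 2 ≤ n₂ ^ 2 := Nat.pow_le_pow_left h 2
      omega
    have q₂ := p₂.pos
    have q₃ := p₃.pos
    obtain ⟨u, rfl⟩ := Nat.exists_eq_add_of_lt h31
    obtain ⟨w, rfl⟩ := Nat.exists_eq_add_of_lt h24
    have hprod : (u + 1) * (2 * n₃ + u + 1) = (w + 1) * (2 * n₂ + w + 1) := by nlinarith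
    obtain ⟨a, b, hab, ⟨c, hc⟩, ⟨d, hd⟩⟩ : ∃ a b, u + 1 = a * b ∧ a ∣ w + 1 ∧ b ∣ 2 * n₂ + w + 1 := by
      obtain ⟨a, b, h1, h2, h3⟩ := exists_dvd_and_dvd_of_dvd_mul (Dvd.intro _ hprod)
      exact ⟨a, b, h3, h1, h2⟩
    have ha : 1 ≤ a := Nat.one_le_iff_ne_zero.2 fun h => by simp [h] at hab
    have hb : 1 ≤ b := Nat.one_le_iff_ne_zero.2 fun h => by simp [h] at hab
    have hcd : 2 * n₃ + u + 1 = c * d := by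
      have h1 : (a * b) * (2 * n₃ + u + 1) = (a * b) * (c * d) := by
        rw [← hab, hprod, hc, hd, hab]; ring
      exact Nat.eq_of_mul_eq_mul_left (by positivity) h1
    have hc1 : 1 ≤ c := Nat.one_le_iff_ne_zero.2 fun h => by simp [h] at hc
    have hd1 : 1 ≤ d := Nat.one_le_iff_ne_zero.2 fun h => by simp [h] at hd
    have e₁ : c * d + a * b = 2 * (n₃ + u + 1) := by omega
    have e₃ : c * d = a * b + 2 * n₃ := by omega
    have e₄ : b * d + a * c = 2 * (n₂ + w + 1) := by omega
    have e₂ : b * d = a * c + 2 * n₂ := by omega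
    refine ⟨(a, b, c, d), ⟨⟨ha, hb, hc1, hd1⟩, ⟨?_, ?_⟩, ?_, ?_, ?_, ?_⟩, ?_⟩
    · intro h
      simp only at h
      subst h
      have h1 : b < c := by by_contra! h; nlinarith
      have h2 : c < b := by by_contra! h; nlinarith
      omega
    · intro h
      simp only at h
      subst h
      apply h14
      omega
    · exact ⟨_, y₁, p₁, by rw [← e₁]; exact_mod_cast rfl⟩
    · refine ⟨_, y₃, p₃, ?_⟩
      have : ((c * d : ℕ) : ℤ) = ((a * b + 2 * n₃ : ℕ) : ℤ) := by rw [e₃]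
      push_cast at this
      simp only
      omega
    · exact ⟨_, y₄, p₄, by rw [← e₄]; exact_mod_cast rfl⟩
    · refine ⟨_, y₂, p₂, ?_⟩
      have : ((b * d : ℕ) : ℤ) = ((a * c + 2 * n₂ : ℕ) : ℤ) := by rw [e₂]
      push_cast at this
      simp only
      omega
    · simp only [hg, Prod.mk.injEq]
      omega
  choose! r hr using hex
  have hinj : Set.InjOn r T := fun q hq q' hq' h => by
    rw [← (hr q hq).2, ← (hr q' hq').2, h]
  rw [← Finset.card_image_of_injOn hinj]
  refine hgood Y hY _ fun x hx => ?_
  obtain ⟨q, hq, rfl⟩ := Finset.mem_image.1 hx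
  exact (hr q hq).1

theorem exists_card_nondiagonal_le : ∃ C > (0 : ℝ), ∀ Y : ℕ, 2 ≤ Y →
    ∀ T : Finset (ℕ × ℕ × ℕ × ℕ),
    (∀ q ∈ T, (IsPrimePow q.1 ∧ IsPrimePow q.2.1 ∧ IsPrimePow q.2.2.1 ∧ IsPrimePow q.2.2.2) ∧
      (q.1 ≤ Y ∧ q.2.1 ≤ Y ∧ q.2.2.1 ≤ Y ∧ q.2.2.2 ≤ Y) ∧
      q.1 ^ 2 + q.2.1 ^ 2 = q.2.2.1 ^ 2 + q.2.2.2 ^ 2 ∧ q.1 ≠ q.2.2.1 ∧ q.1 ≠ q.2.2.2) →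
    (T.card : ℝ) ≤ C * Y ^ 2 / Real.log Y ^ 2 := by
  obtain ⟨C, hC, hord⟩ := exists_card_ordered_solutions_le
  refine ⟨2 * C, by positivity, fun Y hY T hT => ?_⟩
  set T₁ := T.filter fun q => q.2.2.1 < q.1 with hT₁
  set T₂ := T.filter fun q => ¬ q.2.2.1 < q.1 with hT₂
  have hcard : (T.card : ℝ) = T₁.card + T₂.card := by
    rw [hT₁, hT₂]
    exact_mod_cast (Finset.card_filter_add_card_filter_not _).symm
  have h1 := hord Y hY T₁ fun q hq => by
    obtain ⟨g, h⟩ := Finset.mem_filter.1 hq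
    obtain ⟨k1, k2, k3, k4, k5⟩ := hT q g
    exact ⟨k1, k2, k3, h, k5⟩
  have h2 : (T₂.card : ℝ) ≤ C * Y ^ 2 / Real.log Y ^ 2 := by
    have hinj : Function.Injective fun q : ℕ × ℕ × ℕ × ℕ => (q.2.2.1, q.2.2.2, q.1, q.2.1) := by
      rintro ⟨a, b, c, d⟩ ⟨a', b', c', d'⟩ h
      simp only [Prod.mk.injEq] at h ⊢
      tauto
    rw [← Finset.card_image_of_injective T₂ hinj]
    refine hord Y hY _ fun q hq => ?_
    obtain ⟨⟨a, b, c, d⟩, hp, rfl⟩ := Finset.mem_image.1 hq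
    obtain ⟨g, h⟩ := Finset.mem_filter.1 hp
    obtain ⟨⟨p₁, p₂, p₃, p₄⟩, ⟨y₁, y₂, y₃, y₄⟩, he, h13, h14⟩ := hT _ g
    simp only at p₁ p₂ p₃ p₄ y₁ y₂ y₃ y₄ he h13 h14 h ⊢
    refine ⟨⟨p₃, p₄, p₁, p₂⟩, ⟨y₃, y₄, y₁, y₂⟩, he.symm, by omega, ?_⟩
    rintro rfl
    have : a ^ 2 = d ^ 2 := by omega
    exact h14 (Nat.pow_left_injective two_ne_zero this)
  rw [hcard]
  calc (T₁.card : ℝ) + T₂.card ≤ C * Y ^ 2 / Real.log Y ^ 2 + C * Y ^ 2 / Real.log Y ^ 2 := add_le_add h1 h2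
    _ = _ := by ring

theorem exists_sum_vonMangoldt_sq_le : ∃ C > (0 : ℝ), ∀ Y : ℕ, 2 ≤ Y →
    ∑ n ∈ Finset.range (Y + 1), ArithmeticFunction.vonMangoldt n ^ 2 ≤ C * Y * Real.log Y := by
  refine ⟨Real.log 4 + 4, by positivity, fun Y hY => ?_⟩
  have hpsi := Chebyshev.psi_le_const_mul_self (x := (Y : ℝ)) (Nat.cast_nonneg _)
  have hl : 0 ≤ Real.log Y := Real.log_natCast_nonneg Y
  calc ∑ n ∈ Finset.range (Y + 1), ArithmeticFunction.vonMangoldt n ^ 2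
      ≤ ∑ n ∈ Finset.range (Y + 1), ArithmeticFunction.vonMangoldt n * Real.log Y := by
        refine Finset.sum_le_sum fun n hn => ?_
        rw [sq]
        refine mul_le_mul_of_nonneg_left ?_ ArithmeticFunction.vonMangoldt_nonneg
        rcases n.eq_zero_or_pos with rfl | h
        · simpa using hl
        · refine ArithmeticFunction.vonMangoldt_le_log.trans ?_
          have : n ≤ Y := by have := Finset.mem_range.1 hn; omega
          gcongr
    _ = Chebyshev.psi Y * Real.log Y := by
        rw [← Finset.sum_mul, Chebyshev.psi_eq_sum_Icc, Nat.floor_natCast, Finset.range_eq_Ico]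
        rfl
    _ ≤ (Real.log 4 + 4) * Y * Real.log Y := by gcongr

theorem exists_sum_solutions_le : ∃ C > (0 : ℝ), ∀ Y : ℕ, 2 ≤ Y → ∀ T : Finset (ℕ × ℕ × ℕ × ℕ),
    (∀ q ∈ T, (q.1 ≤ Y ∧ q.2.1 ≤ Y ∧ q.2.2.1 ≤ Y ∧ q.2.2.2 ≤ Y) ∧
      q.1 ^ 2 + q.2.1 ^ 2 = q.2.2.1 ^ 2 + q.2.2.2 ^ 2) →
    ∑ q ∈ T, ArithmeticFunction.vonMangoldt q.1 * ArithmeticFunction.vonMangoldt q.2.1 *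
      (ArithmeticFunction.vonMangoldt q.2.2.1 * ArithmeticFunction.vonMangoldt q.2.2.2) ≤
      C * Y ^ 2 * Real.log Y ^ 2 := by
  obtain ⟨C₁, hC₁, hnd⟩ := exists_card_nondiagonal_le
  obtain ⟨C₂, hC₂, hsq⟩ := exists_sum_vonMangoldt_sq_le
  refine ⟨C₁ + 2 * C₂ ^ 2, by positivity, fun Y hY T hT => ?_⟩
  have hY2 : (2 : ℝ) ≤ Y := by exact_mod_cast hY
  have hl : 0 < Real.log Y := Real.log_pos (by linarith)
  set Λ := ArithmeticFunction.vonMangoldt with hΛ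
  have hΛ0 : ∀ n, 0 ≤ Λ n := fun n => ArithmeticFunction.vonMangoldt_nonneg
  set w : ℕ × ℕ × ℕ × ℕ → ℝ := fun q => Λ q.1 * Λ q.2.1 * (Λ q.2.2.1 * Λ q.2.2.2) with hw
  have hw0 : ∀ q, 0 ≤ w q := fun q => mul_nonneg (mul_nonneg (hΛ0 _) (hΛ0 _)) (mul_nonneg (hΛ0 _) (hΛ0 _))
  set B := Finset.range (Y + 1) ×ˢ Finset.range (Y + 1) with hB
  have hdiag : ∑ x ∈ B, Λ x.1 ^ 2 * Λ x.2 ^ 2 ≤ C₂ ^ 2 * Y ^ 2 * Real.log Y ^ 2 := by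
    rw [hB, Finset.sum_product]
    simp only
    rw [← Finset.sum_mul_sum]
    have h1 : 0 ≤ ∑ n ∈ Finset.range (Y + 1), Λ n ^ 2 := Finset.sum_nonneg fun n _ => sq_nonneg _
    calc (∑ n ∈ Finset.range (Y + 1), Λ n ^ 2) * ∑ n ∈ Finset.range (Y + 1), Λ n ^ 2
        ≤ (C₂ * Y * Real.log Y) * (C₂ * Y * Real.log Y) := by
          have := hsq Y hY
          gcongr
      _ = _ := by ring
  set D₁ := B.image fun x => (x.1, x.2, x.1, x.2) with hD₁
  set D₂ := B.image fun x => (x.1, x.2, x.2, x.1) with hD₂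
  classical
  set U := T.filter fun q => (IsPrimePow q.1 ∧ IsPrimePow q.2.1 ∧ IsPrimePow q.2.2.1 ∧
    IsPrimePow q.2.2.2) ∧ q.1 ≠ q.2.2.1 ∧ q.1 ≠ q.2.2.2 with hU
  have hΛY : ∀ n ≤ Y, Λ n ≤ Real.log Y := by
    intro n hn
    rcases n.eq_zero_or_pos with rfl | h
    · simpa using hl.le
    · exact ArithmeticFunction.vonMangoldt_le_log.trans (by gcongr)
  have hU1 : ∑ q ∈ U, w q ≤ C₁ * Y ^ 2 * Real.log Y ^ 2 := by
    calc ∑ q ∈ U, w q ≤ ∑ q ∈ U, Real.log Y ^ 4 := by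
          refine Finset.sum_le_sum fun q hq => ?_
          obtain ⟨⟨y₁, y₂, y₃, y₄⟩, -⟩ := hT q (Finset.mem_filter.1 hq).1
          have := hΛY _ y₁
          have := hΛY _ y₂
          have := hΛY _ y₃
          have := hΛY _ y₄
          have i₁ := hΛ0 q.1
          have i₂ := hΛ0 q.2.1
          have i₃ := hΛ0 q.2.2.1
          have i₄ := hΛ0 q.2.2.2
          calc w q ≤ Real.log Y * Real.log Y * (Real.log Y * Real.log Y) := by
                simp only [hw]; gcongr
            _ = _ := by ring
      _ = U.card * Real.log Y ^ 4 := by rw [Finset.sum_const, nsmul_eq_mul]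
      _ ≤ (C₁ * Y ^ 2 / Real.log Y ^ 2) * Real.log Y ^ 4 := by
          refine mul_le_mul_of_nonneg_right (hnd Y hY U fun q hq => ?_) (by positivity)
          obtain ⟨g, h1, h2⟩ := Finset.mem_filter.1 hq
          exact ⟨h1, (hT q g).1, (hT q g).2, h2⟩
      _ = _ := by field_simp
  have hD1s : ∑ q ∈ D₁, w q ≤ C₂ ^ 2 * Y ^ 2 * Real.log Y ^ 2 := by
    rw [hD₁, Finset.sum_image fun x _ y _ h => by
      simp only [Prod.mk.injEq] at h; exact Prod.ext h.1 h.2.1]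
    refine le_trans (le_of_eq (Finset.sum_congr rfl fun x _ => ?_)) hdiag
    simp only [hw]
    ring
  have hD2s : ∑ q ∈ D₂, w q ≤ C₂ ^ 2 * Y ^ 2 * Real.log Y ^ 2 := by
    rw [hD₂, Finset.sum_image fun x _ y _ h => by
      simp only [Prod.mk.injEq] at h; exact Prod.ext h.1 h.2.1]
    refine le_trans (le_of_eq (Finset.sum_congr rfl fun x _ => ?_)) hdiag
    simp only [hw]
    ring
  have hcover : ∀ q ∈ T, w q ≠ 0 → q ∈ U ∪ (D₁ ∪ D₂) := by
    rintro ⟨n₁, n₂, n₃, n₄⟩ hq hne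
    obtain ⟨⟨y₁, y₂, y₃, y₄⟩, he⟩ := hT _ hq
    simp only at y₁ y₂ y₃ y₄ he
    simp only [hw, mul_ne_zero_iff, hΛ, ArithmeticFunction.vonMangoldt_ne_zero_iff] at hne
    have hBm : (n₁, n₂) ∈ B := by
      rw [hB, Finset.mem_product, Finset.mem_range, Finset.mem_range]
      exact ⟨by omega, by omega⟩
    rw [Finset.mem_union, Finset.mem_union]
    by_cases h3 : n₁ = n₃
    · subst h3
      have : n₂ = n₄ := Nat.pow_left_injective two_ne_zero (by simp only; omega)
      subst this
      exact Or.inr (Or.inl (Finset.mem_image.2 ⟨_, hBm, rfl⟩))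
    by_cases h4 : n₁ = n₄
    · subst h4
      have : n₂ = n₃ := Nat.pow_left_injective two_ne_zero (by simp only; omega)
      subst this
      exact Or.inr (Or.inr (Finset.mem_image.2 ⟨_, hBm, rfl⟩))
    exact Or.inl (Finset.mem_filter.2 ⟨hq, ⟨hne.1.1, hne.1.2, hne.2.1, hne.2.2⟩, h3, h4⟩)
  have hun : ∀ A A' : Finset (ℕ × ℕ × ℕ × ℕ), ∑ q ∈ A ∪ A', w q ≤ ∑ q ∈ A, w q + ∑ q ∈ A', w q := by
    intro A A'
    rw [← Finset.sum_union_inter]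
    linarith [Finset.sum_nonneg fun q (_ : q ∈ A ∩ A') => hw0 q]
  calc ∑ q ∈ T, w q = ∑ q ∈ T.filter (fun q => w q ≠ 0), w q := (Finset.sum_filter_ne_zero _).symm
    _ ≤ ∑ q ∈ U ∪ (D₁ ∪ D₂), w q := by
        refine Finset.sum_le_sum_of_subset_of_nonneg (fun q hq => ?_) fun q _ _ => hw0 q
        exact hcover q (Finset.mem_filter.1 hq).1 (Finset.mem_filter.1 hq).2
    _ ≤ C₁ * Y ^ 2 * Real.log Y ^ 2 + (C₂ ^ 2 * Y ^ 2 * Real.log Y ^ 2 + C₂ ^ 2 * Y ^ 2 * Real.log Y ^ 2) := by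
        have h1 := hun U (D₁ ∪ D₂)
        have h2 := hun D₁ D₂
        linarith
    _ = _ := by ring

theorem integral_exp_two_pi_int (m : ℤ) :
    (∫ α in (-(1 : ℝ) / 2)..(1 / 2), Complex.exp (2 * Real.pi * Complex.I * m * α)) =
      if m = 0 then 1 else 0 := by
  split_ifs with h
  · subst h
    norm_num
  · have hc : 2 * (Real.pi : ℂ) * Complex.I * m ≠ 0 := by
      refine mul_ne_zero Complex.two_pi_I_ne_zero ?_
      exact_mod_cast h
    rw [integral_exp_mul_complex hc, div_eq_zero_iff, sub_eq_zero]
    left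
    rw [Complex.exp_eq_exp_iff_exists_int]
    refine ⟨m, ?_⟩
    push_cast
    ring

theorem integral_norm_pow_four_sum (c : ℕ → ℝ) (K : ℕ) :
    (∫ α in (-(1 : ℝ) / 2)..(1 / 2), ‖∑ n ∈ Finset.range K,
      (c n : ℂ) * Complex.exp (2 * Real.pi * Complex.I * (n : ℂ) ^ 2 * α)‖ ^ 4) =
    ∑ q ∈ (Finset.range K ×ˢ Finset.range K ×ˢ Finset.range K ×ˢ Finset.range K).filter
      fun q => q.1 ^ 2 + q.2.1 ^ 2 = q.2.2.1 ^ 2 + q.2.2.2 ^ 2,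
      c q.1 * c q.2.1 * (c q.2.2.1 * c q.2.2.2) := by
  set e : ℕ → ℝ → ℂ := fun n α => (c n : ℂ) * Complex.exp (2 * Real.pi * Complex.I * (n : ℂ) ^ 2 * α)
    with he
  have hconj : ∀ n α, (starRingEnd ℂ) (e n α) =
      (c n : ℂ) * Complex.exp (-(2 * Real.pi * Complex.I * (n : ℂ) ^ 2 * α)) := by
    intro n α
    simp only [he, map_mul, Complex.conj_ofReal, ← Complex.exp_conj, map_pow, map_ofNat, Complex.conj_I,
      Complex.conj_natCast]
    congr 2
    ring
  set m : ℕ × ℕ × ℕ × ℕ → ℤ := fun q => (q.1 : ℤ) ^ 2 + q.2.1 ^ 2 - (q.2.2.1 : ℤ) ^ 2 - q.2.2.2 ^ 2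
    with hm
  set w : ℕ × ℕ × ℕ × ℕ → ℝ := fun q => c q.1 * c q.2.1 * (c q.2.2.1 * c q.2.2.2) with hw
  set A := Finset.range K ×ˢ Finset.range K ×ˢ Finset.range K ×ˢ Finset.range K with hA
  have hexpand : ∀ α : ℝ, ((‖∑ n ∈ Finset.range K, e n α‖ ^ 4 : ℝ) : ℂ) =
      ∑ q ∈ A, (w q : ℂ) * Complex.exp (2 * Real.pi * Complex.I * m q * α) := by
    intro α
    set S := ∑ n ∈ Finset.range K, e n α with hS
    have h1 : ((‖S‖ ^ 4 : ℝ) : ℂ) = S * (S * ((starRingEnd ℂ) S * (starRingEnd ℂ) S)) := by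
      have := Complex.mul_conj' S
      push_cast
      calc (‖S‖ : ℂ) ^ 4 = ((‖S‖ : ℂ) ^ 2) * (‖S‖ : ℂ) ^ 2 := by ring
        _ = _ := by rw [← this]; ring
    rw [h1, hS, map_sum, Finset.sum_mul_sum, ← Finset.sum_product', Finset.sum_mul_sum,
      ← Finset.sum_product', Finset.sum_mul_sum, ← Finset.sum_product']
    refine Finset.sum_congr rfl fun q _ => ?_
    rw [hconj, hconj]
    simp only [he, hw, hm]
    push_cast
    rw [show 2 * (Real.pi : ℂ) * Complex.I * ((q.1 : ℂ) ^ 2 + (q.2.1 : ℂ) ^ 2 - (q.2.2.1 : ℂ) ^ 2 -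
        (q.2.2.2 : ℂ) ^ 2) * α = 2 * Real.pi * Complex.I * (q.1 : ℂ) ^ 2 * α +
        (2 * Real.pi * Complex.I * (q.2.1 : ℂ) ^ 2 * α +
        (-(2 * Real.pi * Complex.I * (q.2.2.1 : ℂ) ^ 2 * α) +
          -(2 * Real.pi * Complex.I * (q.2.2.2 : ℂ) ^ 2 * α))) by ring,
      Complex.exp_add, Complex.exp_add, Complex.exp_add]
    ring
  have hint : ((∫ α in (-(1 : ℝ) / 2)..(1 / 2), ‖∑ n ∈ Finset.range K, e n α‖ ^ 4 : ℝ) : ℂ) =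
      ((∑ q ∈ A.filter (fun q => q.1 ^ 2 + q.2.1 ^ 2 = q.2.2.1 ^ 2 + q.2.2.2 ^ 2), w q : ℝ) : ℂ) := by
    rw [← intervalIntegral.integral_ofReal]
    simp only [hexpand]
    rw [intervalIntegral.integral_finsetSum]
    · rw [Finset.sum_filter]
      push_cast
      refine Finset.sum_congr rfl fun q _ => ?_
      rw [intervalIntegral.integral_const_mul, integral_exp_two_pi_int]
      have : m q = 0 ↔ q.1 ^ 2 + q.2.1 ^ 2 = q.2.2.1 ^ 2 + q.2.2.2 ^ 2 := by
        simp only [hm]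
        zify
        constructor <;> intro h <;> linarith
      simp only [this]
      split_ifs <;> simp
    · intro q _
      exact (by fun_prop : Continuous _).intervalIntegrable _ _
  exact Complex.ofReal_injective hint

theorem add_one_pow_three_mul_exp_le (j : ℕ) :
    ((j : ℝ) + 1) ^ 3 * Real.exp (-2 * j) ≤ 27 * (1 / 2) ^ j := by
  have h1 : ((j : ℝ) + 1) ≤ 3 * Real.exp (j / 3) := by
    have := Real.add_one_le_exp ((j : ℝ) / 3)
    have : (0 : ℝ) ≤ j := Nat.cast_nonneg j
    linarith
  have h2 : Real.exp (-1) ≤ 1 / 2 := by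
    have := Real.exp_neg_one_lt_d9
    linarith
  calc ((j : ℝ) + 1) ^ 3 * Real.exp (-2 * j) ≤ (3 * Real.exp (j / 3)) ^ 3 * Real.exp (-2 * j) := by gcongr
    _ = 27 * Real.exp (-1) ^ j := by
        rw [mul_pow, ← Real.exp_nat_mul, ← Real.exp_nat_mul, mul_assoc, ← Real.exp_add]
        push_cast
        ring_nf
    _ ≤ 27 * (1 / 2) ^ j := by gcongr

theorem exists_weighted_sum_solutions_le : ∃ C > (0 : ℝ), ∀ N : ℕ, 4 ≤ N →
    ∀ T : Finset (ℕ × ℕ × ℕ × ℕ), (∀ q ∈ T, q.1 ^ 2 + q.2.1 ^ 2 = q.2.2.1 ^ 2 + q.2.2.2 ^ 2) →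
    ∑ q ∈ T, (ArithmeticFunction.vonMangoldt q.1 * ArithmeticFunction.vonMangoldt q.2.1 *
      (ArithmeticFunction.vonMangoldt q.2.2.1 * ArithmeticFunction.vonMangoldt q.2.2.2)) *
      Real.exp (-2 * ((q.1 : ℝ) ^ 2 + (q.2.1 : ℝ) ^ 2) / N) ≤ C * N * Real.log N ^ 2 := by
  obtain ⟨C, hC, hsol⟩ := exists_sum_solutions_le
  refine ⟨54 * C, by positivity, fun N hN T hT => ?_⟩
  have hN4 : (4 : ℝ) ≤ N := by exact_mod_cast hN
  have hl1 : 1 ≤ Real.log N := by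
    rw [Real.le_log_iff_exp_le (by linarith)]
    have := Real.exp_one_lt_d9
    linarith
  set w : ℕ × ℕ × ℕ × ℕ → ℝ := fun q => ArithmeticFunction.vonMangoldt q.1 *
    ArithmeticFunction.vonMangoldt q.2.1 *
      (ArithmeticFunction.vonMangoldt q.2.2.1 * ArithmeticFunction.vonMangoldt q.2.2.2) with hw
  have hw0 : ∀ q, 0 ≤ w q := fun q => mul_nonneg
    (mul_nonneg ArithmeticFunction.vonMangoldt_nonneg ArithmeticFunction.vonMangoldt_nonneg)
    (mul_nonneg ArithmeticFunction.vonMangoldt_nonneg ArithmeticFunction.vonMangoldt_nonneg)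
  set g : ℕ × ℕ × ℕ × ℕ → ℕ := fun q => (q.1 ^ 2 + q.2.1 ^ 2) / N with hg
  set J := T.sup g + 1 with hJ
  have hmaps : ∀ q ∈ T, g q ∈ Finset.range J := fun q hq => by
    rw [Finset.mem_range, hJ]
    exact Nat.lt_succ_of_le (Finset.le_sup hq)
  have hfib : ∀ j : ℕ, ∑ q ∈ T.filter (fun q => g q = j),
      w q * Real.exp (-2 * ((q.1 : ℝ) ^ 2 + (q.2.1 : ℝ) ^ 2) / N) ≤
      C * N * Real.log N ^ 2 * (27 * (1 / 2) ^ j) := by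
    intro j
    set Y := Nat.sqrt ((j + 1) * N) with hY
    have hY2 : 2 ≤ Y := by
      rw [hY, Nat.le_sqrt]
      nlinarith
    have hYsq : (Y : ℝ) ^ 2 ≤ (j + 1) * N := by
      have := Nat.sqrt_le' ((j + 1) * N)
      exact_mod_cast this
    have hj0 : (0 : ℝ) ≤ j := Nat.cast_nonneg j
    have hY2' : (2 : ℝ) ≤ Y := by exact_mod_cast hY2
    have hlogY : Real.log Y ≤ (j + 1) * Real.log N := by
      have h1 : (Y : ℝ) ≤ (j + 1) * N := by nlinarith
      have h2 := Real.log_le_log (by linarith) h1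
      rw [Real.log_mul (by positivity) (by positivity)] at h2
      have h3 := Real.log_le_sub_one_of_pos (by positivity : (0 : ℝ) < (j : ℝ) + 1)
      nlinarith
    have hlogY0 : 0 ≤ Real.log Y := Real.log_natCast_nonneg Y
    have hgq : ∀ q ∈ T.filter (fun q => g q = j), q ∈ T ∧ j * N ≤ q.1 ^ 2 + q.2.1 ^ 2 ∧
        q.1 ^ 2 + q.2.1 ^ 2 ≤ (j + 1) * N := by
      intro q hq
      obtain ⟨h1, h2⟩ := Finset.mem_filter.1 hq
      simp only [hg] at h2
      refine ⟨h1, ?_, ?_⟩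
      · rw [← h2]; exact Nat.div_mul_le_self _ _
      · rw [← h2, mul_comm]; exact (Nat.lt_mul_div_succ _ (by omega)).le
    have hF := hsol Y hY2 (T.filter fun q => g q = j) fun q hq => by
      obtain ⟨h1, -, h3⟩ := hgq q hq
      have he := hT q h1
      refine ⟨⟨?_, ?_, ?_, ?_⟩, he⟩ <;> rw [hY, Nat.le_sqrt'] <;> omega
    calc ∑ q ∈ T.filter (fun q => g q = j), w q * Real.exp (-2 * ((q.1 : ℝ) ^ 2 + (q.2.1 : ℝ) ^ 2) / N)
        ≤ ∑ q ∈ T.filter (fun q => g q = j), w q * Real.exp (-2 * j) := by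
          refine Finset.sum_le_sum fun q hq => mul_le_mul_of_nonneg_left ?_ (hw0 q)
          obtain ⟨-, h2, -⟩ := hgq q hq
          have h2' : (j : ℝ) * N ≤ (q.1 : ℝ) ^ 2 + (q.2.1 : ℝ) ^ 2 := by exact_mod_cast h2
          rw [Real.exp_le_exp, div_le_iff₀ (by linarith)]
          linarith
      _ = (∑ q ∈ T.filter (fun q => g q = j), w q) * Real.exp (-2 * j) := by rw [Finset.sum_mul]
      _ ≤ (C * Y ^ 2 * Real.log Y ^ 2) * Real.exp (-2 * j) := by gcongr
      _ ≤ (C * ((j + 1) * N) * ((j + 1) * Real.log N) ^ 2) * Real.exp (-2 * j) := by gcongr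
      _ = C * N * Real.log N ^ 2 * (((j : ℝ) + 1) ^ 3 * Real.exp (-2 * j)) := by ring
      _ ≤ C * N * Real.log N ^ 2 * (27 * (1 / 2) ^ j) := by
          exact mul_le_mul_of_nonneg_left (add_one_pow_three_mul_exp_le j) (by positivity)
  rw [← Finset.sum_fiberwise_of_maps_to hmaps]
  calc _ ≤ ∑ j ∈ Finset.range J, C * N * Real.log N ^ 2 * (27 * (1 / 2) ^ j) :=
        Finset.sum_le_sum fun j _ => hfib j
    _ = C * N * Real.log N ^ 2 * (27 * ∑ j ∈ Finset.range J, (1 / 2 : ℝ) ^ j) := by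
        rw [← Finset.mul_sum, ← Finset.mul_sum]
    _ ≤ C * N * Real.log N ^ 2 * (27 * 2) := by
        gcongr
        exact sum_geometric_two_le J
    _ = _ := by ring

theorem summable_vonMangoldt_mul_exp {N : ℕ} (hN : 1 ≤ N) :
    Summable fun n : ℕ => ArithmeticFunction.vonMangoldt n * Real.exp (-(n : ℝ) ^ 2 / N) := by
  have hN' : (1 : ℝ) ≤ N := by exact_mod_cast hN
  have hr : ‖Real.exp (-1 / N)‖ < 1 := by
    rw [Real.norm_eq_abs, abs_of_pos (Real.exp_pos _), Real.exp_lt_one_iff]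
    exact div_neg_of_neg_of_pos (by norm_num) (by linarith)
  refine (summable_pow_mul_geometric_of_norm_lt_one 1 hr).of_nonneg_of_le
    (fun n => mul_nonneg ArithmeticFunction.vonMangoldt_nonneg (Real.exp_pos _).le) fun n => ?_
  have h0 : (0 : ℝ) ≤ n := Nat.cast_nonneg n
  have h1 : ArithmeticFunction.vonMangoldt n ≤ (n : ℝ) ^ 1 := by
    rw [pow_one]
    exact ArithmeticFunction.vonMangoldt_le_log.trans (Real.log_le_self h0)
  have h2 : Real.exp (-(n : ℝ) ^ 2 / N) ≤ Real.exp (-1 / N) ^ n := by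
    rw [← Real.exp_nat_mul, Real.exp_le_exp, mul_div_assoc']
    gcongr
    have : (n : ℝ) ≤ (n : ℝ) ^ 2 := by exact_mod_cast Nat.le_self_pow two_ne_zero n
    linarith
  gcongr

/-- For all sufficiently large `N` (with `L = log N`),
`∫_{−1/2}^{1/2} |S̃₂(α)|⁴ dα ≪ N L²`. -/
theorem Stilde2_fourth_moment :
    ∃ C > (0 : ℝ), ∃ N₀ : ℕ, ∀ N : ℕ, N₀ ≤ N →
      (∫ α in (-(1 : ℝ) / 2)..(1 / 2), ‖Stilde2 N α‖ ^ 4) ≤ C * N * Real.log N ^ 2 := by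
  obtain ⟨C, hC, hsum⟩ := exists_weighted_sum_solutions_le
  refine ⟨C, hC, 4, fun N hN => ?_⟩
  set c : ℕ → ℝ := fun n => ArithmeticFunction.vonMangoldt n * Real.exp (-(n : ℝ) ^ 2 / N) with hc
  have hc0 : ∀ n, 0 ≤ c n := fun n => mul_nonneg ArithmeticFunction.vonMangoldt_nonneg (Real.exp_pos _).le
  have hcs : Summable c := summable_vonMangoldt_mul_exp (by omega)
  set e : ℕ → ℝ → ℂ := fun n α => (c n : ℂ) * Complex.exp (2 * Real.pi * Complex.I * (n : ℂ) ^ 2 * α)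
    with he
  have hnorm : ∀ n α, ‖e n α‖ = c n := by
    intro n α
    have h1 : 2 * (Real.pi : ℂ) * Complex.I * (n : ℂ) ^ 2 * α =
        ((2 * Real.pi * (n : ℝ) ^ 2 * α : ℝ) : ℂ) * Complex.I := by
      push_cast
      ring
    simp only [he]
    rw [norm_mul, h1, Complex.norm_exp_ofReal_mul_I, mul_one, Complex.norm_real, Real.norm_of_nonneg (hc0 n)]
  have hS : ∀ α, Stilde2 N α = ∑' n, e n α := by
    intro α
    refine tsum_congr fun n => ?_
    simp only [he, hc]
    push_cast
    rfl
  have hes : ∀ α, Summable fun n => e n α := fun α =>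
    Summable.of_norm (by simpa only [hnorm] using hcs)
  have hlim : Filter.Tendsto (fun K : ℕ => ∫ α in (-(1 : ℝ) / 2)..(1 / 2),
      ‖∑ n ∈ Finset.range K, e n α‖ ^ 4) Filter.atTop
      (nhds (∫ α in (-(1 : ℝ) / 2)..(1 / 2), ‖Stilde2 N α‖ ^ 4)) := by
    refine intervalIntegral.tendsto_integral_filter_of_dominated_convergence
      (fun _ => (∑' n, c n) ^ 4) ?_ ?_ ?_ ?_
    · refine Filter.Eventually.of_forall fun K => ?_
      exact (by fun_prop : Continuous fun α : ℝ => ‖∑ n ∈ Finset.range K, e n α‖ ^ 4).aestronglyMeasurable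
    · refine Filter.Eventually.of_forall fun K => Filter.Eventually.of_forall fun α _ => ?_
      rw [Real.norm_of_nonneg (by positivity)]
      gcongr
      calc ‖∑ n ∈ Finset.range K, e n α‖ ≤ ∑ n ∈ Finset.range K, c n :=
            (norm_sum_le _ _).trans (le_of_eq (Finset.sum_congr rfl fun n _ => hnorm n α))
        _ ≤ ∑' n, c n := hcs.sum_le_tsum _ fun n _ => hc0 n
    · exact intervalIntegrable_const
    · refine Filter.Eventually.of_forall fun α _ => ?_
      rw [hS]
      exact ((hes α).hasSum.tendsto_sum_nat.norm).pow 4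
  refine le_of_tendsto hlim (Filter.Eventually.of_forall fun K => ?_)
  rw [integral_norm_pow_four_sum]
  set T := (Finset.range K ×ˢ Finset.range K ×ˢ Finset.range K ×ˢ Finset.range K).filter
    fun q => q.1 ^ 2 + q.2.1 ^ 2 = q.2.2.1 ^ 2 + q.2.2.2 ^ 2 with hT
  refine le_trans (le_of_eq ?_) (hsum N hN T fun q hq => (Finset.mem_filter.1 hq).2)
  refine Finset.sum_congr rfl fun q hq => ?_
  have h1 : (q.1 : ℝ) ^ 2 + (q.2.1 : ℝ) ^ 2 = (q.2.2.1 : ℝ) ^ 2 + (q.2.2.2 : ℝ) ^ 2 := by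
    exact_mod_cast (Finset.mem_filter.1 hq).2
  have h2 : -2 * ((q.1 : ℝ) ^ 2 + (q.2.1 : ℝ) ^ 2) / N = -(q.1 : ℝ) ^ 2 / N + (-(q.2.1 : ℝ) ^ 2 / N +
      (-(q.2.2.1 : ℝ) ^ 2 / N + -(q.2.2.2 : ℝ) ^ 2 / N)) := by
    rw [← add_div, ← add_div, ← add_div]
    congr 1
    linarith
  rw [h2, Real.exp_add, Real.exp_add, Real.exp_add]
  simp only [hc]
  ring
end
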